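/- arXiv:1103.3423 — 5 statements merged into one kernel-verified Lean document; each statement's English description precedes it below -/
import Mathlib

section
/- Let X be a finite simplicial complex and let I : |X| → ℝⁿ be a topological embedding with strong combinatorial thickness at least T, for some T > 0. Then for every ε with 0 < ε < T, the closed (T−ε)-neighborhood of I(|X|) admits a retraction onto I(|X|). -/
open scoped Classical
open Metric Set Function

/-- `RetractsOnto B A` : there is a retraction from `B` onto `A`, i.e. a continuous map
`B → A` restricting to the identity on `A`. -/
def RetractsOnto {α : Type*} [TopologicalSpace α] (B A : Set α) : Prop :=
  ∃ r : B → A, Continuous r ∧ ∀ x : B, (x : α) ∈ A → ((r x : α) = (x : α))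

/-- An embedding `I` of the polyhedron of a simplicial complex `X` has strong
combinatorial thickness at least `T` if whenever the open `T`-neighborhoods of the images
of the convex hulls of finitely many faces `Δ 0, …, Δ (J-1)` have a common point,
the faces have a common vertex. -/
def HasStrongCombThickness {E F : Type*} [NormedAddCommGroup E] [NormedSpace ℝ E]
    [NormedAddCommGroup F] [NormedSpace ℝ F]
    (X : Geometry.SimplicialComplex ℝ E) (I : X.space → F) (T : ℝ) : Prop :=
  ∀ (J : ℕ) (Δ : Fin J → Finset E), (∀ j, Δ j ∈ X.faces) →
    (⋂ j : Fin J, Metric.thickening T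
      (I '' {x : X.space | (x : E) ∈ convexHull ℝ ((Δ j : Finset E) : Set E)})).Nonempty →
    ∃ v : E, ∀ j : Fin J, v ∈ Δ j

noncomputable def rcc {E : Type*} (V : Finset E) (Fc : Set (Finset E)) (w : E → ℝ) : ℝ :=
  ∑ σ ∈ V.powerset.filter (fun σ => σ.Nonempty ∧ σ ∉ Fc),
    (if h : σ.Nonempty then σ.inf' h w else 0)

lemma rcc_cont {E : Type*} (V : Finset E) (Fc : Set (Finset E)) : Continuous (rcc V Fc) := by
  unfold rcc
  refine continuous_finset_sum _ fun σ _ => ?_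
  by_cases h : σ.Nonempty
  · simp only [h, dite_true]
    exact Continuous.finset_inf'_apply h (fun i _ => continuous_apply i)
  · simp only [h, dite_false]
    exact continuous_const

lemma rcc_term_nonneg {E : Type*} (w : E → ℝ) (hw : ∀ v, 0 ≤ w v) (σ : Finset E) :
    0 ≤ (if h : σ.Nonempty then σ.inf' h w else 0) := by
  split_ifs with h
  · exact Finset.le_inf' _ _ (fun v _ => hw v)
  · exact le_rfl

lemma rcc_nonneg {E : Type*} (V : Finset E) (Fc : Set (Finset E)) (w : E → ℝ)
    (hw : ∀ v, 0 ≤ w v) : 0 ≤ rcc V Fc w :=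
  Finset.sum_nonneg fun σ _ => rcc_term_nonneg w hw σ

lemma rcc_mem {E : Type*} (V : Finset E) (Fc : Set (Finset E)) (w : E → ℝ)
    (hw : ∀ v, 0 ≤ w v) (s : Finset E) (hs : s.Nonempty) (hsV : s ⊆ V)
    (h : ∀ v ∈ s, rcc V Fc w < w v) : s ∈ Fc := by
  by_contra hn
  have h1 : (if h : s.Nonempty then s.inf' h w else 0) ≤ rcc V Fc w := by
    unfold rcc
    exact Finset.single_le_sum (f := fun σ : Finset E => (if h : σ.Nonempty then σ.inf' h w else 0))
      (fun σ _ => rcc_term_nonneg w hw σ) (by simp [hs, hsV, hn])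
  rw [dif_pos hs] at h1
  have h2 : rcc V Fc w < s.inf' hs w := (Finset.lt_inf'_iff hs).2 h
  linarith

lemma rcc_zero {E : Type*} (V : Finset E) (Fc : Set (Finset E))
    (hdown : ∀ s ∈ Fc, ∀ t, t ⊆ s → t.Nonempty → t ∈ Fc) (w : E → ℝ)
    (hw : ∀ v, 0 ≤ w v) (s : Finset E) (hs : s ∈ Fc) (h : ∀ v, v ∉ s → w v = 0) :
    rcc V Fc w = 0 := by
  refine Finset.sum_eq_zero fun σ hσ => ?_
  simp only [Finset.mem_filter, Finset.mem_powerset] at hσ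
  refine le_antisymm ?_ (rcc_term_nonneg w hw σ)
  have : ¬ σ ⊆ s := fun h' => hσ.2.2 (hdown s hs σ h' hσ.2.1)
  obtain ⟨v, hv, hvs⟩ := Finset.not_subset.1 this
  rw [dif_pos hσ.2.1, ← h v hvs]
  exact Finset.inf'_le _ hv

/-- barycentric coordinates polyhedron -/
def barP {E : Type*} (V : Finset E) (Fc : Set (Finset E)) : Set (E → ℝ) :=
  ⋃ s ∈ Fc, {w | (∀ v, 0 ≤ w v) ∧ (∀ v, v ∉ s → w v = 0) ∧ ∑ v ∈ V, w v = 1}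

lemma barP_compact {E : Type*} (V : Finset E) (Fc : Set (Finset E)) (hf : Fc.Finite)
    (hV : ∀ s ∈ Fc, s ⊆ V) : IsCompact (barP V Fc) := by
  refine hf.isCompact_biUnion fun s hs => ?_
  refine IsCompact.of_isClosed_subset
    (isCompact_univ_pi (fun _ : E => isCompact_Icc (a := (0:ℝ)) (b := 1))) ?_ ?_
  · refine IsClosed.and ?_ (IsClosed.and ?_ ?_)
    · simp only [Set.setOf_forall]
      exact isClosed_iInter fun v => isClosed_le continuous_const (continuous_apply v)
    · simp only [Set.setOf_forall]
      exact isClosed_iInter fun v => isClosed_iInter fun _ =>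
        isClosed_eq (continuous_apply v) continuous_const
    · exact isClosed_eq (continuous_finset_sum _ fun v _ => continuous_apply v) continuous_const
  · rintro w ⟨h0, h1, h2⟩ v -
    refine ⟨h0 v, ?_⟩
    by_cases hv : v ∈ s
    · rw [← h2]
      exact Finset.single_le_sum (fun i _ => h0 i) (hV s hs hv)
    · rw [h1 v hv]; exact zero_le_one

lemma bary_unique {E : Type*} [NormedAddCommGroup E] [NormedSpace ℝ E]
    (s : Finset E) (hs : AffineIndependent ℝ ((↑) : s → E)) (w u : E → ℝ)
    (h1 : ∑ v ∈ s, w v = ∑ v ∈ s, u v) (h2 : ∑ v ∈ s, w v • v = ∑ v ∈ s, u v • v) :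
    ∀ v ∈ s, w v = u v := by
  intro v hv
  have := affineIndependent_iff.1 hs Finset.univ (fun i => w i - u i)
    (by rw [Finset.sum_coe_sort s (fun i => w i - u i), Finset.sum_sub_distrib, h1, sub_self])
    (by rw [Finset.sum_coe_sort s (fun i => (w i - u i) • i)]
        simp only [sub_smul]
        rw [Finset.sum_sub_distrib, h2, sub_self]) ⟨v, hv⟩ (Finset.mem_univ _)
  exact sub_eq_zero.1 this

lemma bary_inj {E : Type*} [NormedAddCommGroup E] [NormedSpace ℝ E]
    (X : Geometry.SimplicialComplex ℝ E) (V : Finset E) (hV : ∀ s ∈ X.faces, s ⊆ V)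
    (w w' : E → ℝ) (hw : w ∈ barP V X.faces) (hw' : w' ∈ barP V X.faces)
    (h : ∑ v ∈ V, w v • v = ∑ v ∈ V, w' v • v) : w = w' := by
  simp only [barP, mem_iUnion, mem_setOf_eq, exists_prop] at hw hw'
  obtain ⟨s, hs, h0, hz, h1⟩ := hw
  obtain ⟨s', hs', h0', hz', h1'⟩ := hw'
  have key : ∀ (t : Finset E) (_ : t ⊆ V) (u : E → ℝ) (_ : ∀ v, v ∉ t → u v = 0),
      ∑ v ∈ t, u v = ∑ v ∈ V, u v ∧ ∑ v ∈ t, u v • v = ∑ v ∈ V, u v • v := by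
    intro t ht u hu
    exact ⟨Finset.sum_subset ht fun v _ hv => hu v hv,
      Finset.sum_subset ht fun v _ hv => by rw [hu v hv, zero_smul]⟩
  have m1 : ∑ v ∈ V, w v • v ∈ convexHull ℝ (s : Set E) := by
    rw [Finset.mem_convexHull']
    exact ⟨w, fun y _ => h0 y, (key s (hV s hs) w hz).1.trans h1, (key s (hV s hs) w hz).2⟩
  have m2 : ∑ v ∈ V, w v • v ∈ convexHull ℝ (s' : Set E) := by
    rw [Finset.mem_convexHull']
    exact ⟨w', fun y _ => h0' y, (key s' (hV s' hs') w' hz').1.trans h1',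
      (key s' (hV s' hs') w' hz').2.trans h.symm⟩
  have m3 := X.inter_subset_convexHull hs hs' ⟨m1, m2⟩
  rw [← Finset.coe_inter, Finset.mem_convexHull'] at m3
  obtain ⟨u, _, hu1, hu2⟩ := m3
  set u' : E → ℝ := fun v => if v ∈ s ∩ s' then u v else 0 with hu'
  have a1 : ∑ v ∈ s ∩ s', u' v = 1 := by
    rw [← hu1]; exact Finset.sum_congr rfl fun v hv => by simp only [hu', if_pos hv]
  have a2 : ∑ v ∈ s ∩ s', u' v • v = ∑ v ∈ V, w v • v := by
    rw [← hu2]; exact Finset.sum_congr rfl fun v hv => by simp only [hu', if_pos hv]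
  have hz2 : ∀ v, v ∉ s ∩ s' → u' v = 0 := fun v hv => by simp only [hu', if_neg hv]
  have k0 := key (s ∩ s') (Finset.inter_subset_left.trans (hV s hs)) u' hz2
  have e1 : ∀ (t : Finset E) (x : E → ℝ) (_ : t ∈ X.faces) (_ : s ∩ s' ⊆ t)
      (_ : ∀ v, v ∉ t → x v = 0) (_ : ∑ v ∈ V, x v = 1)
      (_ : ∑ v ∈ V, x v • v = ∑ v ∈ V, w v • v), x = u' := by
    intro t x ht hst hx hx1 hx2
    have kz : ∀ v, v ∉ t → u' v = 0 := fun v hv => hz2 v fun h => hv (hst h)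
    have k1 := key t (hV t ht) u' kz
    have k2 := key t (hV t ht) x hx
    have := bary_unique t (X.indep ht) x u' (by rw [k1.1, k2.1, ← k0.1, a1, hx1])
      (by rw [k1.2, k2.2, ← k0.2, a2, hx2])
    funext v
    by_cases hv : v ∈ t
    · exact this v hv
    · rw [hx v hv, kz v hv]
  rw [e1 s w hs Finset.inter_subset_left hz h1 rfl,
    e1 s' w' hs' Finset.inter_subset_right hz' h1' h.symm]

/-- normalisation -/
noncomputable def rnorm {E : Type*} (V : Finset E) (Fc : Set (Finset E)) (x : E → ℝ) : E → ℝ :=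
  fun v => (if v ∈ V then max 0 (x v - rcc V Fc x) else 0) / ∑ u ∈ V, max 0 (x u - rcc V Fc x)

def rgood {E : Type*} (V : Finset E) (Fc : Set (Finset E)) : Set (E → ℝ) :=
  {x | ∃ v ∈ V, rcc V Fc x < x v}

lemma rgood_open {E : Type*} (V : Finset E) (Fc : Set (Finset E)) : IsOpen (rgood V Fc) := by
  have : rgood V Fc = ⋃ v ∈ V, {x | rcc V Fc x < x v} := by ext; simp [rgood]
  rw [this]
  exact isOpen_biUnion fun v _ => isOpen_lt (rcc_cont V Fc) (continuous_apply v)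

lemma rsum_pos {E : Type*} (V : Finset E) (Fc : Set (Finset E)) (x : E → ℝ)
    (hx : x ∈ rgood V Fc) : 0 < ∑ u ∈ V, max 0 (x u - rcc V Fc x) := by
  obtain ⟨v, hv, h⟩ := hx
  exact Finset.sum_pos' (fun _ _ => le_max_left _ _)
    ⟨v, hv, lt_max_of_lt_right (sub_pos.2 h)⟩

lemma rnorm_cont {E : Type*} (V : Finset E) (Fc : Set (Finset E)) :
    ContinuousOn (rnorm V Fc) (rgood V Fc) := by
  have hc := rcc_cont V Fc
  refine continuousOn_pi.2 fun v => ?_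
  refine ContinuousOn.div ?_ ?_ fun x hx => (rsum_pos V Fc x hx).ne'
  · by_cases hv : v ∈ V
    · simp only [hv, if_true]
      exact (continuous_const.max ((continuous_apply v).sub hc)).continuousOn
    · simp only [hv, if_false]
      exact continuousOn_const
  · exact (continuous_finset_sum _ fun u _ =>
      continuous_const.max ((continuous_apply u).sub hc)).continuousOn

lemma rnorm_mem {E : Type*} (V : Finset E) (Fc : Set (Finset E)) (x : E → ℝ)
    (hx0 : ∀ v, 0 ≤ x v) (hx : x ∈ rgood V Fc) : rnorm V Fc x ∈ barP V Fc := by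
  have hpos := rsum_pos V Fc x hx
  simp only [barP, mem_iUnion, mem_setOf_eq, exists_prop]
  refine ⟨V.filter (fun v => rcc V Fc x < x v), ?_, ?_, ?_, ?_⟩
  · refine rcc_mem V Fc x hx0 _ ?_ (Finset.filter_subset _ _) fun v hv => (Finset.mem_filter.1 hv).2
    obtain ⟨v, hv, h⟩ := hx
    exact ⟨v, Finset.mem_filter.2 ⟨hv, h⟩⟩
  · intro v
    refine div_nonneg ?_ hpos.le
    split_ifs
    · exact le_max_left _ _
    · exact le_rfl
  · intro v hv
    unfold rnorm
    split_ifs with h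
    · have : x v ≤ rcc V Fc x := by
        by_contra h'
        exact hv (Finset.mem_filter.2 ⟨h, not_le.1 h'⟩)
      rw [max_eq_left (by linarith), zero_div]
    · exact zero_div _
  · unfold rnorm
    rw [← Finset.sum_div, div_eq_one_iff_eq hpos.ne']
    exact Finset.sum_congr rfl fun v hv => if_pos hv

lemma rnorm_id {E : Type*} (V : Finset E) (Fc : Set (Finset E)) (hV : ∀ s ∈ Fc, s ⊆ V)
    (hdown : ∀ s ∈ Fc, ∀ t, t ⊆ s → t.Nonempty → t ∈ Fc) (x : E → ℝ)
    (hx : x ∈ barP V Fc) : rnorm V Fc x = x := by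
  simp only [barP, mem_iUnion, mem_setOf_eq, exists_prop] at hx
  obtain ⟨s, hs, h0, hz, h1⟩ := hx
  have hc := rcc_zero V Fc hdown x h0 s hs hz
  funext v
  simp only [rnorm, hc, sub_zero, max_eq_right (h0 _), h1, div_one]
  split_ifs with h
  · rfl
  · exact (hz v fun h' => h (hV s hs h')).symm

theorem statement13 {E : Type*} [NormedAddCommGroup E] [NormedSpace ℝ E] (n : ℕ)
    (X : Geometry.SimplicialComplex ℝ E) (hXfin : X.faces.Finite)
    (I : X.space → EuclideanSpace ℝ (Fin n))
    (hIc : Continuous I) (hIinj : Function.Injective I)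
    (T : ℝ) (hT : 0 < T) (hstrong : HasStrongCombThickness X I T)
    (ε : ℝ) (hε : 0 < ε) (hεT : ε < T) :
    RetractsOnto (Metric.cthickening (T - ε) (Set.range I)) (Set.range I) := by
  set V : Finset E := hXfin.toFinset.biUnion id with hVdef
  have hV : ∀ s ∈ X.faces, s ⊆ V := fun s hs v hv =>
    Finset.mem_biUnion.2 ⟨s, hXfin.mem_toFinset.2 hs, hv⟩
  have hdown : ∀ s ∈ X.faces, ∀ t, t ⊆ s → t.Nonempty → t ∈ X.faces :=
    fun s hs t hts ht => X.down_closed hs hts ht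
  have hPc := barP_compact V X.faces hXfin hV
  set P := barP V X.faces with hP
  -- realisation
  have hull : ∀ w ∈ P, ∀ s ∈ X.faces, (∀ v, v ∉ s → w v = 0) →
      ∑ v ∈ V, w v • v ∈ convexHull ℝ (s : Set E) := by
    intro w hw s hs hz
    simp only [hP, barP, mem_iUnion, mem_setOf_eq, exists_prop] at hw
    obtain ⟨_, _, h0, _, h1⟩ := hw
    rw [Finset.mem_convexHull']
    exact ⟨w, fun y _ => h0 y, (Finset.sum_subset (hV s hs) fun v _ hv => hz v hv).trans h1,
      Finset.sum_subset (hV s hs) fun v _ hv => by rw [hz v hv, zero_smul]⟩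
  have hsp : ∀ w ∈ P, ∑ v ∈ V, w v • v ∈ X.space := by
    intro w hw
    have hw' := hw
    simp only [hP, barP, mem_iUnion, mem_setOf_eq, exists_prop] at hw'
    obtain ⟨s, hs, h0, hz, h1⟩ := hw'
    exact X.convexHull_subset_space hs (hull w hw s hs hz)
  let ψ : P → X.space := fun w => ⟨∑ v ∈ V, (w : E → ℝ) v • v, hsp w w.2⟩
  have hψc : Continuous ψ := by
    refine Continuous.subtype_mk (continuous_finset_sum _ fun v _ => ?_) _
    exact ((continuous_apply v).comp continuous_subtype_val).smul continuous_const
  have hψi : Injective ψ := fun w w' h =>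
    Subtype.ext (bary_inj X V hV w w' w.2 w'.2 (congrArg Subtype.val h))
  have hψs : Surjective ψ := by
    rintro ⟨x, hx⟩
    obtain ⟨s, hs, hxs⟩ := Geometry.SimplicialComplex.mem_space_iff.1 hx
    rw [Finset.mem_convexHull'] at hxs
    obtain ⟨u, hu0, hu1, hu2⟩ := hxs
    have e1 : ∑ v ∈ V, (if v ∈ s then u v else 0) = 1 := by
      rw [← hu1, ← Finset.sum_subset (hV s hs) fun v _ hv => if_neg hv]
      exact Finset.sum_congr rfl fun v hv => if_pos hv
    refine ⟨⟨fun v => if v ∈ s then u v else 0, ?_⟩, ?_⟩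
    · simp only [hP, barP, mem_iUnion, mem_setOf_eq, exists_prop]
      refine ⟨s, hs, fun v => ?_, fun v hv => if_neg hv, e1⟩
      split_ifs with h
      · exact hu0 v h
      · exact le_rfl
    · refine Subtype.ext ?_
      show ∑ v ∈ V, (if v ∈ s then u v else 0) • v = x
      rw [← hu2, ← Finset.sum_subset (hV s hs) fun v _ hv => by rw [if_neg hv, zero_smul]]
      exact Finset.sum_congr rfl fun v hv => by rw [if_pos hv]
  haveI : CompactSpace P := isCompact_iff_compactSpace.1 hPc
  let φ : P → EuclideanSpace ℝ (Fin n) := I ∘ ψ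
  have hφc : Continuous φ := hIc.comp hψc
  have hφe : Topology.IsClosedEmbedding φ := hφc.isClosedEmbedding (hIinj.comp hψi)
  have hφr : range φ = range I := hψs.range_comp I
  have hKc : IsCompact (range I) := hφr ▸ isCompact_range hφc
  obtain ⟨F0, hF0⟩ := ContinuousMap.exists_extension hφe
    (⟨Subtype.val, continuous_subtype_val⟩ : C(P, E → ℝ))
  have hF0' : ∀ w : P, F0 (φ w) = w := fun w => DFunLike.congr_fun hF0 w
  have hPnn : ∀ w ∈ P, ∀ v, 0 ≤ w v := by
    intro w hw
    simp only [hP, barP, mem_iUnion, mem_setOf_eq, exists_prop] at hw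
    obtain ⟨_, _, h0, _⟩ := hw
    exact h0
  let F : EuclideanSpace ℝ (Fin n) → E → ℝ := fun p v => max 0 (F0 p v)
  have hFc : Continuous F := continuous_pi fun v =>
    continuous_const.max ((continuous_apply v).comp F0.continuous)
  have hFφ : ∀ w : P, F (φ w) = w := fun w => by
    funext v
    simp only [F, hF0']
    exact max_eq_right (hPnn w w.2 v)
  -- the simplices
  let S : Finset E → Set (EuclideanSpace ℝ (Fin n)) := fun s =>
    I '' {x : X.space | (x : E) ∈ convexHull ℝ (s : Set E)}
  have hSne : ∀ s ∈ X.faces, (S s).Nonempty := by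
    intro s hs
    obtain ⟨v, hv⟩ := X.nonempty_of_mem_faces hs
    have hv' : v ∈ convexHull ℝ (s : Set E) := subset_convexHull ℝ _ hv
    exact ⟨_, ⟨v, X.convexHull_subset_space hs hv'⟩, hv', rfl⟩
  let h : EuclideanSpace ℝ (Fin n) → E → ℝ := fun p v =>
    if v ∈ V then
    ∏ s ∈ hXfin.toFinset.filter (fun s => v ∉ s), max 0 (infDist p (S s) - (T - ε)) else 0
  have hhc : Continuous h := by
    refine continuous_pi fun v => ?_
    by_cases hv : v ∈ V
    · simp only [h, hv, if_true]
      exact continuous_finset_prod _ fun s _ =>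
        continuous_const.max ((continuous_infDist_pt _).sub continuous_const)
    · simp only [h, hv, if_false]
      exact continuous_const
  have hhnn : ∀ p v, 0 ≤ h p v := by
    intro p v
    simp only [h]
    split_ifs
    · exact Finset.prod_nonneg fun s _ => le_max_left _ _
    · exact le_rfl
  have hhz : ∀ p, ∀ s ∈ X.faces, infDist p (S s) ≤ T - ε → ∀ v, v ∉ s → h p v = 0 := by
    intro p s hs hd v hv
    simp only [h]
    split_ifs
    · refine Finset.prod_eq_zero (i := s) (by simp [hs, hv]) (max_eq_left (by linarith))
    · rfl
  have hNface : ∀ p ∈ cthickening (T - ε) (range I), ∃ s ∈ X.faces, infDist p (S s) ≤ T - ε := by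
    intro p hp
    rw [hKc.cthickening_eq_biUnion_closedBall (by linarith)] at hp
    simp only [mem_iUnion, exists_prop] at hp
    obtain ⟨_, ⟨x, rfl⟩, hd⟩ := hp
    obtain ⟨s, hs, hxs⟩ := Geometry.SimplicialComplex.mem_space_iff.1 x.2
    exact ⟨s, hs, (infDist_le_dist_of_mem (mem_image_of_mem I hxs)).trans hd⟩
  have hhpos : ∀ p ∈ cthickening (T - ε) (range I), ∃ v ∈ V, 0 < h p v := by
    intro p hp
    obtain ⟨s0, hs0, hd0⟩ := hNface p hp
    set L := hXfin.toFinset.filter (fun s => infDist p (S s) ≤ T - ε) with hL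
    have hLm : ∀ s, s ∈ L ↔ s ∈ X.faces ∧ infDist p (S s) ≤ T - ε := by
      intro s; simp [hL]
    obtain ⟨v, hv⟩ := hstrong L.card (fun j => (L.equivFin.symm j : Finset E))
      (fun j => ((hLm _).1 (L.equivFin.symm j).2).1)
      ⟨p, mem_iInter.2 fun j => by
        have := (hLm _).1 (L.equivFin.symm j).2
        exact (mem_thickening_iff_infDist_lt (hSne _ this.1)).2 (by linarith [this.2])⟩
    have hv' : ∀ s ∈ L, v ∈ s := fun s hs => by simpa using hv (L.equivFin ⟨s, hs⟩)
    have hvV : v ∈ V := hV s0 hs0 (hv' s0 ((hLm _).2 ⟨hs0, hd0⟩))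
    refine ⟨v, hvV, ?_⟩
    simp only [h, if_pos hvV]
    refine Finset.prod_pos fun s hs => lt_max_of_lt_right ?_
    simp only [Finset.mem_filter, Finite.mem_toFinset] at hs
    by_contra hcon
    exact hs.2 (hv' s ((hLm s).2 ⟨hs.1, by linarith⟩))
  -- goodness criterion
  have good : ∀ x : E → ℝ, (∀ v, 0 ≤ x v) → (∃ s ∈ X.faces, ∀ v, v ∉ s → x v = 0) →
      (∃ v ∈ V, 0 < x v) → x ∈ rgood V X.faces := by
    rintro x hx ⟨s, hs, hz⟩ ⟨v, hv, hpos⟩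
    exact ⟨v, hv, by rwa [rcc_zero V X.faces hdown x hx s hs hz]⟩
  let Φ : EuclideanSpace ℝ (Fin n) × ℝ → E → ℝ := fun q v => (1 - q.2) * F q.1 v + q.2 * h q.1 v
  have hΦc : Continuous Φ := by
    refine continuous_pi fun v => ?_
    exact ((continuous_const.sub continuous_snd).mul
      ((continuous_apply v).comp (hFc.comp continuous_fst))).add
      (continuous_snd.mul ((continuous_apply v).comp (hhc.comp continuous_fst)))
  have hΦnn : ∀ p, ∀ t ∈ Icc (0:ℝ) 1, ∀ v, 0 ≤ Φ (p, t) v := by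
    intro p t ht v
    exact add_nonneg (mul_nonneg (by linarith [ht.2]) (le_max_left _ _))
      (mul_nonneg ht.1 (hhnn p v))
  have hKN : range I ⊆ cthickening (T - ε) (range I) := self_subset_cthickening _
  have hΦK : range I ×ˢ Icc (0:ℝ) 1 ⊆ Φ ⁻¹' rgood V X.faces := by
    rintro ⟨p, t⟩ ⟨hp, ht⟩
    have hp' := hp
    simp only at hp hp' ht
    rw [← hφr] at hp
    obtain ⟨w, rfl⟩ := hp
    have hw := w.2
    simp only [hP, barP, mem_iUnion, mem_setOf_eq, exists_prop] at hw
    obtain ⟨s, hs, h0, hz, h1⟩ := hw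
    have hd : infDist (φ w) (S s) ≤ T - ε := by
      have : φ w ∈ S s := ⟨ψ w, hull w w.2 s hs hz, rfl⟩
      rw [infDist_zero_of_mem this]; linarith
    refine good _ (hΦnn _ t ht) ⟨s, hs, fun v hv => ?_⟩ ?_
    · simp only [Φ, hFφ, hz v hv, hhz _ s hs hd v hv, mul_zero, add_zero]
    · rcases eq_or_lt_of_le ht.2 with rfl | ht1
      · obtain ⟨v, hv, hpos⟩ := hhpos _ (hKN hp')
        exact ⟨v, hv, by simpa [Φ] using hpos⟩
      · have : ∃ v ∈ V, 0 < (w : E → ℝ) v := by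
          by_contra hcon
          push Not at hcon
          have := Finset.sum_nonpos hcon
          linarith
        obtain ⟨v, hv, hpos⟩ := this
        refine ⟨v, hv, ?_⟩
        simp only [Φ, hFφ]
        exact add_pos_of_pos_of_nonneg (mul_pos (by linarith) hpos) (mul_nonneg ht.1 (hhnn _ v))
  obtain ⟨U, W, hU, hW, hKU, hIW, hUW⟩ := generalized_tube_lemma hKc isCompact_Icc
    ((rgood_open V X.faces).preimage hΦc) hΦK
  obtain ⟨τ, hτ0, hτ1, hτ⟩ := exists_continuous_zero_one_of_isClosed hKc.isClosed
    hU.isClosed_compl (disjoint_compl_right_iff_subset.2 hKU)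
  let G : cthickening (T - ε) (range I) → E → ℝ := fun p => Φ (p, τ p)
  have hGc : Continuous G := hΦc.comp (continuous_subtype_val.prodMk
    (τ.continuous.comp continuous_subtype_val))
  have hGg : ∀ p, G p ∈ rgood V X.faces := by
    rintro ⟨p, hp⟩
    by_cases hpU : p ∈ U
    · exact hUW (Set.mk_mem_prod hpU (hIW (hτ p)))
    · have h1 : τ p = 1 := hτ1 hpU
      have : G ⟨p, hp⟩ = h p := by
        funext v; simp [G, Φ, h1]
      rw [this]
      obtain ⟨s, hs, hd⟩ := hNface p hp
      exact good _ (hhnn p) ⟨s, hs, hhz p s hs hd⟩ (hhpos p hp)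
  have hGm : ∀ p, rnorm V X.faces (G p) ∈ P := fun p =>
    rnorm_mem V X.faces _ (hΦnn _ _ (hτ _)) (hGg p)
  have hrc : Continuous fun p => (⟨rnorm V X.faces (G p), hGm p⟩ : P) :=
    Continuous.subtype_mk ((rnorm_cont V X.faces).comp_continuous hGc hGg) _
  refine ⟨fun p => ⟨φ ⟨rnorm V X.faces (G p), hGm p⟩, hφr ▸ mem_range_self _⟩,
    Continuous.subtype_mk (hφc.comp hrc) _, ?_⟩
  rintro ⟨p, hpN⟩ hp
  have h0 : τ p = 0 := hτ0 hp
  simp only at hp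
  rw [← hφr] at hp
  obtain ⟨w, rfl⟩ := hp
  have hG : G ⟨φ w, hpN⟩ = w := by
    funext v; simp [G, Φ, h0, hFφ]
  have : (⟨rnorm V X.faces (G ⟨φ w, hpN⟩), hGm _⟩ : P) = w := by
    refine Subtype.ext ?_
    show rnorm V X.faces (G ⟨φ w, hpN⟩) = w
    rw [hG]
    exact rnorm_id V X.faces hV hdown _ w.2
  exact congrArg φ this
end

section
/- Let k ≥ 0 and n ≥ 2k+1, let L ≥ 1 and ε > 0. There is a constant C(n,L,ε) > 0 with the following property: for every finite k-dimensional simplicial complex X with N ≥ 2 faces in which every vertex lies in at most L faces, there exists a topological embedding I of |X| into the closed ball of radius C(n,L,ε)·N^{1/(n−k)+ε} in ℝⁿ such that the closed 1-neighborhood of I(|X|) admits a retraction onto I(|X|). -/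
open scoped Classical
open Metric Set Function

lemma tk_count {ι β : Type} [Fintype ι] [DecidableEq ι] [Fintype β] (A B C : Finset (ι → β)) (v : ι) (c : ℕ)
    (hC : ∀ F ∈ C, F ∈ A ∧ F ∈ B)
    (hB : ∀ F ∈ B, ∀ a, update F v a ∈ B)
    (hA : ∀ F : ι → β, (Finset.univ.filter (fun a => update F v a ∈ A)).card ≤ c) :
    C.card * Fintype.card β ≤ c * B.card := by
  have h1 : (C ×ˢ (Finset.univ : Finset β)).card ≤
      (B.sigma (fun F => Finset.univ.filter (fun a => update F v a ∈ A))).card := by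
    apply Finset.card_le_card_of_injOn
      (fun p => (⟨update p.1 v p.2, p.1 v⟩ : (_ : ι → β) × β))
    · rintro ⟨F, a⟩ h
      simp only [Finset.coe_product, Set.mem_prod, Finset.mem_coe, Set.mem_univ] at h
      simp only [Finset.mem_coe, Finset.mem_sigma, Finset.mem_filter, Finset.mem_univ, true_and]
      exact ⟨hB _ (hC _ h.1).2 _, by simpa using (hC _ h.1).1⟩
    · rintro ⟨F, a⟩ - ⟨F', a'⟩ - h
      simp only [Sigma.mk.injEq, heq_eq_eq] at h
      obtain ⟨h1, h2⟩ := h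
      have ha : a = a' := by simpa using congrFun h1 v
      have hF : F = F' := by
        funext w
        by_cases hw : w = v
        · subst hw; exact h2
        · simpa [hw] using congrFun h1 w
      rw [ha, hF]
  rw [Finset.card_product, Finset.card_univ] at h1
  refine h1.trans ?_
  rw [Finset.card_sigma]
  calc _ ≤ ∑ F ∈ B, c := Finset.sum_le_sum (fun F _ => hA F)
    _ = c * B.card := by simp [mul_comm]

/-- affine independence, hands-on -/
def tkAI {Z : Type} {n : ℕ} (S : Finset Z) (G : Z → Fin n → ℤ) : Prop :=
  ∀ l : Z → ℝ, ∑ z ∈ S, l z = 0 → (∀ j, ∑ z ∈ S, l z * (G z j : ℝ) = 0) → ∀ z ∈ S, l z = 0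

lemma tk_func {Z : Type} {n : ℕ} (hn : 1 ≤ n) (S : Finset Z) (G : Z → Fin n → ℤ)
    (hS : S.card ≤ n) :
    ∃ l : Fin n → ℝ, ∃ b : ℝ, l ≠ 0 ∧ ∀ z ∈ S, ∑ j, l j * (G z j : ℝ) = b := by
  rcases S.eq_empty_or_nonempty with rfl | ⟨z0, hz0⟩
  · refine ⟨fun _ => 1, 0, ?_, by simp⟩
    intro h
    have := congrFun h ⟨0, hn⟩
    simp at this
  · let f : (Fin n → ℝ) →ₗ[ℝ] ({z // z ∈ S.erase z0} → ℝ) :=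
      { toFun := fun l z => ∑ j, l j * ((G z j : ℝ) - G z0 j)
        map_add' := by intro x y; ext z; simp [add_mul, Finset.sum_add_distrib]
        map_smul' := by intro r x; ext z; simp [Finset.mul_sum, mul_assoc] }
    have hk : LinearMap.ker f ≠ ⊥ := by
      apply LinearMap.ker_ne_bot_of_finrank_lt
      have := Finset.card_erase_of_mem hz0
      simp [Module.finrank_fintype_fun_eq_card]
      have h0 : 0 < S.card := Finset.card_pos.2 ⟨z0, hz0⟩
      omega
    obtain ⟨l, hl, hl0⟩ := Submodule.exists_mem_ne_zero_of_ne_bot hk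
    refine ⟨l, ∑ j, l j * (G z0 j : ℝ), hl0, ?_⟩
    intro z hz
    by_cases h : z = z0
    · rw [h]
    · have := congrFun (LinearMap.mem_ker.1 hl) ⟨z, Finset.mem_erase.2 ⟨h, hz⟩⟩
      simp only [f, LinearMap.coe_mk, AddHom.coe_mk, mul_sub, Finset.sum_sub_distrib,
        Pi.zero_apply] at this
      linarith

lemma tk_avoid {n Q : ℕ} (A : Finset ((Fin n → ℝ) × ℝ)) (hA : A.card < Q)
    (hA0 : ∀ p ∈ A, p.1 ≠ 0) (o : Fin n → ℤ) :
    ∃ g : Fin n → ℤ, (∀ j, o j ≤ g j ∧ g j < o j + Q) ∧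
      ∀ p ∈ A, ∑ j, p.1 j * (g j : ℝ) ≠ p.2 := by
  by_contra hcon
  push Not at hcon
  let bad : (Fin n → ℝ) × ℝ → Finset (Fin n → Fin Q) := fun p =>
    Finset.univ.filter (fun u => ∑ j, p.1 j * ((o j + (u j : ℕ) : ℤ) : ℝ) = p.2)
  have hcov : (Finset.univ : Finset (Fin n → Fin Q)) ⊆ A.biUnion bad := by
    intro u _
    obtain ⟨p, hp, he⟩ := hcon (fun j => o j + ((u j : ℕ) : ℤ))
      (fun j => ⟨by simp, by have := (u j).2; simp⟩)
    rw [Finset.mem_biUnion]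
    exact ⟨p, hp, by simpa [bad] using he⟩
  have hQ : 0 < Q := by omega
  have hbad : ∀ p ∈ A, (bad p).card * Q ≤ Q ^ n := by
    intro p hp
    obtain ⟨j0, hj0⟩ := Function.ne_iff.1 (hA0 p hp)
    have := tk_count (bad p) Finset.univ (bad p) j0 1 (by simp) (by simp) (by
      intro F
      rw [Finset.card_le_one]
      intro a ha b hb
      simp only [bad, Finset.mem_filter, Finset.mem_univ, true_and] at ha hb
      have h := ha.trans hb.symm
      rw [← Finset.add_sum_erase _ _ (Finset.mem_univ j0),
        ← Finset.add_sum_erase _ _ (Finset.mem_univ j0)] at h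
      have he : ∀ c : Fin Q, ∑ j ∈ Finset.univ.erase j0,
          p.1 j * ((o j + ((update F j0 c j : Fin Q) : ℕ) : ℤ) : ℝ) =
          ∑ j ∈ Finset.univ.erase j0, p.1 j * ((o j + ((F j : Fin Q) : ℕ) : ℤ) : ℝ) := by
        intro c
        apply Finset.sum_congr rfl
        intro j hj
        rw [update_of_ne (Finset.ne_of_mem_erase hj)]
      rw [he, he] at h
      simp only [update_self] at h
      have h2 := mul_left_cancel₀ hj0 (add_right_cancel h)
      have h3 : o j0 + ((a : ℕ) : ℤ) = o j0 + ((b : ℕ) : ℤ) := by exact_mod_cast h2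
      apply Fin.ext
      omega)
    simpa using this
  have h1 : Q ^ n ≤ ∑ p ∈ A, (bad p).card := by
    have := (Finset.card_le_card hcov).trans Finset.card_biUnion_le
    simpa using this
  have h2 : Q ^ n * Q ≤ A.card * Q ^ n := by
    calc Q ^ n * Q ≤ (∑ p ∈ A, (bad p).card) * Q := Nat.mul_le_mul_right _ h1
      _ = ∑ p ∈ A, (bad p).card * Q := Finset.sum_mul _ _ _
      _ ≤ ∑ p ∈ A, Q ^ n := Finset.sum_le_sum hbad
      _ = _ := by simp
  have h3 : 0 < Q ^ n := by positivity
  rw [mul_comm] at h2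
  have := Nat.le_of_mul_le_mul_right h2 h3
  omega

lemma tk_genpos {n : ℕ} (hn : 1 ≤ n) (M : ℕ) {Z : Type} [Fintype Z] (near : Z → Z → Prop)
    (hM : ∀ z, (Finset.univ.filter (fun w => near z w)).card ≤ M) (o : Z → Fin n → ℤ) :
    ∃ G : Z → Fin n → ℤ, (∀ z j, o z j ≤ G z j ∧ G z j < o z j + ((2 ^ M + 1 : ℕ) : ℤ)) ∧
      ∀ S : Finset Z, S.card ≤ n + 1 → (∀ z ∈ S, ∀ w ∈ S, near z w) → tkAI S G := by
  suffices H : ∀ s : Finset Z, ∃ G : Z → Fin n → ℤ,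
      (∀ z j, o z j ≤ G z j ∧ G z j < o z j + ((2 ^ M + 1 : ℕ) : ℤ)) ∧
      ∀ S : Finset Z, S ⊆ s → S.card ≤ n + 1 → (∀ z ∈ S, ∀ w ∈ S, near z w) → tkAI S G by
    obtain ⟨G, h1, h2⟩ := H Finset.univ
    exact ⟨G, h1, fun S => h2 S (Finset.subset_univ _)⟩
  intro s
  induction s using Finset.induction_on with
  | empty =>
    refine ⟨o, fun z j => ⟨le_rfl, by push_cast; have : (0:ℤ) < 2 ^ M := by positivity
                                      linarith⟩, ?_⟩
    intro S hS _ _ l _ _ z hz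
    have := hS hz
    simp at this
  | insert z s hz ih =>
    obtain ⟨G, hG1, hG2⟩ := ih
    choose! l b hl hb using fun (S : Finset Z) (h : S.card ≤ n) => tk_func hn S G h
    let A : Finset ((Fin n → ℝ) × ℝ) :=
      (((Finset.univ.filter (fun w => near z w)).powerset).filter
        (fun S => S.card ≤ n)).image (fun S => (l S, b S))
    obtain ⟨g, hg1, hg2⟩ := tk_avoid (Q := 2 ^ M + 1) A (by
      refine Nat.lt_succ_of_le (Finset.card_image_le.trans ((Finset.card_filter_le _ _).trans ?_))
      rw [Finset.card_powerset]
      exact Nat.pow_le_pow_right (by norm_num) (hM z)) (by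
      intro p hp
      simp only [A, Finset.mem_image, Finset.mem_filter] at hp
      obtain ⟨S, hS, rfl⟩ := hp
      exact hl S hS.2) (o z)
    refine ⟨update G z g, ?_, ?_⟩
    · intro w j
      by_cases hw : w = z
      · subst hw; simpa using hg1 j
      · simpa [hw] using hG1 w j
    · intro S hS hcard hnear
      have hoff : ∀ w, w ≠ z → update G z g w = G w := fun w hw => update_of_ne hw _ _
      by_cases hzS : z ∈ S
      · intro c hc0 hc1
        have hE : (S.erase z).card ≤ n := by rw [Finset.card_erase_of_mem hzS]; omega
        have hsub : S.erase z ⊆ s := fun w hw =>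
          (Finset.mem_insert.1 (hS (Finset.mem_of_mem_erase hw))).resolve_left
            (Finset.ne_of_mem_erase hw)
        have hcz : c z = 0 := by
          have hne := hg2 (l (S.erase z), b (S.erase z)) (by
            simp only [A, Finset.mem_image, Finset.mem_filter, Finset.mem_powerset]
            refine ⟨_, ⟨?_, hE⟩, rfl⟩
            intro w hw
            simp only [Finset.mem_filter, Finset.mem_univ, true_and]
            exact hnear z hzS w (Finset.mem_of_mem_erase hw))
          have key : ∑ w ∈ S, c w * (∑ j, l (S.erase z) j * (update G z g w j : ℝ)
              - b (S.erase z)) = 0 := by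
            simp only [mul_sub, Finset.sum_sub_distrib, ← Finset.sum_mul, hc0, zero_mul, sub_zero,
              Finset.mul_sum]
            rw [Finset.sum_comm]
            apply Finset.sum_eq_zero
            intro j _
            have := hc1 j
            calc _ = ∑ w ∈ S, l (S.erase z) j * (c w * (update G z g w j : ℝ)) := by
                  apply Finset.sum_congr rfl; intros; ring
              _ = 0 := by rw [← Finset.mul_sum, this, mul_zero]
          rw [← Finset.add_sum_erase _ _ hzS, Finset.sum_eq_zero (s := S.erase z), add_zero] at key
          · rcases mul_eq_zero.1 key with h | h
            · exact h
            · exfalso; apply hne; simp only [update_self] at h; linarith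
          · intro w hw
            rw [hoff w (Finset.ne_of_mem_erase hw), hb _ hE w hw, sub_self, mul_zero]
        have hAI := hG2 (S.erase z) hsub (by omega) (fun a ha b hb =>
          hnear a (Finset.mem_of_mem_erase ha) b (Finset.mem_of_mem_erase hb)) c
          (by rw [← Finset.add_sum_erase _ _ hzS, hcz, zero_add] at hc0; exact hc0)
          (by
            intro j
            have := hc1 j
            rw [← Finset.add_sum_erase _ _ hzS, hcz, zero_mul, zero_add] at this
            rw [← this]
            apply Finset.sum_congr rfl
            intro w hw
            rw [hoff w (Finset.ne_of_mem_erase hw)])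
        intro w hw
        by_cases h : w = z
        · rw [h, hcz]
        · exact hAI w (Finset.mem_erase.2 ⟨h, hw⟩)
      · have hsub : S ⊆ s := fun w hw =>
          (Finset.mem_insert.1 (hS hw)).resolve_left (fun h => hzS (h ▸ hw))
        have hAI := hG2 S hsub hcard hnear
        intro c hc0 hc1
        refine hAI c hc0 (fun j => ?_)
        rw [← hc1 j]
        apply Finset.sum_congr rfl
        intro w hw
        rw [hoff w (fun h => hzS (h ▸ hw))]

lemma tk_quant (n D : ℕ) : ∃ K : ℝ, 0 < K ∧ ∀ (Z : Type) (S : Finset Z) (G : Z → Fin n → ℤ),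
    S.card ≤ n + 1 → (∀ z ∈ S, ∀ w ∈ S, ∀ j, |G z j - G w j| ≤ (D : ℤ)) → tkAI S G →
    ∀ l : Z → ℝ, ∑ z ∈ S, l z = 0 →
      ∑ z ∈ S, |l z| ≤ K * ‖(fun j => ∑ z ∈ S, l z * (G z j : ℝ) : Fin n → ℝ)‖ := by
  have key : ∀ (r : ℕ) (p : Fin r → Fin n → ℤ), ∃ K : ℝ, 0 < K ∧ (tkAI Finset.univ p →
      ∀ l : Fin r → ℝ, ∑ i, l i = 0 →
        ∑ i, |l i| ≤ K * ‖(fun j => ∑ i, l i * (p i j : ℝ) : Fin n → ℝ)‖) := by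
    intro r p
    by_cases hp : tkAI Finset.univ p
    swap
    · exact ⟨1, one_pos, fun h => absurd h hp⟩
    let f : (Fin r → ℝ) →ₗ[ℝ] (ℝ × (Fin n → ℝ)) :=
      { toFun := fun l => (∑ i, l i, fun j => ∑ i, l i * (p i j : ℝ))
        map_add' := by
          intro x y
          ext <;> simp [add_mul, Finset.sum_add_distrib]
        map_smul' := by
          intro c x
          ext <;> simp [Finset.mul_sum, mul_assoc] }
    have hker : LinearMap.ker f = ⊥ := by
      rw [LinearMap.ker_eq_bot']
      intro l hl
      have h1 : ∑ i, l i = 0 := congrArg Prod.fst hl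
      have h2 : (fun j => ∑ i, l i * (p i j : ℝ)) = 0 := congrArg Prod.snd hl
      funext i
      exact hp l h1 (fun j => congrFun h2 j) i (Finset.mem_univ i)
    obtain ⟨K, hK, hf⟩ := f.exists_antilipschitzWith hker
    refine ⟨(r + 1) * K, by positivity, fun _ l hl => ?_⟩
    have h := hf.le_mul_dist l 0
    rw [map_zero, dist_zero_right, dist_zero_right] at h
    have h3 : ‖f l‖ = ‖(fun j => ∑ i, l i * (p i j : ℝ) : Fin n → ℝ)‖ := by
      simp [f, Prod.norm_def, hl]
    rw [h3] at h
    calc ∑ i, |l i| ≤ ∑ i : Fin r, ‖l‖ := Finset.sum_le_sum (fun i _ => norm_le_pi_norm l i)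
      _ = r * ‖l‖ := by simp
      _ ≤ (r + 1) * ‖l‖ := by gcongr; linarith
      _ ≤ (r + 1) * (K * ‖(fun j => ∑ i, l i * (p i j : ℝ) : Fin n → ℝ)‖) := by gcongr
      _ = _ := by ring
  choose K hK0 hK using key
  let cfg : (r : Fin (n + 2)) → (Fin r → Fin n → Fin (2 * D + 1)) → Fin r → Fin n → ℤ :=
    fun r p i j => (p i j : ℕ) - D
  have hpos : 0 < 1 + ∑ r : Fin (n + 2), ∑ p : (Fin r → Fin n → Fin (2 * D + 1)),
      K r (cfg r p) := by
    have : 0 ≤ ∑ r : Fin (n + 2), ∑ p : (Fin r → Fin n → Fin (2 * D + 1)), K r (cfg r p) :=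
      Finset.sum_nonneg fun r _ => Finset.sum_nonneg fun p _ => (hK0 _ _).le
    linarith
  refine ⟨_, hpos, ?_⟩
  intro Z S G hcard hG hAI l hl
  rcases S.eq_empty_or_nonempty with rfl | ⟨z0, hz0⟩
  · rw [Finset.sum_empty]
    exact mul_nonneg hpos.le (norm_nonneg _)
  let e := S.equivFin
  let r : Fin (n + 2) := ⟨S.card, by omega⟩
  let p : Fin r → Fin n → Fin (2 * D + 1) := fun i j =>
    ⟨(G (e.symm i) j - G z0 j + D).toNat, by
      have := abs_le.1 (hG _ (e.symm i).2 _ hz0 j); omega⟩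
  have hp : ∀ (i : Fin S.card) (j), cfg r p i j = G (e.symm i) j - G z0 j := by
    intro i j
    have := abs_le.1 (hG _ (e.symm i).2 _ hz0 j)
    simp only [cfg, p]
    omega
  have hsum : ∀ f : Z → ℝ, ∑ z ∈ S, f z = ∑ i : Fin S.card, f (e.symm i) := by
    intro f
    rw [← Finset.sum_coe_sort S f]
    exact (Equiv.sum_comp e.symm (fun z : S => f z)).symm
  have hrel : ∀ c : Z → ℝ, ∑ z ∈ S, c z = 0 → ∀ j,
      ∑ i : Fin S.card, c (e.symm i) * (cfg r p i j : ℝ) = ∑ z ∈ S, c z * (G z j : ℝ) := by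
    intro c hc j
    rw [hsum (fun z => c z * (G z j : ℝ))]
    have hc' := hc
    rw [hsum] at hc'
    simp only [hp]
    push_cast
    simp only [mul_sub, Finset.sum_sub_distrib, ← Finset.sum_mul, hc', zero_mul, sub_zero]
  have hAI' : tkAI Finset.univ (cfg r p) := by
    intro c hc0 hc1
    let c' : Z → ℝ := fun z => if h : z ∈ S then c (e ⟨z, h⟩) else 0
    have hc' : ∀ i : Fin S.card, c' (e.symm i) = c i := by
      intro i
      simp [c']
    have h0 : ∑ z ∈ S, c' z = 0 := by
      rw [hsum]; simp only [hc']; exact hc0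
    have := hAI c' h0 (fun j => by
      rw [← hrel c' h0 j]; simp only [hc']; exact hc1 j)
    intro i _
    have h2 := this _ (e.symm i).2
    rwa [hc'] at h2
  have h := hK r (cfg r p) hAI' (fun i => l (e.symm i)) (by rw [← hsum]; exact hl)
  have hle : K r (cfg r p) ≤ 1 + ∑ r : Fin (n + 2), ∑ p : (Fin r → Fin n → Fin (2 * D + 1)),
      K r (cfg r p) := by
    have h1 : K r (cfg r p) ≤ ∑ p : (Fin r → Fin n → Fin (2 * D + 1)), K r (cfg r p) :=
      Finset.single_le_sum (f := fun p => K r (cfg r p)) (fun p _ => (hK0 _ _).le)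
        (Finset.mem_univ p)
    have h2 := Finset.single_le_sum (f := fun r : Fin (n + 2) =>
        ∑ p : (Fin r → Fin n → Fin (2 * D + 1)), K r (cfg r p))
        (fun r _ => Finset.sum_nonneg fun p _ => (hK0 _ _).le) (Finset.mem_univ r)
    linarith
  have hfun : (fun j => ∑ z ∈ S, l z * (G z j : ℝ) : Fin n → ℝ) =
      (fun j => ∑ i : Fin S.card, l (e.symm i) * (cfg r p i j : ℝ)) := by
    funext j; exact (hrel l hl j).symm
  rw [hsum (fun z => |l z|), hfun]
  refine h.trans ?_
  gcongr

lemma tk_int_floor (a : ℝ) : ∫ t in Set.Ico (0:ℝ) 1, ((⌊a + t⌋ : ℤ) : ℝ) = a := by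
  have hfr : ∀ b : ℝ, ∫ t in (b)..(b + 1), Int.fract t = 1 / 2 := by
    intro b
    have hp : Function.Periodic (Int.fract : ℝ → ℝ) 1 := fun x => Int.fract_add_one x
    rw [hp.intervalIntegral_add_eq b 0]
    have : ∫ t in (0:ℝ)..(0 + 1), Int.fract t = ∫ t in (0:ℝ)..1, t := by
      rw [zero_add, intervalIntegral.integral_of_le zero_le_one,
        intervalIntegral.integral_of_le zero_le_one, ← MeasureTheory.integral_Ico_eq_integral_Ioc,
        ← MeasureTheory.integral_Ico_eq_integral_Ioc]
      apply MeasureTheory.setIntegral_congr_fun measurableSet_Ico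
      intro t ht
      exact Int.fract_eq_self.2 ⟨ht.1, ht.2⟩
    rw [this]; simp
  have hmeas : MeasureTheory.IntegrableOn (fun t : ℝ => Int.fract (a + t)) (Set.Ico 0 1) := by
    apply MeasureTheory.Measure.integrableOn_of_bounded (M := 1) (by simp)
    · exact (measurable_fract.comp (measurable_const.add measurable_id)).aestronglyMeasurable
    · refine Filter.Eventually.of_forall fun t => ?_
      rw [Real.norm_eq_abs, abs_of_nonneg (Int.fract_nonneg _)]
      exact (Int.fract_lt_one _).le
  have hlin : MeasureTheory.IntegrableOn (fun t : ℝ => a + t) (Set.Ico 0 1) :=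
    ((continuous_const.add continuous_id).integrableOn_Icc (a := (0:ℝ)) (b := 1)).mono_set
      Set.Ico_subset_Icc_self
  have h1 : ∫ t in Set.Ico (0:ℝ) 1, ((⌊a + t⌋ : ℤ) : ℝ) =
      ∫ t in Set.Ico (0:ℝ) 1, ((a + t) - Int.fract (a + t)) := by
    congr 1; funext t; rw [Int.self_sub_fract]
  rw [h1, MeasureTheory.integral_sub hlin hmeas]
  rw [MeasureTheory.integral_Ico_eq_integral_Ioc, MeasureTheory.integral_Ico_eq_integral_Ioc,
    ← intervalIntegral.integral_of_le zero_le_one, ← intervalIntegral.integral_of_le zero_le_one]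
  rw [intervalIntegral.integral_comp_add_left (fun t => t) a,
    intervalIntegral.integral_comp_add_left (fun t => Int.fract t) a, add_zero, hfr, integral_id]
  ring

/-- prefix sums -/
noncomputable def tkS {d : ℕ} (x : Fin d → ℝ) (i : ℕ) : ℝ :=
  ∑ j : Fin d, if j.val < i then x j else 0

lemma tkS_zero {d : ℕ} (x : Fin d → ℝ) : tkS x 0 = 0 := by simp [tkS]

lemma tkS_top {d : ℕ} (x : Fin d → ℝ) : tkS x d = ∑ j, x j := by simp [tkS]

lemma tkS_succ {d : ℕ} (x : Fin d → ℝ) (j : Fin d) : tkS x (j.val + 1) = tkS x j.val + x j := by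
  unfold tkS
  rw [← Finset.sum_ite_eq' Finset.univ j x |>.trans (if_pos (Finset.mem_univ j)),
    ← Finset.sum_add_distrib]
  apply Finset.sum_congr rfl
  intro w _
  by_cases h : w = j
  · subst h; simp
  · have h' : w.val ≠ j.val := fun h' => h (Fin.ext h')
    have : (w.val < j.val + 1) ↔ (w.val < j.val) := by omega
    simp [h, this]

lemma tkS_continuous {d : ℕ} (i : ℕ) : Continuous (fun x : Fin d → ℝ => tkS x i) := by
  unfold tkS
  apply continuous_finset_sum
  intro j _
  split_ifs
  · exact continuous_apply j
  · exact continuous_const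

/-- defect -/
noncomputable def tkD {d : ℕ} (m : ℕ) (x : Fin d → ℝ) (z : Fin d → ℕ) (i : ℕ) : ℝ :=
  tkS (fun j => (z j : ℝ)) i - m * tkS x i

noncomputable def tkA {d : ℕ} (m : ℕ) (x : Fin d → ℝ) (z : Fin d → ℕ) : ℝ :=
  max (1 + (Finset.range (d + 1)).inf' Finset.nonempty_range_add_one (tkD m x z) -
    (Finset.range (d + 1)).sup' Finset.nonempty_range_add_one (tkD m x z)) 0

lemma tkA_continuous {d : ℕ} (m : ℕ) (z : Fin d → ℕ) : Continuous (fun x => tkA m x z) := by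
  unfold tkA
  have h : ∀ i, Continuous (fun x : Fin d → ℝ => tkD m x z i) := fun i =>
    continuous_const.sub (continuous_const.mul (tkS_continuous i))
  refine Continuous.max (Continuous.sub (continuous_const.add ?_) ?_) continuous_const
  · exact Continuous.finset_inf'_apply _ (fun i _ => h i)
  · exact Continuous.finset_sup'_apply _ (fun i _ => h i)

lemma tkA_nonneg {d : ℕ} (m : ℕ) (x : Fin d → ℝ) (z : Fin d → ℕ) : 0 ≤ tkA m x z :=
  le_max_right _ _

lemma tkA_ne {d m : ℕ} {x : Fin d → ℝ} {z : Fin d → ℕ} (h : tkA m x z ≠ 0) {i j : ℕ}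
    (hi : i ≤ d) (hj : j ≤ d) : tkD m x z i - tkD m x z j < 1 := by
  have h0 : 0 < tkA m x z := lt_of_le_of_ne (tkA_nonneg _ _ _) (Ne.symm h)
  have h1 := (lt_max_iff.1 h0).resolve_right (lt_irrefl _)
  have h2 := Finset.le_sup' (tkD m x z) (Finset.mem_range.2 (Nat.lt_succ_of_le hi))
  have h3 := Finset.inf'_le (tkD m x z) (Finset.mem_range.2 (Nat.lt_succ_of_le hj))
  linarith

lemma tkD_succ {d m : ℕ} (x : Fin d → ℝ) (z : Fin d → ℕ) (j : Fin d) :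
    tkD m x z (j.val + 1) - tkD m x z j.val = z j - m * x j := by
  unfold tkD; rw [tkS_succ, tkS_succ]; ring

lemma tkA_close {d m : ℕ} {x : Fin d → ℝ} {z : Fin d → ℕ} (h : tkA m x z ≠ 0) (j : Fin d) :
    |(z j : ℝ) - m * x j| < 1 := by
  rw [← tkD_succ, abs_lt]
  have h1 := tkA_ne h (i := j.val + 1) (j := j.val) j.2 j.2.le
  have h2 := tkA_ne h (i := j.val) (j := j.val + 1) j.2.le j.2
  constructor <;> linarith

lemma tkA_supp {d m : ℕ} {x : Fin d → ℝ} {z : Fin d → ℕ} (h : tkA m x z ≠ 0) (j : Fin d)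
    (hx : x j = 0) : z j = 0 := by
  have := tkA_close h j
  rw [hx, mul_zero, sub_zero, abs_lt] at this
  have h2 : z j < 1 := by exact_mod_cast this.2
  omega

/-- integer prefix sums -/
lemma tkS_nat {d : ℕ} (z : Fin d → ℕ) (i : ℕ) :
    ∃ c : ℤ, tkS (fun j => (z j : ℝ)) i = c := by
  refine ⟨∑ j : Fin d, if j.val < i then (z j : ℤ) else 0, ?_⟩
  unfold tkS
  push_cast
  rfl

lemma tk_T {d m : ℕ} {x : Fin d → ℝ} {z : Fin d → ℕ} (t : ℝ) :
    (t ∈ Set.Ico ((Finset.range (d + 1)).sup' Finset.nonempty_range_add_one (tkD m x z))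
      (1 + (Finset.range (d + 1)).inf' Finset.nonempty_range_add_one (tkD m x z))) ↔
    ∀ i ≤ d, ((⌊m * tkS x i + t⌋ : ℤ) : ℝ) = tkS (fun j => (z j : ℝ)) i := by
  rw [Set.mem_Ico, Finset.sup'_le_iff]
  have h2 : (t < 1 + (Finset.range (d + 1)).inf' Finset.nonempty_range_add_one (tkD m x z)) ↔
      ∀ i ∈ Finset.range (d + 1), t - 1 < tkD m x z i := by
    rw [← Finset.lt_inf'_iff (H := Finset.nonempty_range_add_one)]
    constructor <;> intro h <;> linarith
  rw [h2, ← forall₂_and]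
  apply forall_congr'
  intro i
  rw [Finset.mem_range, Nat.lt_succ_iff]
  apply imp_congr_right
  intro hi
  obtain ⟨c, hc⟩ := tkS_nat z i
  unfold tkD
  rw [hc, Int.cast_inj, Int.floor_eq_iff]
  constructor
  · rintro ⟨h1, h2⟩; constructor <;> linarith
  · rintro ⟨h1, h2⟩; constructor <;> linarith

lemma tk_T_unique {d m : ℕ} {x : Fin d → ℝ} {z z' : Fin d → ℕ}
    (h : ∀ i ≤ d, tkS (fun j => (z j : ℝ)) i = tkS (fun j => (z' j : ℝ)) i) : z = z' := by
  funext j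
  have h1 := h j.val j.2.le
  have h2 := h (j.val + 1) j.2
  rw [tkS_succ, tkS_succ, h1] at h2
  exact_mod_cast add_left_cancel h2

noncomputable def tkZt {d : ℕ} (m : ℕ) (x : Fin d → ℝ) (t : ℝ) : Fin d → ℕ := fun j =>
  (⌊m * tkS x (j.val + 1) + t⌋ - ⌊m * tkS x j.val + t⌋).toNat

lemma tkZt_apply {d m : ℕ} {x : Fin d → ℝ} (hx : ∀ j, 0 ≤ x j) (t : ℝ) (j : Fin d) :
    ((tkZt m x t j : ℕ) : ℝ) =
      (⌊m * tkS x (j.val + 1) + t⌋ : ℝ) - (⌊m * tkS x j.val + t⌋ : ℝ) := by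
  have h : ⌊m * tkS x j.val + t⌋ ≤ ⌊m * tkS x (j.val + 1) + t⌋ := by
    apply Int.floor_mono
    rw [tkS_succ]
    have : 0 ≤ (m : ℝ) * x j := mul_nonneg (Nat.cast_nonneg _) (hx j)
    linarith
  unfold tkZt
  have h2 : (((⌊m * tkS x (j.val + 1) + t⌋ - ⌊m * tkS x j.val + t⌋).toNat : ℕ) : ℤ) =
      ⌊m * tkS x (j.val + 1) + t⌋ - ⌊m * tkS x j.val + t⌋ := by omega
  have h3 := congrArg (fun y : ℤ => (y : ℝ)) h2
  push_cast at h3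
  exact h3

lemma tkZt_S {d m : ℕ} {x : Fin d → ℝ} (hx : ∀ j, 0 ≤ x j) {t : ℝ} (ht : t ∈ Set.Ico (0:ℝ) 1) :
    ∀ i ≤ d, ((⌊m * tkS x i + t⌋ : ℤ) : ℝ) = tkS (fun j => ((tkZt m x t j : ℕ) : ℝ)) i := by
  intro i
  induction i with
  | zero =>
    intro _
    rw [tkS_zero, tkS_zero, mul_zero, zero_add]
    have : ⌊t⌋ = 0 := Int.floor_eq_zero_iff.2 ht
    simp [this]
  | succ i ih =>
    intro hi
    have h1 := ih (by omega)
    have h2 := tkS_succ (fun j => ((tkZt m x t j : ℕ) : ℝ)) ⟨i, hi⟩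
    simp only at h2
    rw [h2, ← h1, tkZt_apply hx]
    simp

lemma tk_interp {d m : ℕ} {x : Fin d → ℝ} (hx : ∀ j, 0 ≤ x j) (hs : ∑ j, x j = 1)
    (c : (Fin d → ℕ) → ℝ) :
    ∑ z ∈ Finset.piAntidiag Finset.univ m, tkA m x z * c z =
      ∫ t in Set.Ico (0:ℝ) 1, c (tkZt m x t) := by
  let I : (Fin d → ℕ) → Set ℝ := fun z =>
    Set.Ico ((Finset.range (d + 1)).sup' Finset.nonempty_range_add_one (tkD m x z))
      (1 + (Finset.range (d + 1)).inf' Finset.nonempty_range_add_one (tkD m x z))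
  have hIsub : ∀ z, I z ⊆ Set.Ico 0 1 := by
    intro z t ht
    have := (tk_T t).1 ht 0 (Nat.zero_le _)
    rw [tkS_zero, tkS_zero, mul_zero, zero_add] at this
    exact Int.floor_eq_zero_iff.1 (by exact_mod_cast this)
  have h1 : ∀ t ∈ Set.Ico (0:ℝ) 1, c (tkZt m x t) =
      ∑ z ∈ Finset.piAntidiag Finset.univ m, (I z).indicator (fun _ => c z) t := by
    intro t ht
    have hmem : tkZt m x t ∈ Finset.piAntidiag (Finset.univ : Finset (Fin d)) m := by
      rw [Finset.mem_piAntidiag]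
      refine ⟨?_, by simp⟩
      have := tkZt_S (m := m) hx ht d le_rfl
      rw [tkS_top, tkS_top, hs, mul_one] at this
      rw [add_comm, Int.floor_add_natCast, Int.floor_eq_zero_iff.2 ht] at this
      have h2 : ((m : ℕ) : ℝ) = ((∑ j, tkZt m x t j : ℕ) : ℝ) := by
        push_cast at this ⊢; linarith
      exact_mod_cast h2.symm
    rw [Finset.sum_eq_single_of_mem _ hmem]
    · rw [Set.indicator_of_mem]
      exact (tk_T t).2 (tkZt_S hx ht)
    · intro z _ hz
      apply Set.indicator_of_notMem
      intro h
      apply hz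
      apply tk_T_unique (m := m) (x := x)
      intro i hi
      rw [← (tk_T t).1 h i hi, tkZt_S hx ht i hi]
  rw [MeasureTheory.setIntegral_congr_fun measurableSet_Ico h1, MeasureTheory.integral_finset_sum]
  · apply Finset.sum_congr rfl
    intro z _
    rw [MeasureTheory.setIntegral_indicator measurableSet_Ico,
      Set.inter_eq_self_of_subset_right (hIsub z), MeasureTheory.setIntegral_const,
      Real.volume_real_Ico, smul_eq_mul]
    rfl
  · intro z _
    apply MeasureTheory.Integrable.indicator _ measurableSet_Ico
    exact MeasureTheory.integrable_const _

lemma tk_interp_one {d m : ℕ} {x : Fin d → ℝ} (hx : ∀ j, 0 ≤ x j) (hs : ∑ j, x j = 1) :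
    ∑ z ∈ Finset.piAntidiag Finset.univ m, tkA m x z = 1 := by
  have := tk_interp (m := m) hx hs (fun _ => 1)
  simpa using this

lemma tk_floor_integrable (a : ℝ) :
    MeasureTheory.IntegrableOn (fun t : ℝ => ((⌊a + t⌋ : ℤ) : ℝ)) (Set.Ico 0 1) := by
  apply MeasureTheory.Measure.integrableOn_of_bounded (M := |a| + 2) (by simp)
  · apply Measurable.aestronglyMeasurable
    exact (measurable_from_top (f := fun z : ℤ => (z : ℝ))).comp
      (Int.measurable_floor.comp (measurable_const.add measurable_id))
  · rw [MeasureTheory.ae_restrict_iff' measurableSet_Ico]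
    refine Filter.Eventually.of_forall fun t ht => ?_
    have h1 := Int.floor_le (a + t)
    have h2 := Int.lt_floor_add_one (a + t)
    rw [Real.norm_eq_abs, abs_le]
    have h3 := neg_abs_le a
    have h4 := le_abs_self a
    constructor <;> linarith [ht.1, ht.2]

lemma tk_interp_coord {d m : ℕ} {x : Fin d → ℝ} (hx : ∀ j, 0 ≤ x j) (hs : ∑ j, x j = 1)
    (j : Fin d) :
    ∑ z ∈ Finset.piAntidiag Finset.univ m, tkA m x z * (z j : ℝ) = m * x j := by
  rw [tk_interp hx hs (fun z => (z j : ℝ))]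
  simp only [tkZt_apply hx]
  rw [MeasureTheory.integral_sub (tk_floor_integrable _) (tk_floor_integrable _), tk_int_floor,
    tk_int_floor, tkS_succ]
  ring

lemma tk_floor_split (a t : ℝ) (ht : t ∈ Set.Ico (0:ℝ) 1) :
    ⌊a + t⌋ = ⌊a⌋ + if 1 ≤ t + Int.fract a then 1 else 0 := by
  have h := Int.floor_add_fract a
  have h1 := Int.fract_nonneg a
  have h2 := Int.fract_lt_one a
  rw [Int.floor_eq_iff]
  split_ifs with h3
  · push_cast; constructor <;> linarith [ht.1, ht.2]
  · push Not at h3; push_cast; constructor <;> linarith [ht.1, ht.2]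

lemma tk_card {d m : ℕ} {x : Fin d → ℝ} (hs : ∑ j, x j = 1) (W : Finset (Fin d → ℕ))
    (hW : ∀ z ∈ W, tkA m x z ≠ 0) :
    W.card ≤ (Finset.univ.filter (fun j => x j ≠ 0)).card := by
  let Fr : Finset ℝ := (Finset.univ.filter (fun j => x j ≠ 0)).image
    (fun j : Fin d => Int.fract (m * tkS x (j.val + 1)))
  have hclaim : ∀ i ≤ d, Int.fract (m * tkS x i) ∈ Fr ∨ tkS x i = 0 := by
    intro i
    induction i with
    | zero => intro _; right; exact tkS_zero x
    | succ i ih =>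
      intro hi
      have hsucc := tkS_succ x ⟨i, hi⟩
      simp only at hsucc
      by_cases h : x ⟨i, hi⟩ = 0
      · rw [hsucc, h, add_zero]; exact ih (by omega)
      · left
        exact Finset.mem_image.2 ⟨⟨i, hi⟩, by simpa using h, rfl⟩
  have h0 : (0:ℝ) ∈ Fr := by
    rcases hclaim d le_rfl with h | h
    · rw [tkS_top, hs, mul_one, Int.fract_natCast] at h; exact h
    · rw [tkS_top, hs] at h; norm_num at h
  have hFr : ∀ i ≤ d, Int.fract (m * tkS x i) ∈ Fr := by
    intro i hi
    rcases hclaim i hi with h | h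
    · exact h
    · rw [h, mul_zero, Int.fract_zero]; exact h0
  have hT : ∀ z ∈ W, ∃ t ∈ Set.Ico (0:ℝ) 1,
      ∀ i ≤ d, ((⌊m * tkS x i + t⌋ : ℤ) : ℝ) = tkS (fun j => (z j : ℝ)) i := by
    intro z hz
    have h0 : 0 < tkA m x z := lt_of_le_of_ne (tkA_nonneg _ _ _) (Ne.symm (hW z hz))
    have h1 := (lt_max_iff.1 h0).resolve_right (lt_irrefl _)
    have ht := (tk_T (m := m) (x := x) (z := z) _).1 (Set.left_mem_Ico.2 (by linarith))
    refine ⟨_, ?_, ht⟩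
    have := ht 0 (Nat.zero_le _)
    rw [tkS_zero, tkS_zero, mul_zero, zero_add] at this
    exact Int.floor_eq_zero_iff.1 (by exact_mod_cast this)
  choose! t ht01 ht using hT
  let fl : (Fin d → ℕ) → Finset ℝ := fun z => Fr.filter (fun f => 1 ≤ t z + f)
  have hmap : W.card ≤ (Finset.range Fr.card).card := by
    apply Finset.card_le_card_of_injOn (fun z => (fl z).card)
    · intro z hz
      simp only [Finset.coe_range, Set.mem_Iio]
      apply Finset.card_lt_card
      rw [Finset.filter_ssubset]
      refine ⟨0, h0, ?_⟩
      have := (ht01 z hz).2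
      push Not; linarith
    · intro z hz w hw h
      simp only at h
      have heq : fl z = fl w := by
        rcases le_total (t z) (t w) with hl | hl
        · apply Finset.eq_of_subset_of_card_le _ h.ge
          intro f hf
          simp only [fl, Finset.mem_filter] at hf ⊢
          exact ⟨hf.1, by linarith [hf.2]⟩
        · symm
          apply Finset.eq_of_subset_of_card_le _ h.le
          intro f hf
          simp only [fl, Finset.mem_filter] at hf ⊢
          exact ⟨hf.1, by linarith [hf.2]⟩
      apply tk_T_unique (m := m) (x := x)
      intro i hi
      rw [← ht z hz i hi, ← ht w hw i hi, tk_floor_split _ _ (ht01 z hz),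
        tk_floor_split _ _ (ht01 w hw)]
      have hmem : (1 ≤ t z + Int.fract (m * tkS x i)) ↔ (1 ≤ t w + Int.fract (m * tkS x i)) := by
        have := Finset.ext_iff.1 heq (Int.fract (m * tkS x i))
        simpa [fl, hFr i hi] using this
      simp only [hmem]
  rw [Finset.card_range] at hmap
  exact hmap.trans Finset.card_image_le

noncomputable def tkSupp {V : Type} [Fintype V] (z : V → ℕ) : Finset V :=
  Finset.univ.filter (fun v => z v ≠ 0)

lemma tk_mem_supp {V : Type} [Fintype V] {z : V → ℕ} {v : V} : v ∈ tkSupp z ↔ z v ≠ 0 := by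
  simp [tkSupp]

noncomputable def tkLat {V : Type} [Fintype V] (K : Finset (Finset V)) (m : ℕ) :
    Finset (V → ℕ) :=
  (Finset.piAntidiag Finset.univ m).filter (fun z => tkSupp z ∈ K)

lemma tk_mem_lat {V : Type} [Fintype V] {K : Finset (Finset V)} {m : ℕ} {z : V → ℕ} :
    z ∈ tkLat K m ↔ ∑ v, z v = m ∧ tkSupp z ∈ K := by
  simp [tkLat, Finset.mem_piAntidiag]

lemma tk_sum_supp {V : Type} [Fintype V] (z : V → ℕ) : ∑ v ∈ tkSupp z, z v = ∑ v, z v :=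
  Finset.sum_filter_ne_zero _

lemma tk_lat_card {V : Type} [Fintype V] (K : Finset (Finset V)) (m k : ℕ)
    (hK : ∀ s ∈ K, s.card ≤ k + 1) (hm : 0 < m) :
    (tkLat K m).card ≤ K.card * (m + 1) ^ k := by
  have h1 : tkLat K m ⊆ K.biUnion (fun s => (tkLat K m).filter (fun z => tkSupp z = s)) := by
    intro z hz
    rw [Finset.mem_biUnion]
    exact ⟨tkSupp z, (tk_mem_lat.1 hz).2, by simp [hz]⟩
  refine (Finset.card_le_card h1).trans (Finset.card_biUnion_le_card_mul _ _ _ ?_)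
  intro s hs
  rcases s.eq_empty_or_nonempty with rfl | ⟨v0, hv0⟩
  · rw [Finset.card_eq_zero.2]
    · positivity
    · apply Finset.filter_eq_empty_iff.2
      intro z hz h
      have h2 := tk_sum_supp z
      rw [h, (tk_mem_lat.1 hz).1] at h2
      simp at h2; omega
  · have hle : ∀ z ∈ tkLat K m, ∀ v, z v ≤ m := by
      intro z hz v
      rw [← (tk_mem_lat.1 hz).1]
      exact Finset.single_le_sum (f := z) (fun _ _ => Nat.zero_le _) (Finset.mem_univ v)
    have hc : ((tkLat K m).filter (fun z => tkSupp z = s)).card ≤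
        (Finset.univ : Finset ({v // v ∈ s.erase v0} → Fin (m + 1))).card := by
      apply Finset.card_le_card_of_injOn (fun z v => Fin.ofNat (m + 1) (z v))
      · intro z _; simp
      · intro z hz w hw h
        simp only [Finset.coe_filter, Set.mem_ofPred_eq] at hz hw
        have h1 : ∀ v ∈ s.erase v0, z v = w v := by
          intro v hv
          have h3 := congrArg Fin.val (congrFun h ⟨v, hv⟩)
          simp only [Fin.ofNat] at h3
          rwa [Nat.mod_eq_of_lt (Nat.lt_succ_of_le (hle z hz.1 v)),
            Nat.mod_eq_of_lt (Nat.lt_succ_of_le (hle w hw.1 v))] at h3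
        have h2 : z v0 = w v0 := by
          have hz2 := tk_sum_supp z
          have hw2 := tk_sum_supp w
          rw [hz.2, (tk_mem_lat.1 hz.1).1, ← Finset.add_sum_erase _ _ hv0] at hz2
          rw [hw.2, (tk_mem_lat.1 hw.1).1, ← Finset.add_sum_erase _ _ hv0] at hw2
          have : ∑ x ∈ s.erase v0, z x = ∑ x ∈ s.erase v0, w x := Finset.sum_congr rfl h1
          omega
        funext v
        by_cases hv : v ∈ s
        · by_cases hvv : v = v0
          · rw [hvv, h2]
          · exact h1 v (Finset.mem_erase.2 ⟨hvv, hv⟩)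
        · have a1 : z v = 0 := by
            by_contra hne; exact hv (hz.2 ▸ tk_mem_supp.2 hne)
          have a2 : w v = 0 := by
            by_contra hne; exact hv (hw.2 ▸ tk_mem_supp.2 hne)
          rw [a1, a2]
    refine hc.trans ?_
    rw [Finset.card_univ, Fintype.card_fun, Fintype.card_fin, Fintype.card_coe,
      Finset.card_erase_of_mem hv0]
    exact Nat.pow_le_pow_right (by omega) (by have := hK s hs; omega)

/-- the coarse map on lattice points -/
noncomputable def tkH {V : Type} [Fintype V] {n q : ℕ} (m : ℕ) (b : V → Fin n → ℝ)
    (g : V → Fin n → Fin q) (z : V → ℕ) (j : Fin n) : ℝ :=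
  (∑ v, (z v : ℝ) * (b v j + ((g v j : ℕ) : ℝ))) / m

lemma tk_dominant {V : Type} [Fintype V] {K : Finset (Finset V)} {m k : ℕ}
    (hK : ∀ s ∈ K, s.card ≤ k + 1) (hm : 0 < m) {z : V → ℕ} (hz : z ∈ tkLat K m) :
    ∃ v, m ≤ (k + 1) * z v := by
  by_contra hcon
  push Not at hcon
  obtain ⟨h1, h2⟩ := tk_mem_lat.1 hz
  have h3 : ∑ v ∈ tkSupp z, (k + 1) * z v < ∑ v ∈ tkSupp z, m := by
    apply Finset.sum_lt_sum_of_nonempty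
    · rw [Finset.nonempty_iff_ne_empty]
      intro h
      have := tk_sum_supp z
      rw [h, h1] at this
      simp at this; omega
    · intro v _; exact hcon v
  rw [← Finset.mul_sum, tk_sum_supp, h1, Finset.sum_const, smul_eq_mul] at h3
  have := Nat.mul_le_mul_right m (hK _ h2)
  omega

lemma tk_card_interval {q : ℕ} (s : Finset (Fin q)) (T : ℕ)
    (h : ∀ a ∈ s, ∀ b ∈ s, (a : ℕ) ≤ b + T) : s.card ≤ T + 1 := by
  rcases s.eq_empty_or_nonempty with rfl | hs
  · simp
  · have hmin := Finset.min'_mem s hs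
    have : s.card ≤ (Finset.Icc (s.min' hs : ℕ) (s.min' hs + T)).card := by
      apply Finset.card_le_card_of_injOn (fun a : Fin q => (a : ℕ))
      · intro a ha
        simp only [Finset.coe_Icc, Set.mem_Icc]
        exact ⟨Finset.min'_le s a ha, h a ha _ hmin⟩
      · intro a _ b _ hab; exact Fin.ext hab
    rw [Nat.card_Icc] at this
    omega

lemma tk_update_H {V : Type} [Fintype V] {n q : ℕ} (m : ℕ) (b : V → Fin n → ℝ)
    (g : V → Fin n → Fin q) (z : V → ℕ) (v : V) (a : Fin n → Fin q) (hv : z v = 0) :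
    tkH m b (update g v a) z = tkH m b g z := by
  funext j
  unfold tkH
  congr 1
  apply Finset.sum_congr rfl
  intro w _
  by_cases hw : w = v
  · subst hw; simp [hv]
  · rw [update_of_ne hw]

lemma tk_event_one {V : Type} [Fintype V] {n q : ℕ} {m k : ℕ} (hm : 0 < m) (b : V → Fin n → ℝ)
    (D : ℕ) (z z0 : V → ℕ) (v : V) (hv : m ≤ (k + 1) * z v) (hzv : 0 < z v) (hz0 : z0 v = 0)
    (g : V → Fin n → Fin q) :
    (Finset.univ.filter (fun a => ∀ j, |tkH m b (update g v a) z j -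
      tkH m b (update g v a) z0 j| ≤ D)).card ≤ (2 * D * (k + 1) + 1) ^ n := by
  let c : Fin n → Finset (Fin q) := fun j => Finset.univ.filter (fun e =>
    |tkH m b (update g v (fun _ => e)) (z) j - tkH m b g (z0) j| ≤ D)
  have hHj : ∀ (a : Fin n → Fin q) j, tkH m b (update g v a) (z) j =
      tkH m b (update g v (fun _ => a j)) (z) j := by
    intro a j
    unfold tkH
    congr 1
    apply Finset.sum_congr rfl
    intro u _
    by_cases hu : u = v
    · subst hu; simp
    · rw [update_of_ne hu, update_of_ne hu]
  have hsub : (Finset.univ.filter (fun a => ∀ j,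
      |tkH m b (update g v a) (z) j - tkH m b (update g v a) (z0) j| ≤ D)) ⊆ Fintype.piFinset c := by
    intro a ha
    simp only [Finset.mem_filter, Finset.mem_univ, true_and] at ha
    rw [Fintype.mem_piFinset]
    intro j
    simp only [c, Finset.mem_filter, Finset.mem_univ, true_and]
    rw [← hHj, ← tk_update_H m b g (z0) v a hz0]
    exact ha j
  refine (Finset.card_le_card hsub).trans ?_
  rw [Fintype.card_piFinset]
  refine (Finset.prod_le_pow_card _ _ _ (fun j _ => ?_)).trans (le_of_eq (by
    rw [Finset.card_univ, Fintype.card_fin]))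
  apply tk_card_interval
  intro e he e' he'
  simp only [c, Finset.mem_filter, Finset.mem_univ, true_and] at he he'
  have hdiff : tkH m b (update g v (fun _ => e)) (z) j -
      tkH m b (update g v (fun _ => e')) (z) j =
      (z v : ℝ) * (((e : ℕ) : ℝ) - ((e' : ℕ) : ℝ)) / m := by
    unfold tkH
    rw [← sub_div, ← Finset.sum_sub_distrib, Finset.sum_eq_single v]
    · simp; ring
    · intro u _ hu
      rw [update_of_ne hu, update_of_ne hu, sub_self]
    · simp
  have h2 : (z v : ℝ) * (((e : ℕ) : ℝ) - ((e' : ℕ) : ℝ)) / m ≤ 2 * D := by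
    rw [← hdiff]
    have a1 := abs_le.1 he
    have a2 := abs_le.1 he'
    linarith [a1.2, a2.1]
  have hmR : (0:ℝ) < m := by exact_mod_cast hm
  rw [div_le_iff₀ hmR] at h2
  have hvR : (m : ℝ) ≤ (k + 1) * z v := by exact_mod_cast hv
  have hzR : (0:ℝ) < z v := by exact_mod_cast hzv
  have h3 : (z v : ℝ) * (((e : ℕ) : ℝ) - ((e' : ℕ) : ℝ)) ≤
      (z v : ℝ) * (2 * D * (k + 1)) := by
    calc _ ≤ 2 * (D:ℝ) * m := h2
      _ ≤ 2 * (D:ℝ) * ((k + 1) * z v) := by gcongr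
      _ = _ := by ring
  have h4 := le_of_mul_le_mul_left h3 hzR
  have h5 : ((e : ℕ) : ℝ) ≤ ((e' : ℕ) : ℝ) + 2 * D * (k + 1) := by linarith
  exact_mod_cast h5

lemma tk_event {V : Type} [Fintype V] {n q : ℕ} {K : Finset (Finset V)} {m k : ℕ}
    (hK : ∀ s ∈ K, s.card ≤ k + 1) (hm : 0 < m) (b : V → Fin n → ℝ) (D h : ℕ)
    (w : Fin (h + 1) → V → ℕ) (hw : ∀ i, w i ∈ tkLat K m)
    (hdis : ∀ i j, i ≠ j → Disjoint (tkSupp (w i)) (tkSupp (w j))) (r : ℕ) (hr : r ≤ h) :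
    (Finset.univ.filter (fun g : V → Fin n → Fin q => ∀ i : Fin (h + 1), i.val ≤ r → ∀ j,
      |tkH m b g (w i) j - tkH m b g (w 0) j| ≤ D)).card * (q ^ n) ^ r ≤
    ((2 * D * (k + 1) + 1) ^ n) ^ r * Fintype.card (V → Fin n → Fin q) := by
  induction r with
  | zero =>
    simp only [pow_zero, mul_one, one_mul]
    exact Finset.card_le_univ _
  | succ r ih =>
    have ih := ih (by omega)
    let i0 : Fin (h + 1) := ⟨r + 1, by omega⟩
    obtain ⟨v, hv⟩ := tk_dominant hK hm (hw i0)
    have hzv : 0 < w i0 v := by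
      rcases Nat.eq_zero_or_pos (w i0 v) with h0 | h0
      · rw [h0] at hv; omega
      · exact h0
    have hother : ∀ i, i ≠ i0 → w i v = 0 := by
      intro i hi
      by_contra hne
      exact Finset.disjoint_left.1 (hdis i i0 hi) (tk_mem_supp.2 hne) (tk_mem_supp.2 hzv.ne')
    have h00 : (0 : Fin (h + 1)) ≠ i0 := by
      intro h; have := congrArg Fin.val h; simp [i0] at this
    let A : Finset (V → Fin n → Fin q) := Finset.univ.filter (fun g => ∀ j,
      |tkH m b g (w i0) j - tkH m b g (w 0) j| ≤ D)
    let B : Finset (V → Fin n → Fin q) := Finset.univ.filter (fun g =>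
      ∀ i : Fin (h + 1), i.val ≤ r → ∀ j, |tkH m b g (w i) j - tkH m b g (w 0) j| ≤ D)
    let Cc : Finset (V → Fin n → Fin q) := (Finset.univ.filter
      (fun g : V → Fin n → Fin q => ∀ i : Fin (h + 1),
        i.val ≤ r + 1 → ∀ j, |tkH m b g (w i) j - tkH m b g (w 0) j| ≤ D))
    have hAB : ∀ g ∈ Cc, g ∈ A ∧ g ∈ B := by
      intro g hg
      simp only [Cc, A, B, Finset.mem_filter, Finset.mem_univ, true_and] at hg ⊢
      exact ⟨hg i0 le_rfl, fun i hi => hg i (by omega)⟩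
    have hcount := tk_count A B Cc v ((2 * D * (k + 1) + 1) ^ n) hAB (by
      intro g hg a
      simp only [B, Finset.mem_filter, Finset.mem_univ, true_and] at hg ⊢
      intro i hi j
      rw [tk_update_H _ _ _ _ _ _ (hother i (by
        intro h; have := congrArg Fin.val h; simp [i0] at this; omega)),
        tk_update_H _ _ _ _ _ _ (hother 0 h00)]
      exact hg i hi j) (by
      intro g
      have := tk_event_one (n := n) (q := q) (k := k) hm b D (w i0) (w 0) v hv hzv (hother 0 h00) g
      refine le_trans (le_of_eq ?_) this
      congr 1
      ext a
      simp [A])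
    have hcard : Fintype.card (Fin n → Fin q) = q ^ n := by simp
    rw [hcard] at hcount
    change B.card * _ ≤ _ at ih
    change Cc.card * _ ≤ _
    clear_value A B Cc
    generalize (2 * D * (k + 1) + 1) ^ n = c1 at *
    generalize q ^ n = c2 at *
    generalize Fintype.card (V → Fin n → Fin q) = c3 at *
    calc _ = (Cc.card * c2) * c2 ^ r := by ring
      _ ≤ (c1 * B.card) * (c2) ^ r := Nat.mul_le_mul_right _ hcount
      _ = c1 * (B.card * (c2) ^ r) := by ring
      _ ≤ c1 * ((c1) ^ r *
            c3) := Nat.mul_le_mul_left _ ih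
      _ = _ := by ring

lemma tk_random {V : Type} [Fintype V] {n q : ℕ} {K : Finset (Finset V)} {m k : ℕ}
    (hK : ∀ s ∈ K, s.card ≤ k + 1) (hm : 0 < m) (hq : 0 < q) (b : V → Fin n → ℝ) (D h : ℕ)
    (hlt : (tkLat K m).card ^ (h + 1) * ((2 * D * (k + 1) + 1) ^ n) ^ h < (q ^ n) ^ h) :
    ∃ g : V → Fin n → Fin q, ∀ w : Fin (h + 1) → V → ℕ, (∀ i, w i ∈ tkLat K m) →
      (∀ i j, i ≠ j → Disjoint (tkSupp (w i)) (tkSupp (w j))) →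
      ¬ ∀ i j, |tkH m b g (w i) j - tkH m b g (w 0) j| ≤ D := by
  by_contra hcon
  push Not at hcon
  let Wt : Finset (Fin (h + 1) → V → ℕ) := (Fintype.piFinset (fun _ => tkLat K m)).filter
    (fun w => ∀ i j, i ≠ j → Disjoint (tkSupp (w i)) (tkSupp (w j)))
  let ev : (Fin (h + 1) → V → ℕ) → Finset (V → Fin n → Fin q) := fun w =>
    (Finset.univ.filter (fun g : V → Fin n → Fin q => ∀ i : Fin (h + 1), i.val ≤ h → ∀ j,
      |tkH m b g (w i) j - tkH m b g (w 0) j| ≤ D))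
  have hcov : (Finset.univ : Finset (V → Fin n → Fin q)) ⊆ Wt.biUnion ev := by
    intro g _
    obtain ⟨w, h1, h2, h3⟩ := hcon g
    rw [Finset.mem_biUnion]
    refine ⟨w, ?_, ?_⟩
    · simp only [Wt, Finset.mem_filter, Fintype.mem_piFinset]; exact ⟨h1, h2⟩
    · simp only [ev, Finset.mem_filter, Finset.mem_univ, true_and]
      exact fun i _ => h3 i
  have hWt : Wt.card ≤ (tkLat K m).card ^ (h + 1) := by
    refine (Finset.card_filter_le _ _).trans ?_
    rw [Fintype.card_piFinset]; simp
  have h1 : Fintype.card (V → Fin n → Fin q) ≤ ∑ w ∈ Wt, (ev w).card := by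
    have := (Finset.card_le_card hcov).trans Finset.card_biUnion_le
    rwa [Finset.card_univ] at this
  have hpos : 0 < Fintype.card (V → Fin n → Fin q) := by
    have : Nonempty (Fin q) := ⟨⟨0, hq⟩⟩
    exact Fintype.card_pos
  have h2 : Fintype.card (V → Fin n → Fin q) * (q ^ n) ^ h ≤
      (tkLat K m).card ^ (h + 1) * ((2 * D * (k + 1) + 1) ^ n) ^ h *
        Fintype.card (V → Fin n → Fin q) := by
    calc _ ≤ (∑ w ∈ Wt, (ev w).card) * (q ^ n) ^ h := Nat.mul_le_mul_right _ h1
      _ = ∑ w ∈ Wt, (ev w).card * (q ^ n) ^ h := Finset.sum_mul _ _ _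
      _ ≤ ∑ w ∈ Wt, ((2 * D * (k + 1) + 1) ^ n) ^ h * Fintype.card (V → Fin n → Fin q) := by
          apply Finset.sum_le_sum
          intro w hw
          simp only [Wt, Finset.mem_filter, Fintype.mem_piFinset] at hw
          exact tk_event hK hm b D h w hw.1 hw.2 h le_rfl
      _ = Wt.card * (((2 * D * (k + 1) + 1) ^ n) ^ h * Fintype.card (V → Fin n → Fin q)) := by
          simp
      _ ≤ _ := by rw [← mul_assoc]; gcongr
  rw [mul_comm] at h2
  have := Nat.le_of_mul_le_mul_right h2 hpos
  omega

lemma tk_step1 (k n L : ℕ) (hn : 2 * k + 1 ≤ n) : ∃ τ Q0 : ℕ, ∀ (V : Type) [Fintype V]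
    (K : Finset (Finset V)), (∀ s ∈ K, s.card ≤ k + 1) →
    (∀ v, (K.filter (fun s => v ∈ s)).card ≤ L) →
    ∃ P : V → Fin n → ℕ, (∀ v j, P v j ≤ Q0) ∧ ∀ s ∈ K, ∀ l : V → ℝ, ∑ v ∈ s, l v = 0 →
      2 * ∑ v ∈ s, |l v| ≤ τ * ‖(fun j => ∑ v ∈ s, l v * (P v j : ℝ) : Fin n → ℝ)‖ := by
  obtain ⟨K0, hK0, hq⟩ := tk_quant n (2 ^ (L * (k + 1)) + 1)
  refine ⟨⌈2 * K0⌉₊, 2 ^ (L * (k + 1)) + 1, ?_⟩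
  intro V _ K hK hL
  obtain ⟨G, h1, h2⟩ := tk_genpos (n := n) (by omega) (L * (k + 1))
    (fun v w : V => ∃ s ∈ K, v ∈ s ∧ w ∈ s) (by
      intro v
      have : (Finset.univ.filter (fun w => ∃ s ∈ K, v ∈ s ∧ w ∈ s)) ⊆
          (K.filter (fun s => v ∈ s)).biUnion id := by
        intro w hw
        simp only [Finset.mem_filter, Finset.mem_univ, true_and] at hw
        obtain ⟨s, hs, hv, hw⟩ := hw
        simp only [Finset.mem_biUnion, Finset.mem_filter, id]
        exact ⟨s, ⟨hs, hv⟩, hw⟩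
      have key : (Finset.univ.filter (fun w => ∃ s ∈ K, v ∈ s ∧ w ∈ s)).card ≤ L * (k + 1) :=
        (Finset.card_le_card this).trans
        ((Finset.card_biUnion_le_card_mul _ _ (k + 1) (fun s hs =>
          hK s (Finset.mem_filter.1 hs).1)).trans (Nat.mul_le_mul_right _ (hL v)))
      convert key) (fun _ _ => 0)
  have hnn : ∀ v j, ((G v j).toNat : ℤ) = G v j := fun v j => Int.toNat_of_nonneg (h1 v j).1
  refine ⟨fun v j => (G v j).toNat, ?_, ?_⟩
  · intro v j
    have := (h1 v j).2
    have h3 := hnn v j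
    simp only [zero_add] at this
    zify
    rw [h3]
    have := this.le
    push_cast at this
    exact this
  · intro s hs l hl
    have h3 := hq V s G (by have := hK s hs; omega) (by
      intro z _ w _ j
      have := h1 z j
      have := h1 w j
      rw [abs_le]
      constructor <;> linarith) (h2 s (by have := hK s hs; omega) (by
        intro z hz w hw; exact ⟨s, hs, hz, hw⟩)) l hl
    have h4 : ∀ v j, (((G v j).toNat : ℕ) : ℝ) = (G v j : ℝ) := by
      intro v j
      have := hnn v j
      exact_mod_cast congrArg (fun x : ℤ => (x : ℝ)) this
    simp only [h4]
    have h5 := Nat.le_ceil (2 * K0)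
    calc 2 * ∑ v ∈ s, |l v| ≤ (2 * K0) * ‖(fun j => ∑ v ∈ s, l v * (G v j : ℝ) : Fin n → ℝ)‖ := by
          linarith
      _ ≤ _ := by gcongr

lemma tk_sep {V : Type} [Fintype V] {n q m τ : ℕ} (hm : 0 < m) {P : V → Fin n → ℕ}
    (s : Finset V) (hP : ∀ l : V → ℝ, ∑ v ∈ s, l v = 0 →
      2 * ∑ v ∈ s, |l v| ≤ τ * ‖(fun j => ∑ v ∈ s, l v * (P v j : ℝ) : Fin n → ℝ)‖)
    (g : V → Fin n → Fin q) {z z' : V → ℕ} (hz : ∑ v, z v = m) (hz' : ∑ v, z' v = m)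
    (hs : tkSupp z ⊆ s) (hs' : tkSupp z' ⊆ s) {T : ℝ} (hT : 0 ≤ T)
    (h : ∀ j, |tkH m (fun v j => (τ : ℝ) * q * P v j) g z j -
      tkH m (fun v j => (τ : ℝ) * q * P v j) g z' j| ≤ T) :
    (∑ v ∈ s, |(z v : ℝ) - z' v|) * q ≤ m * T := by
  have hm' : (0:ℝ) < m := by exact_mod_cast hm
  have hex : ∀ (y : V → ℕ), tkSupp y ⊆ s → ∀ f : V → ℝ,
      ∑ v, (y v : ℝ) * f v = ∑ v ∈ s, (y v : ℝ) * f v := by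
    intro y hy f
    symm
    apply Finset.sum_subset (Finset.subset_univ _)
    intro v _ hv
    have : y v = 0 := by
      by_contra h0
      exact hv (hy (tk_mem_supp.2 h0))
    simp [this]
  set l : V → ℝ := fun v => (z v : ℝ) - z' v with hl
  have hl0 : ∑ v ∈ s, l v = 0 := by
    have e1 := hex z hs (fun _ => 1)
    have e2 := hex z' hs' (fun _ => 1)
    simp only [mul_one] at e1 e2
    rw [hl, Finset.sum_sub_distrib, ← e1, ← e2]
    have : (∑ v, (z v : ℝ)) = m := by exact_mod_cast hz
    have : (∑ v, (z' v : ℝ)) = m := by exact_mod_cast hz'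
    linarith
  have h1 := hP l hl0
  have h2 : ∀ j, ((m:ℝ) * (tkH m (fun v j => (τ : ℝ) * q * P v j) g z j -
      tkH m (fun v j => (τ : ℝ) * q * P v j) g z' j)) =
      τ * q * (∑ v ∈ s, l v * (P v j : ℝ)) + ∑ v ∈ s, l v * ((g v j : ℕ) : ℝ) := by
    intro j
    unfold tkH
    rw [hex z hs, hex z' hs', Finset.mul_sum, ← Finset.sum_add_distrib, ← sub_div,
      mul_div_cancel₀ _ hm'.ne', ← Finset.sum_sub_distrib]
    apply Finset.sum_congr rfl
    intro v _
    simp only [hl]; ring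
  have h3 : ‖(fun j => ∑ v ∈ s, l v * (P v j : ℝ) : Fin n → ℝ)‖ * (τ * q) ≤
      m * T + q * ∑ v ∈ s, |l v| := by
    rcases Nat.eq_zero_or_pos (τ * q) with h0 | h0
    · have : ((τ:ℝ) * q) = 0 := by exact_mod_cast h0
      rw [this, mul_zero]
      have : 0 ≤ ∑ v ∈ s, |l v| := Finset.sum_nonneg fun _ _ => abs_nonneg _
      positivity
    · have h0' : (0:ℝ) < τ * q := by exact_mod_cast h0
      rw [← le_div_iff₀ h0']
      have : 0 ≤ ∑ v ∈ s, |l v| := Finset.sum_nonneg fun _ _ => abs_nonneg _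
      rw [pi_norm_le_iff_of_nonneg (by positivity)]
      intro j
      rw [Real.norm_eq_abs, le_div_iff₀ h0']
      have h4 : |∑ v ∈ s, l v * ((g v j : ℕ) : ℝ)| ≤ q * ∑ v ∈ s, |l v| := by
        refine (Finset.abs_sum_le_sum_abs _ _).trans ?_
        rw [Finset.mul_sum]
        apply Finset.sum_le_sum
        intro v _
        rw [abs_mul, mul_comm, Nat.abs_cast]
        gcongr
        exact_mod_cast (g v j).2.le
      have h5 : |∑ v ∈ s, l v * (P v j : ℝ)| * (τ * q) = |τ * q * (∑ v ∈ s, l v * (P v j : ℝ))| := by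
        rw [abs_mul, abs_of_pos h0', mul_comm]
      rw [h5]
      have h6 : τ * q * (∑ v ∈ s, l v * (P v j : ℝ)) = ((m:ℝ) * (tkH m (fun v j => (τ : ℝ) * q * P v j) g z j -
        tkH m (fun v j => (τ : ℝ) * q * P v j) g z' j)) - ∑ v ∈ s, l v * ((g v j : ℕ) : ℝ) := by
        rw [h2 j]; ring
      rw [h6]
      refine (abs_sub _ _).trans ?_
      rw [abs_mul, abs_of_pos hm']
      have := h j
      gcongr
  have h7 := mul_le_mul_of_nonneg_right h1 (Nat.cast_nonneg (α := ℝ) q)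
  have h8 : ∑ v ∈ s, |l v| = ∑ v ∈ s, |(z v : ℝ) - z' v| := rfl
  rw [← h8]
  nlinarith

lemma tk_degree {V : Type} [Fintype V] {n : ℕ} {K : Finset (Finset V)} {k L m h D B : ℕ}
    (hm : 0 < m) (hK : ∀ s ∈ K, s.card ≤ k + 1)
    (hL : ∀ v, (K.filter (fun s => v ∈ s)).card ≤ L) (H : (V → ℕ) → Fin n → ℝ)
    (hsep : ∀ z ∈ tkLat K m, ∀ z' ∈ tkLat K m, tkSupp z = tkSupp z' →
      (∀ j, |H z j - H z' j| ≤ ((2 * D : ℕ) : ℝ)) → ∀ v, z v ≤ z' v + B)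
    (hr : ∀ w : Fin (h + 1) → V → ℕ, (∀ i, w i ∈ tkLat K m) →
      (∀ i j, i ≠ j → Disjoint (tkSupp (w i)) (tkSupp (w j))) →
      ¬ ∀ i j, |H (w i) j - H (w 0) j| ≤ ((2 * D : ℕ) : ℝ)) (z0 : V → ℕ) :
    ((tkLat K m).filter (fun z => ∀ j, |H z j - H z0 j| ≤ (D : ℝ))).card ≤
      h * (k + 1) * L * (2 * B + 1) ^ (k + 1) := by
  set NF := (tkLat K m).filter (fun z => ∀ j, |H z j - H z0 j| ≤ (D : ℝ)) with hNF
  have hmem : ∀ z, z ∈ NF ↔ z ∈ tkLat K m ∧ ∀ j, |H z j - H z0 j| ≤ (D : ℝ) := by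
    intro z; simp [hNF]
  have htwo : ∀ z ∈ NF, ∀ z' ∈ NF, ∀ j, |H z j - H z' j| ≤ ((2 * D : ℕ) : ℝ) := by
    intro z hz z' hz' j
    have h1 := ((hmem z).1 hz).2 j
    have h2 := ((hmem z').1 hz').2 j
    rw [abs_le] at h1 h2 ⊢
    push_cast
    constructor <;> linarith [h1.1, h1.2, h2.1, h2.2]
  let good : Finset (V → ℕ) → Prop := fun W =>
    ∀ a ∈ W, ∀ b ∈ W, a ≠ b → Disjoint (tkSupp a) (tkSupp b)
  obtain ⟨W, hW, hmax⟩ := Finset.exists_max_image (NF.powerset.filter good) Finset.card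
    ⟨∅, by simp [good]⟩
  rw [Finset.mem_filter, Finset.mem_powerset] at hW
  have hWc : W.card ≤ h := by
    by_contra hcon
    have : Fintype.card (Fin (h + 1)) ≤ Fintype.card {z // z ∈ W} := by
      rw [Fintype.card_fin, Fintype.card_coe]; omega
    obtain ⟨e⟩ := Function.Embedding.nonempty_of_card_le this
    refine hr (fun i => (e i).1) (fun i => ((hmem _).1 (hW.1 (e i).2)).1) ?_ ?_
    · intro i j hij
      apply hW.2 _ (e i).2 _ (e j).2
      intro h0
      exact hij (e.injective (Subtype.ext h0))
    · intro i j
      exact htwo _ (hW.1 (e i).2) _ (hW.1 (e 0).2) j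
  let U : Finset V := W.biUnion tkSupp
  have hUc : U.card ≤ h * (k + 1) := by
    refine (Finset.card_biUnion_le_card_mul _ _ (k + 1) ?_).trans (Nat.mul_le_mul_right _ hWc)
    intro z hz
    exact hK _ (tk_mem_lat.1 ((hmem z).1 (hW.1 hz)).1).2
  let FS : Finset (Finset V) := U.biUnion (fun v => K.filter (fun s => v ∈ s))
  have hFc : FS.card ≤ h * (k + 1) * L :=
    (Finset.card_biUnion_le_card_mul _ _ L (fun v _ => hL v)).trans (Nat.mul_le_mul_right _ hUc)
  have hcov : NF ⊆ FS.biUnion (fun s => NF.filter (fun z => tkSupp z = s)) := by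
    intro z hz
    rw [Finset.mem_biUnion]
    refine ⟨tkSupp z, ?_, by simp [hz]⟩
    have hzl := tk_mem_lat.1 ((hmem z).1 hz).1
    have hex : ∃ v ∈ tkSupp z, v ∈ U := by
      by_contra hcon
      push Not at hcon
      have hne : (tkSupp z).Nonempty := by
        rw [Finset.nonempty_iff_ne_empty]
        intro h0
        have := tk_sum_supp z
        rw [h0, hzl.1] at this
        simp at this; omega
      have hdis : ∀ a ∈ W, Disjoint (tkSupp z) (tkSupp a) := by
        intro a ha
        rw [Finset.disjoint_left]
        intro v hv hva
        exact hcon v hv (Finset.mem_biUnion.2 ⟨a, ha, hva⟩)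
      have hzW : z ∉ W := by
        intro h0
        have := hdis z h0
        rw [disjoint_self] at this
        exact hne.ne_empty this
      have := hmax (insert z W) (by
        rw [Finset.mem_filter, Finset.mem_powerset]
        refine ⟨Finset.insert_subset hz hW.1, ?_⟩
        intro a ha b hb hab
        rw [Finset.mem_insert] at ha hb
        rcases ha with rfl | ha <;> rcases hb with rfl | hb
        · exact absurd rfl hab
        · exact hdis b hb
        · exact (hdis a ha).symm
        · exact hW.2 a ha b hb hab)
      rw [Finset.card_insert_of_notMem hzW] at this
      omega
    obtain ⟨v, hv, hvU⟩ := hex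
    exact Finset.mem_biUnion.2 ⟨v, hvU, Finset.mem_filter.2 ⟨hzl.2, hv⟩⟩
  refine (Finset.card_le_card hcov).trans
    ((Finset.card_biUnion_le_card_mul _ _ ((2 * B + 1) ^ (k + 1)) ?_).trans
      (Nat.mul_le_mul_right _ hFc))
  intro s hs
  obtain ⟨v, _, hvs⟩ := Finset.mem_biUnion.1 hs
  have hsK := (Finset.mem_filter.1 hvs).1
  rcases (NF.filter (fun z => tkSupp z = s)).eq_empty_or_nonempty with h0 | ⟨z1, hz1⟩
  · rw [h0]; simp
  have hz1' := Finset.mem_filter.1 hz1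
  have hb : ∀ z ∈ NF.filter (fun z => tkSupp z = s), ∀ v, z v ≤ z1 v + B ∧ z1 v ≤ z v + B := by
    intro z hz v
    have hz' := Finset.mem_filter.1 hz
    have l1 := ((hmem z).1 hz'.1).1
    have l2 := ((hmem z1).1 hz1'.1).1
    exact ⟨hsep z l1 z1 l2 (hz'.2.trans hz1'.2.symm) (htwo _ hz'.1 _ hz1'.1) v,
      hsep z1 l2 z l1 (hz1'.2.trans hz'.2.symm) (htwo _ hz1'.1 _ hz'.1) v⟩
  have hc : (NF.filter (fun z => tkSupp z = s)).card ≤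
      (Finset.univ : Finset ({v // v ∈ s} → Fin (2 * B + 1))).card := by
    apply Finset.card_le_card_of_injOn (fun (z : V → ℕ) (v : {v // v ∈ s}) => Fin.ofNat (2 * B + 1) (z v + B - z1 v))
    · intro z _; simp
    · intro z hz w hw hzw
      rw [Finset.mem_coe] at hz hw
      funext v
      by_cases hv : v ∈ s
      · have h3 := congrArg Fin.val (congrFun hzw ⟨v, hv⟩)
        simp only [Fin.ofNat] at h3
        have a1 := hb z hz v
        have a2 := hb w hw v
        rw [Nat.mod_eq_of_lt (by omega), Nat.mod_eq_of_lt (by omega)] at h3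
        omega
      · have e1 : z v = 0 := by
          by_contra hne
          exact hv ((Finset.mem_filter.1 hz).2 ▸ tk_mem_supp.2 hne)
        have e2 : w v = 0 := by
          by_contra hne
          exact hv ((Finset.mem_filter.1 hw).2 ▸ tk_mem_supp.2 hne)
        rw [e1, e2]
  refine hc.trans ?_
  rw [Finset.card_univ, Fintype.card_fun, Fintype.card_fin, Fintype.card_coe]
  exact Nat.pow_le_pow_right (by omega) (hK s hsK)

lemma tk_choose_q (k n κ c : ℕ) (hn : 2 * k + 1 ≤ n) (ε : ℝ) (hε : 0 < ε) :
    ∃ (h : ℕ) (C4 : ℝ), 0 < C4 ∧ ∀ N : ℕ, 1 ≤ N → ∃ q : ℕ, 0 < q ∧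
      (q : ℝ) ≤ C4 * (N : ℝ) ^ (((n : ℝ) - (k : ℝ))⁻¹ + ε) ∧
      (N * ((k + 1) * κ * q + 1) ^ k) ^ (h + 1) * (c ^ n) ^ h < (q ^ n) ^ h := by
  obtain ⟨a, ha⟩ : ∃ a, n = k + a := ⟨n - k, by omega⟩
  have ha1 : k + 1 ≤ a := by omega
  have ha0 : (1:ℝ) ≤ a := by exact_mod_cast (by omega : 1 ≤ a)
  set h : ℕ := k + 1 + ⌈((a:ℝ) + k) / ε⌉₊ with hh
  obtain ⟨p, hp⟩ : ∃ p, a * h = k + p := by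
    refine ⟨a * h - k, ?_⟩
    have : k ≤ a * h := le_trans (by omega : k ≤ 1 * h) (Nat.mul_le_mul_right _ (by omega))
    omega
  have hp1 : 1 ≤ p := by
    have : 1 * h ≤ a * h := Nat.mul_le_mul_right _ (by omega)
    omega
  have hph : ((a:ℝ) + k) / ε ≤ p := by
    have h1 : h ≤ k + p := by
      rw [← hp]; exact le_trans (by omega) (Nat.mul_le_mul_right h (by omega : 1 ≤ a))
    have h2 : ⌈((a:ℝ) + k) / ε⌉₊ ≤ p := by omega
    exact (Nat.le_ceil _).trans (by exact_mod_cast h2)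
  set e : ℝ := ((n : ℝ) - (k : ℝ))⁻¹ + ε with he
  have hea : e = (a:ℝ)⁻¹ + ε := by rw [he, ha]; push_cast; congr 2; ring
  have hep : ((h + 1 : ℕ) : ℝ) ≤ e * p := by
    rw [hea]
    have h1 : (a:ℝ) * h = k + p := by exact_mod_cast hp
    rw [div_le_iff₀ hε] at hph
    have h2 : (h:ℝ) = (k + p) / a := by field_simp; linarith
    push_cast
    rw [h2]
    have h3 : ((k:ℝ) + p) / a + 1 ≤ (a:ℝ)⁻¹ * p + (a + k) := by
      have : (k:ℝ) / a ≤ k := div_le_self (Nat.cast_nonneg _) ha0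
      rw [add_div, div_eq_inv_mul (p:ℝ)]
      linarith
    linarith
  have he0 : 0 ≤ e := by rw [hea]; positivity
  set C3 : ℕ := ((k + 1) * κ + 1) ^ (k * (h + 1)) * (c ^ n) ^ h with hC3
  refine ⟨h, ((C3 + 1 : ℕ) : ℝ) * 2, by positivity, ?_⟩
  intro N hN
  have hN1 : (1:ℝ) ≤ N := by exact_mod_cast hN
  have hNe : (1:ℝ) ≤ (N:ℝ) ^ e := Real.one_le_rpow hN1 he0
  set r : ℕ := ⌈(N:ℝ) ^ e⌉₊ with hr
  have hr1 : (N:ℝ) ^ e ≤ r := Nat.le_ceil _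
  have hr2 : (r:ℝ) ≤ 2 * (N:ℝ) ^ e := by
    have := (Nat.ceil_lt_add_one (by positivity : (0:ℝ) ≤ (N:ℝ) ^ e)).le
    linarith
  have hr0 : 1 ≤ r := by exact_mod_cast hNe.trans hr1
  have hrp : N ^ (h + 1) ≤ r ^ p := by
    have h1 : ((N:ℝ)) ^ (h + 1) ≤ (r:ℝ) ^ p := by
      calc (N:ℝ) ^ (h + 1) = (N:ℝ) ^ ((h + 1 : ℕ) : ℝ) := (Real.rpow_natCast _ _).symm
        _ ≤ (N:ℝ) ^ (e * p) := Real.rpow_le_rpow_of_exponent_le hN1 hep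
        _ = ((N:ℝ) ^ e) ^ p := by rw [Real.rpow_mul (by positivity), Real.rpow_natCast]
        _ ≤ _ := by gcongr
    exact_mod_cast h1
  refine ⟨(C3 + 1) * r, by positivity, ?_, ?_⟩
  · push_cast
    have : (0:ℝ) ≤ (C3:ℝ) + 1 := by positivity
    nlinarith
  · set q := (C3 + 1) * r with hq
    have hq1 : 1 ≤ q := by rw [hq]; exact Nat.one_le_iff_ne_zero.2 (by positivity)
    have hm : (k + 1) * κ * q + 1 ≤ ((k + 1) * κ + 1) * q := by
      rw [add_mul ((k + 1) * κ) 1 q, one_mul]; omega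
    have hqp : C3 * N ^ (h + 1) < q ^ p := by
      rw [hq, mul_pow]
      have h1 : C3 + 1 ≤ (C3 + 1) ^ p := Nat.le_self_pow (by omega) _
      have h2 : 0 < N ^ (h + 1) := by positivity
      calc C3 * N ^ (h + 1) < (C3 + 1) * N ^ (h + 1) := Nat.mul_lt_mul_of_pos_right (by omega) h2
        _ ≤ _ := Nat.mul_le_mul h1 hrp
    calc (N * ((k + 1) * κ * q + 1) ^ k) ^ (h + 1) * (c ^ n) ^ h
        ≤ (N * (((k + 1) * κ + 1) * q) ^ k) ^ (h + 1) * (c ^ n) ^ h := by gcongr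
      _ = q ^ (k * (h + 1)) * (C3 * N ^ (h + 1)) := by
          rw [hC3, mul_pow N, ← pow_mul, mul_pow _ q]
          generalize (c ^ n) ^ h = y
          generalize ((k + 1) * κ + 1) ^ (k * (h + 1)) = y1
          generalize q ^ (k * (h + 1)) = y2
          ring
      _ < q ^ (k * (h + 1)) * q ^ p := Nat.mul_lt_mul_of_pos_left hqp (by positivity)
      _ = (q ^ n) ^ h := by
          rw [← pow_add, ← pow_mul]
          congr 1
          rw [ha, add_mul, hp]; ring

def tkDelta {d : ℕ} (K : Finset (Finset (Fin d))) : Set (Fin d → ℝ) :=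
  {x | (∀ v, 0 ≤ x v) ∧ ∑ v, x v = 1 ∧ Finset.univ.filter (fun v => x v ≠ 0) ∈ K}

lemma tkDelta_lat {d m : ℕ} {K : Finset (Finset (Fin d))}
    (hdown : ∀ s ∈ K, ∀ t ⊆ s, t.Nonempty → t ∈ K) (hm : 0 < m) {x : Fin d → ℝ}
    (hx : x ∈ tkDelta K) (f : (Fin d → ℕ) → ℝ) :
    ∑ z ∈ tkLat K m, tkA m x z * f z =
      ∑ z ∈ Finset.piAntidiag Finset.univ m, tkA m x z * f z := by
  have hsub : tkLat K m ⊆ Finset.piAntidiag Finset.univ m := by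
    intro z hz
    have := (tk_mem_lat.1 hz).1
    simp [Finset.mem_piAntidiag, this]
  apply Finset.sum_subset hsub
  intro z hz hnl
  by_contra hne
  have hne' : tkA m x z ≠ 0 := left_ne_zero_of_mul hne
  apply hnl
  refine tk_mem_lat.2 ⟨by simpa [Finset.mem_piAntidiag] using hz, ?_⟩
  apply hdown _ hx.2.2
  · intro v hv
    simp only [Finset.mem_filter, Finset.mem_univ, true_and]
    intro h0
    exact tk_mem_supp.1 hv (tkA_supp hne' v h0)
  · rw [Finset.nonempty_iff_ne_empty]
    intro h0
    have h1 := tk_sum_supp z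
    have h2 : ∑ v, z v = m := by simpa [Finset.mem_piAntidiag] using hz
    rw [h0, h2] at h1
    simp at h1; omega

lemma tkDelta_one {d m : ℕ} {K : Finset (Finset (Fin d))}
    (hdown : ∀ s ∈ K, ∀ t ⊆ s, t.Nonempty → t ∈ K) (hm : 0 < m) {x : Fin d → ℝ}
    (hx : x ∈ tkDelta K) : ∑ z ∈ tkLat K m, tkA m x z = 1 := by
  have := tkDelta_lat hdown hm hx (fun _ => 1)
  simp only [mul_one] at this
  rw [this, tk_interp_one hx.1 hx.2.1]

lemma tkDelta_coord {d m : ℕ} {K : Finset (Finset (Fin d))}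
    (hdown : ∀ s ∈ K, ∀ t ⊆ s, t.Nonempty → t ∈ K) (hm : 0 < m) {x : Fin d → ℝ}
    (hx : x ∈ tkDelta K) (v : Fin d) :
    ∑ z ∈ tkLat K m, tkA m x z * (z v : ℝ) = m * x v := by
  rw [tkDelta_lat hdown hm hx (fun z => (z v : ℝ)), tk_interp_coord hx.1 hx.2.1]

lemma tkDelta_H {d m k n : ℕ} {K : Finset (Finset (Fin d))} (hK : ∀ s ∈ K, s.card ≤ k + 1)
    (hm : 0 < m) {x : Fin d → ℝ} (hx : x ∈ tkDelta K) {F : Fin d → Fin n → ℝ} {R : ℝ}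
    (hF : ∀ v j, 0 ≤ F v j ∧ F v j ≤ R) (hR : (k + 1) * R ≤ m) {z : Fin d → ℕ}
    (hz : tkA m x z ≠ 0) (j : Fin n) :
    |(∑ v, (z v : ℝ) * F v j) / m - ∑ v, x v * F v j| ≤ 1 := by
  have hm' : (0:ℝ) < m := by exact_mod_cast hm
  have h1 : (∑ v, (z v : ℝ) * F v j) / m - ∑ v, x v * F v j =
      (∑ v, ((z v : ℝ) - m * x v) * F v j) / m := by
    simp only [sub_mul]
    rw [Finset.sum_sub_distrib, sub_div]
    congr 1
    rw [eq_div_iff hm'.ne', Finset.sum_mul]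
    exact Finset.sum_congr rfl fun v _ => by ring
  rw [h1, abs_div, abs_of_pos hm', div_le_one hm']
  set s := Finset.univ.filter (fun v => x v ≠ 0) with hs
  have h2 : ∑ v, ((z v : ℝ) - m * x v) * F v j = ∑ v ∈ s, ((z v : ℝ) - m * x v) * F v j := by
    symm
    apply Finset.sum_subset (Finset.subset_univ _)
    intro v _ hv
    have h0 : x v = 0 := by simpa [hs] using hv
    rw [tkA_supp hz v h0, h0]; simp
  rw [h2]
  refine (Finset.abs_sum_le_sum_abs _ _).trans ?_
  rcases s.eq_empty_or_nonempty with h0 | ⟨v0, _⟩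
  · rw [h0]; simp
  have hR0 : 0 ≤ R := (hF v0 j).1.trans (hF v0 j).2
  have h3 : ∀ v ∈ s, |((z v : ℝ) - m * x v) * F v j| ≤ R := by
    intro v _
    rw [abs_mul, abs_of_nonneg (hF v j).1]
    have := (tkA_close hz v).le
    nlinarith [(hF v j).1, (hF v j).2, abs_nonneg ((z v : ℝ) - m * x v)]
  refine (Finset.sum_le_card_nsmul _ _ _ h3).trans ?_
  rw [nsmul_eq_mul]
  have h4 : (s.card : ℝ) ≤ k + 1 := by exact_mod_cast hK s hx.2.2
  nlinarith

lemma tk_J {d m k n Q : ℕ} (hn : 2 * k + 1 ≤ n) (hQ : 1 ≤ Q) {Kq : ℝ} (hKq : 0 < Kq)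
    (hquant : ∀ (Z : Type) (S : Finset Z) (G : Z → Fin n → ℤ),
      S.card ≤ n + 1 → (∀ z ∈ S, ∀ w ∈ S, ∀ j, |G z j - G w j| ≤ ((9 * Q : ℕ) : ℤ)) → tkAI S G →
      ∀ l : Z → ℝ, ∑ z ∈ S, l z = 0 →
      ∑ z ∈ S, |l z| ≤ Kq * ‖(fun j => ∑ z ∈ S, l z * (G z j : ℝ) : Fin n → ℝ)‖)
    {K : Finset (Finset (Fin d))} (hK : ∀ s ∈ K, s.card ≤ k + 1)
    (hdown : ∀ s ∈ K, ∀ t ⊆ s, t.Nonempty → t ∈ K)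
    (hm : 0 < m) {F : Fin d → Fin n → ℝ} {R : ℝ} (hR0 : 0 ≤ R)
    (hF : ∀ v j, 0 ≤ F v j ∧ F v j ≤ R) (hR : (k + 1) * R ≤ m)
    (H : (Fin d → ℕ) → Fin n → ℝ) (hH : ∀ z j, H z j = (∑ v, (z v : ℝ) * F v j) / m)
    (G : (Fin d → ℕ) → Fin n → ℤ)
    (hG1 : ∀ z ∈ tkLat K m, ∀ j, |(G z j : ℝ) - Q * H z j| ≤ Q)
    (hG2 : ∀ S ⊆ tkLat K m, S.card ≤ n + 1 →
      (∀ z ∈ S, ∀ w ∈ S, ∀ j, |H z j - H w j| ≤ 7) → tkAI S G) :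
    ∃ J : (Fin d → ℝ) → (Fin n → ℝ), Continuous J ∧
      (∀ x ∈ tkDelta K, ‖J x‖ ≤ Q * (R + 2)) ∧
      ∀ x ∈ tkDelta K, ∀ y ∈ tkDelta K, ∀ v, |x v - y v| ≤ (Kq + 1) * ‖J x - J y‖ := by
  have hQ' : (1:ℝ) ≤ Q := by exact_mod_cast hQ
  have hm' : (0:ℝ) < m := by exact_mod_cast hm
  set J : (Fin d → ℝ) → (Fin n → ℝ) := fun x j => ∑ z ∈ tkLat K m, tkA m x z * (G z j : ℝ) with hJ
  have hc : ∀ x ∈ tkDelta K, ∀ z, tkA m x z ≠ 0 → ∀ j, |H z j - ∑ v, x v * F v j| ≤ 1 := by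
    intro x hx z hz j
    rw [hH]
    exact tkDelta_H hK hm hx hF hR hz j
  have hJF : ∀ x ∈ tkDelta K, ∀ j, |J x j - Q * ∑ v, x v * F v j| ≤ 2 * Q := by
    intro x hx j
    have h1 := tkDelta_one hdown hm hx
    have h2 : J x j - Q * ∑ v, x v * F v j =
        ∑ z ∈ tkLat K m, tkA m x z * ((G z j : ℝ) - Q * ∑ v, x v * F v j) := by
      simp only [mul_sub]
      rw [Finset.sum_sub_distrib, ← Finset.sum_mul, h1, one_mul]
    rw [h2]
    calc |∑ z ∈ tkLat K m, tkA m x z * ((G z j : ℝ) - Q * ∑ v, x v * F v j)|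
        ≤ ∑ z ∈ tkLat K m, |tkA m x z * ((G z j : ℝ) - Q * ∑ v, x v * F v j)| :=
          Finset.abs_sum_le_sum_abs _ _
      _ ≤ ∑ z ∈ tkLat K m, tkA m x z * (2 * Q) := by
          apply Finset.sum_le_sum
          intro z hz
          rw [abs_mul, abs_of_nonneg (tkA_nonneg _ _ _)]
          by_cases h0 : tkA m x z = 0
          · simp [h0]
          apply mul_le_mul_of_nonneg_left _ (tkA_nonneg _ _ _)
          have h3 := hc x hx z h0 j
          have h4 := hG1 z hz j
          have h5 : |(Q:ℝ) * (H z j - ∑ v, x v * F v j)| ≤ Q := by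
            rw [abs_mul, abs_of_pos (by linarith)]
            nlinarith
          have h6 : (G z j : ℝ) - Q * ∑ v, x v * F v j =
            ((G z j : ℝ) - Q * H z j) + Q * (H z j - ∑ v, x v * F v j) := by ring
          rw [h6]
          refine (abs_add_le _ _).trans ?_
          linarith
      _ = 2 * Q := by rw [← Finset.sum_mul, h1, one_mul]
  refine ⟨J, ?_, ?_, ?_⟩
  · apply continuous_pi
    intro j
    apply continuous_finsetSum
    intro z _
    exact (tkA_continuous m z).mul continuous_const
  · intro x hx
    rw [pi_norm_le_iff_of_nonneg (by positivity)]
    intro j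
    rw [Real.norm_eq_abs]
    have h1 := hJF x hx j
    have h2 : 0 ≤ ∑ v, x v * F v j := Finset.sum_nonneg fun v _ => mul_nonneg (hx.1 v) (hF v j).1
    have h3 : ∑ v, x v * F v j ≤ R := by
      calc ∑ v, x v * F v j ≤ ∑ v, x v * R :=
            Finset.sum_le_sum fun v _ => mul_le_mul_of_nonneg_left (hF v j).2 (hx.1 v)
        _ = R := by rw [← Finset.sum_mul, hx.2.1, one_mul]
    rw [abs_le] at h1 ⊢
    constructor <;> nlinarith
  · intro x hx y hy v
    have hle1 : ∀ x ∈ tkDelta K, x v ≤ 1 := by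
      intro x hx
      rw [← hx.2.1]
      exact Finset.single_le_sum (f := x) (fun v _ => hx.1 v) (Finset.mem_univ v)
    by_cases hbig : ‖J x - J y‖ ≤ Q
    swap
    · push Not at hbig
      have h1 : |x v - y v| ≤ 1 := by
        rw [abs_le]
        constructor <;> linarith [hle1 x hx, hle1 y hy, hx.1 v, hy.1 v]
      have h2 := norm_nonneg (J x - J y)
      nlinarith
    have hFxy : ∀ j, |∑ v, x v * F v j - ∑ v, y v * F v j| ≤ 5 := by
      intro j
      have h1 := hJF x hx j
      have h2 := hJF y hy j
      have h3 := (norm_le_pi_norm (J x - J y) j).trans hbig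
      rw [Real.norm_eq_abs, Pi.sub_apply] at h3
      rw [abs_le] at h1 h2 h3 ⊢
      constructor <;> nlinarith
    set S := (tkLat K m).filter (fun z => tkA m x z ≠ 0 ∨ tkA m y z ≠ 0) with hS
    have hSn : ∀ z ∈ S, ∀ w ∈ S, ∀ j, |H z j - H w j| ≤ 7 := by
      intro z hz w hw j
      have hz := (Finset.mem_filter.1 hz).2
      have hw := (Finset.mem_filter.1 hw).2
      have h5 := hFxy j
      rw [abs_le] at h5 ⊢
      rcases hz with hz | hz <;> rcases hw with hw | hw
      · have h1 := abs_le.1 (hc x hx z hz j)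
        have h2 := abs_le.1 (hc x hx w hw j)
        constructor <;> linarith [h1.1, h1.2, h2.1, h2.2]
      · have h1 := abs_le.1 (hc x hx z hz j)
        have h2 := abs_le.1 (hc y hy w hw j)
        constructor <;> linarith [h1.1, h1.2, h2.1, h2.2, h5.1, h5.2]
      · have h1 := abs_le.1 (hc y hy z hz j)
        have h2 := abs_le.1 (hc x hx w hw j)
        constructor <;> linarith [h1.1, h1.2, h2.1, h2.2, h5.1, h5.2]
      · have h1 := abs_le.1 (hc y hy z hz j)
        have h2 := abs_le.1 (hc y hy w hw j)
        constructor <;> linarith [h1.1, h1.2, h2.1, h2.2]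
    have hSc : S.card ≤ n + 1 := by
      have h1 : S ⊆ (tkLat K m).filter (fun z => tkA m x z ≠ 0) ∪
          (tkLat K m).filter (fun z => tkA m y z ≠ 0) := by
        intro z hz
        have := Finset.mem_filter.1 hz
        rw [Finset.mem_union, Finset.mem_filter, Finset.mem_filter]
        tauto
      have h2 := (Finset.card_le_card h1).trans (Finset.card_union_le _ _)
      have h3 := (tk_card (m := m) hx.2.1 ((tkLat K m).filter (fun z => tkA m x z ≠ 0))
        (fun z hz => (Finset.mem_filter.1 hz).2)).trans (hK _ hx.2.2)
      have h4 := (tk_card (m := m) hy.2.1 ((tkLat K m).filter (fun z => tkA m y z ≠ 0))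
        (fun z hz => (Finset.mem_filter.1 hz).2)).trans (hK _ hy.2.2)
      omega
    have hSl : S ⊆ tkLat K m := Finset.filter_subset _ _
    set l : (Fin d → ℕ) → ℝ := fun z => tkA m x z - tkA m y z with hl
    have hsum : ∀ f : (Fin d → ℕ) → ℝ, ∑ z ∈ S, l z * f z =
        ∑ z ∈ tkLat K m, tkA m x z * f z - ∑ z ∈ tkLat K m, tkA m y z * f z := by
      intro f
      rw [← Finset.sum_sub_distrib]
      rw [Finset.sum_subset hSl]
      · exact Finset.sum_congr rfl fun z _ => by simp only [hl]; ring
      · intro z hz hzS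
        have : ¬ (tkA m x z ≠ 0 ∨ tkA m y z ≠ 0) := fun h => hzS (Finset.mem_filter.2 ⟨hz, h⟩)
        push Not at this
        simp [hl, this.1, this.2]
    have hl0 : ∑ z ∈ S, l z = 0 := by
      have := hsum (fun _ => 1)
      simp only [mul_one] at this
      rw [this, tkDelta_one hdown hm hx, tkDelta_one hdown hm hy, sub_self]
    have hq := hquant _ S G hSc (by
      intro z hz w hw j
      have h1 := abs_le.1 (hG1 z (hSl hz) j)
      have h2 := abs_le.1 (hG1 w (hSl hw) j)
      have h3 := abs_le.1 (hSn z hz w hw j)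
      have h4 : |((G z j : ℝ) - G w j)| ≤ ((9 * Q : ℕ) : ℝ) := by
        push_cast
        rw [abs_le]
        constructor <;> nlinarith
      exact_mod_cast h4) (hG2 S hSl hSc hSn) l hl0
    have hJJ : (fun j => ∑ z ∈ S, l z * (G z j : ℝ) : Fin n → ℝ) = J x - J y := by
      funext j
      rw [hsum, Pi.sub_apply]
    rw [hJJ] at hq
    have hxy : (m:ℝ) * (x v - y v) = ∑ z ∈ S, l z * (z v : ℝ) := by
      rw [hsum, tkDelta_coord hdown hm hx, tkDelta_coord hdown hm hy]; ring
    have hb : (m:ℝ) * |x v - y v| ≤ m * ∑ z ∈ S, |l z| := by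
      rw [← abs_of_pos hm', ← abs_mul, abs_of_pos hm', hxy]
      refine (Finset.abs_sum_le_sum_abs _ _).trans ?_
      rw [Finset.mul_sum]
      apply Finset.sum_le_sum
      intro z hz
      rw [abs_mul, mul_comm, Nat.abs_cast]
      gcongr
      rw [← (tk_mem_lat.1 (hSl hz)).1]
      exact Finset.single_le_sum (f := z) (fun _ _ => Nat.zero_le _) (Finset.mem_univ v)
    have h1 := le_of_mul_le_mul_left hb hm'
    have h2 := norm_nonneg (J x - J y)
    nlinarith

lemma tk_A (k n L : ℕ) (hn : 2 * k + 1 ≤ n) (ε : ℝ) (hε : 0 < ε) :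
    ∃ Kc C : ℝ, 0 < Kc ∧ 0 < C ∧ ∀ (d : ℕ) (K : Finset (Finset (Fin d))),
      (∀ s ∈ K, s.card ≤ k + 1) → (∀ s ∈ K, ∀ t ⊆ s, t.Nonempty → t ∈ K) →
      (∀ v, (K.filter (fun s => v ∈ s)).card ≤ L) → 1 ≤ K.card →
      ∃ J : (Fin d → ℝ) → (Fin n → ℝ), Continuous J ∧
      (∀ x ∈ tkDelta K, ‖J x‖ ≤ C * (K.card : ℝ) ^ (((n : ℝ) - (k : ℝ))⁻¹ + ε)) ∧
      ∀ x ∈ tkDelta K, ∀ y ∈ tkDelta K, ∀ v, |x v - y v| ≤ Kc * ‖J x - J y‖ := by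
  obtain ⟨τ, Q0, hstep⟩ := tk_step1 k n L hn
  set κ : ℕ := τ * Q0 + 1 with hκ
  obtain ⟨h, C4, hC4, hch⟩ := tk_choose_q k n κ (2 * 14 * (k + 1) + 1) hn ε hε
  set B : ℕ := 14 * (k + 1) * κ with hB
  set M : ℕ := h * (k + 1) * L * (2 * B + 1) ^ (k + 1) with hM
  set Q : ℕ := 2 ^ M + 1 with hQ
  obtain ⟨Kq, hKq, hquant⟩ := tk_quant n (9 * Q)
  refine ⟨Kq + 1, Q * (κ + 2) * C4, by positivity, by positivity, ?_⟩
  intro d K hK hdown hL hN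
  obtain ⟨q, hq, hqN, hlt⟩ := hch K.card hN
  have hq' : (0:ℝ) < q := by exact_mod_cast hq
  obtain ⟨P, hP1, hP2⟩ := hstep (Fin d) K hK (fun v => by convert hL v)
  set m : ℕ := (k + 1) * κ * q with hm
  have hm0 : 0 < m := by positivity
  obtain ⟨g, hg⟩ := tk_random (n := n) (K := K) (m := m) hK hm0 hq
    (fun v j => (τ : ℝ) * q * P v j) 14 h (lt_of_le_of_lt (by
      gcongr
      exact tk_lat_card K m k hK hm0) hlt)
  set H := tkH m (fun v j => (τ : ℝ) * q * P v j) g with hH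
  have hsep : ∀ z ∈ tkLat K m, ∀ z' ∈ tkLat K m, tkSupp z = tkSupp z' →
      (∀ j, |H z j - H z' j| ≤ ((2 * 7 : ℕ) : ℝ)) → ∀ v, z v ≤ z' v + B := by
    intro z hz z' hz' hzz hh v
    have h1 := tk_sep hm0 (tkSupp z) (hP2 _ (tk_mem_lat.1 hz).2) g (tk_mem_lat.1 hz).1
      (tk_mem_lat.1 hz').1 subset_rfl hzz.symm.subset (T := ((2 * 7 : ℕ) : ℝ)) (by positivity) hh
    have h2 : (∑ v ∈ tkSupp z, |(z v : ℝ) - z' v|) ≤ B := by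
      refine le_of_mul_le_mul_right (h1.trans (le_of_eq ?_)) hq'
      rw [hm, hB]; push_cast; ring
    by_cases hv : v ∈ tkSupp z
    · have h3 := (Finset.single_le_sum (f := fun v => |(z v : ℝ) - z' v|)
        (fun _ _ => abs_nonneg _) hv).trans h2
      have h4 := (le_abs_self _).trans h3
      have h5 : (z v : ℝ) ≤ z' v + B := by linarith
      exact_mod_cast h5
    · have : z v = 0 := by
        by_contra h0; exact hv (tk_mem_supp.2 h0)
      omega
  have hdeg := tk_degree (D := 7) (B := B) (h := h) (L := L) hm0 hK
    (fun v => by convert hL v) H hsep (by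
      intro w hw1 hw2
      have := hg w hw1 hw2
      norm_num at this ⊢
      exact this)
  obtain ⟨G0, hG1, hG2⟩ := tk_genpos (n := n) (by omega) M
    (Z := {z // z ∈ tkLat K m}) (fun z w => ∀ j, |H w.1 j - H z.1 j| ≤ ((7 : ℕ) : ℝ)) (by
      intro z
      refine le_trans (Finset.card_le_card_of_injOn Subtype.val ?_ ?_) (hdeg z.1)
      · intro w hw
        simp only [Finset.coe_filter, Finset.mem_univ, true_and, Set.mem_ofPred_eq] at hw ⊢
        exact ⟨w.2, hw⟩
      · intro a _ b _ hab
        exact Subtype.ext hab)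
    (fun z j => (Q : ℤ) * ⌊H z.1 j⌋)
  set G : (Fin d → ℕ) → Fin n → ℤ := fun z => if hz : z ∈ tkLat K m then G0 ⟨z, hz⟩ else 0 with hGdef
  have hGG : ∀ z : {z // z ∈ tkLat K m}, G z.1 = G0 z := by
    intro z; simp only [hGdef]; rw [dif_pos z.2]
  obtain ⟨J, hJ1, hJ2, hJ3⟩ := tk_J (m := m) (Q := Q) hn (Nat.succ_le_succ (Nat.zero_le _)) hKq hquant hK hdown hm0
    (F := fun v j => (τ : ℝ) * q * P v j + ((g v j : ℕ) : ℝ)) (R := κ * q) (by positivity)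
    (by
      intro v j
      refine ⟨by positivity, ?_⟩
      have h1 : (P v j : ℝ) ≤ Q0 := by exact_mod_cast hP1 v j
      have h2 : ((g v j : ℕ) : ℝ) ≤ q := by exact_mod_cast (g v j).2.le
      have h3 : (τ : ℝ) * q * P v j ≤ τ * q * Q0 := by gcongr
      rw [hκ]; push_cast
      linarith)
    (by rw [hm]; push_cast; apply le_of_eq; ring) H (fun z j => rfl) G (by
      intro z hz j
      have h1 := hG1 ⟨z, hz⟩ j
      rw [← hGG ⟨z, hz⟩] at h1
      have h2 : ((Q:ℤ) * ⌊H z j⌋ : ℝ) ≤ G z j := by exact_mod_cast h1.1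
      have h3 : (G z j : ℝ) < (Q:ℤ) * ⌊H z j⌋ + (Q : ℤ) := by exact_mod_cast h1.2
      have h4 := Int.floor_le (H z j)
      have h5 := (Int.lt_floor_add_one (H z j)).le
      have h6 : (0:ℝ) ≤ Q := by positivity
      push_cast at h2 h3
      have h7 := mul_le_mul_of_nonneg_left h4 h6
      have h8 := mul_le_mul_of_nonneg_left h5 h6
      rw [abs_le]
      constructor <;> linarith) (by
      intro S hS hSc hSn l hl0 hl1 z hz
      have h1 := hG2 (S.subtype (fun z => z ∈ tkLat K m)) (by
        rw [Finset.card_subtype]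
        exact (Finset.card_filter_le _ _).trans hSc) (by
        intro z hz w hw j
        rw [Finset.mem_subtype] at hz hw
        have := hSn w.1 hw z.1 hz j
        push_cast
        exact this) (fun z => l z.1) (by
        rw [← hl0]
        exact Finset.sum_subtype_of_mem l hS) (by
        intro j
        rw [← hl1 j, ← Finset.sum_subtype_of_mem (fun z => l z * (G z j : ℝ)) hS]
        exact Finset.sum_congr rfl fun z _ => by rw [hGG]) ⟨z, hS hz⟩ (Finset.mem_subtype.2 hz)
      exact h1)
  refine ⟨J, hJ1, ?_, hJ3⟩
  intro x hx
  refine (hJ2 x hx).trans ?_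
  have hq1 : (1:ℝ) ≤ q := by exact_mod_cast hq
  have : (κ : ℝ) * q + 2 ≤ (κ + 2) * q := by linarith
  calc (Q:ℝ) * (κ * q + 2) ≤ Q * ((κ + 2) * q) := by gcongr
    _ ≤ Q * ((κ + 2) * (C4 * (K.card : ℝ) ^ (((n : ℝ) - (k : ℝ))⁻¹ + ε))) := by gcongr
    _ = _ := by ring

lemma tkDelta_compact {d : ℕ} {K : Finset (Finset (Fin d))}
    (hdown : ∀ s ∈ K, ∀ t ⊆ s, t.Nonempty → t ∈ K) : IsCompact (tkDelta K) := by
  have h1 : tkDelta K = ⋃ s ∈ K, {x : Fin d → ℝ | (∀ v, 0 ≤ x v) ∧ ∑ v, x v = 1 ∧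
      ∀ v, v ∉ s → x v = 0} := by
    ext x
    simp only [Set.mem_iUnion, Set.mem_ofPred_eq, tkDelta]
    constructor
    · rintro ⟨a, b, c⟩
      refine ⟨_, c, a, b, ?_⟩
      intro v hv
      simpa using hv
    · rintro ⟨s, hs, a, b, c⟩
      refine ⟨a, b, hdown s hs _ ?_ ?_⟩
      · intro v hv
        by_contra h0
        simp [c v h0] at hv
      · by_contra h0
        rw [Finset.not_nonempty_iff_eq_empty, Finset.filter_eq_empty_iff] at h0
        rw [Finset.sum_eq_zero (fun v _ => by simpa using h0 (Finset.mem_univ v))] at b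
        exact zero_ne_one b
  rw [h1]
  apply K.isCompact_biUnion
  intro s _
  apply IsCompact.of_isClosed_subset (isCompact_Icc (a := (0 : Fin d → ℝ)) (b := 1))
  · have e : {x : Fin d → ℝ | (∀ v, 0 ≤ x v) ∧ ∑ v, x v = 1 ∧ ∀ v, v ∉ s → x v = 0} =
        (⋂ v, {x : Fin d → ℝ | 0 ≤ x v}) ∩ ({x : Fin d → ℝ | ∑ v, x v = 1} ∩
          ⋂ v, ⋂ (_ : v ∉ s), {x : Fin d → ℝ | x v = 0}) := by
      ext x; simp
    rw [e]
    refine IsClosed.inter ?_ (IsClosed.inter ?_ ?_)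
    · exact isClosed_iInter fun v => isClosed_le continuous_const (continuous_apply v)
    · exact isClosed_eq (by fun_prop) continuous_const
    · exact isClosed_iInter fun v => isClosed_iInter fun _ =>
        isClosed_eq (continuous_apply v) continuous_const
  · rintro x ⟨a, b, _⟩
    refine ⟨a, fun v => ?_⟩
    rw [Pi.one_apply, ← b]
    exact Finset.single_le_sum (f := x) (fun v _ => a v) (Finset.mem_univ v)

noncomputable def tkPhi {d : ℕ} (K : Finset (Finset (Fin d))) (S : Finset (Fin d))
    (y : Fin d → ℝ) : ℝ :=
  if h : S.Nonempty ∧ S ∉ K then max 0 (S.inf' h.1 y) else 0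

noncomputable def tkC {d : ℕ} (K : Finset (Finset (Fin d))) (y : Fin d → ℝ) : ℝ :=
  Finset.univ.sup' Finset.univ_nonempty (fun S => tkPhi K S y)

lemma tkC_continuous {d : ℕ} (K : Finset (Finset (Fin d))) : Continuous (tkC K) := by
  unfold tkC
  apply Continuous.finset_sup'_apply
  intro S _
  unfold tkPhi
  by_cases h : S.Nonempty ∧ S ∉ K
  · simp only [dif_pos h]
    apply continuous_const.max
    apply Continuous.finset_inf'_apply
    intro v _
    exact continuous_apply v
  · simp only [dif_neg h]
    exact continuous_const

lemma tkC_nonneg {d : ℕ} (K : Finset (Finset (Fin d))) (y : Fin d → ℝ) : 0 ≤ tkC K y := by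
  have h1 := Finset.le_sup' (fun S => tkPhi K S y) (Finset.mem_univ (∅ : Finset (Fin d)))
  have h2 : tkPhi K ∅ y = 0 := by simp [tkPhi]
  unfold tkC
  rw [← h2]; exact h1

lemma tkC_face {d : ℕ} {K : Finset (Finset (Fin d))} {y : Fin d → ℝ} {S : Finset (Fin d)}
    (hne : S.Nonempty) (h : ∀ v ∈ S, tkC K y < y v) : S ∈ K := by
  by_contra hS
  have h1 := Finset.le_sup' (fun S => tkPhi K S y) (Finset.mem_univ S)
  have h2 : tkPhi K S y ≤ tkC K y := h1
  have h3 : S.inf' hne y ≤ tkPhi K S y := by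
    unfold tkPhi
    rw [dif_pos ⟨hne, hS⟩]
    exact le_max_right _ _
  obtain ⟨v, hv, hv2⟩ := Finset.exists_mem_eq_inf' hne y
  have := h v hv
  rw [hv2] at h3
  linarith

lemma tkC_le {d : ℕ} {K : Finset (Finset (Fin d))}
    (hdown : ∀ s ∈ K, ∀ t ⊆ s, t.Nonempty → t ∈ K) {x y : Fin d → ℝ} (hx : x ∈ tkDelta K)
    {t : ℝ} (ht : 0 ≤ t) (h : ∀ v, |y v - x v| ≤ t) : tkC K y ≤ t := by
  unfold tkC
  apply Finset.sup'_le
  intro S _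
  unfold tkPhi
  split_ifs with hS
  · apply max_le ht
    by_contra hcon
    push Not at hcon
    apply hS.2
    apply hdown _ hx.2.2 S _ hS.1
    intro v hv
    rw [Finset.mem_filter]
    refine ⟨Finset.mem_univ _, fun h0 => ?_⟩
    have h1 := Finset.inf'_le y hv
    have h2 := (le_abs_self _).trans (h v)
    rw [h0] at h2
    linarith
  · exact ht

noncomputable def tkW {d : ℕ} (K : Finset (Finset (Fin d))) (y : Fin d → ℝ) : Fin d → ℝ :=
  fun v => max (y v - tkC K y) 0 / ∑ u, max (y u - tkC K y) 0

lemma tkW_mem {d : ℕ} {K : Finset (Finset (Fin d))} {y : Fin d → ℝ}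
    (hpos : ∃ v, tkC K y < y v) :
    0 < ∑ u, max (y u - tkC K y) 0 ∧ tkW K y ∈ tkDelta K := by
  obtain ⟨v0, hv0⟩ := hpos
  have hσ : 0 < ∑ u, max (y u - tkC K y) 0 :=
    Finset.sum_pos' (fun _ _ => le_max_right _ _)
      ⟨v0, Finset.mem_univ _, lt_max_of_lt_left (by linarith)⟩
  refine ⟨hσ, ?_, ?_, ?_⟩
  · intro v
    exact div_nonneg (le_max_right _ _) hσ.le
  · unfold tkW
    rw [← Finset.sum_div, div_self hσ.ne']
  · apply tkC_face (y := y)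
    · refine ⟨v0, Finset.mem_filter.2 ⟨Finset.mem_univ _, ?_⟩⟩
      exact (div_pos (lt_max_of_lt_left (by linarith)) hσ).ne'
    · intro v hv
      have := (Finset.mem_filter.1 hv).2
      by_contra hcon
      push Not at hcon
      apply this
      unfold tkW
      rw [max_eq_right (by linarith), zero_div]

lemma tkW_self {d : ℕ} {K : Finset (Finset (Fin d))}
    (hdown : ∀ s ∈ K, ∀ t ⊆ s, t.Nonempty → t ∈ K) {x : Fin d → ℝ} (hx : x ∈ tkDelta K) :
    tkW K x = x := by
  have h0 : tkC K x = 0 :=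
    le_antisymm (tkC_le hdown hx le_rfl (fun v => by simp)) (tkC_nonneg _ _)
  funext v
  unfold tkW
  rw [h0]
  have : ∀ u, max (x u - 0) 0 = x u := fun u => by rw [sub_zero]; exact max_eq_left (hx.1 u)
  simp only [this]
  rw [hx.2.1, div_one]

lemma tk_retract {d k : ℕ} {Y : Type} [MetricSpace Y] {K : Finset (Finset (Fin d))}
    (hK : ∀ s ∈ K, s.card ≤ k + 1)
    (hdown : ∀ s ∈ K, ∀ t ⊆ s, t.Nonempty → t ∈ K) {J : (Fin d → ℝ) → Y} (hJ : Continuous J)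
    (hJ2 : ∀ x ∈ tkDelta K, ∀ y ∈ tkDelta K, ∀ v,
      |x v - y v| ≤ (4 * ((k : ℝ) + 1))⁻¹ * dist (J x) (J y)) :
    RetractsOnto (Metric.cthickening 1 (J '' tkDelta K)) (J '' tkDelta K) := by
  set θ : NNReal := (4 * ((k : NNReal) + 1))⁻¹ with hθ
  have hθr : (θ : ℝ) = (4 * ((k : ℝ) + 1))⁻¹ := by rw [hθ]; push_cast; rfl
  have hinj : ∀ x ∈ tkDelta K, ∀ y ∈ tkDelta K, J x = J y → x = y := by
    intro x hx y hy h
    funext v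
    have := hJ2 x hx y hy v
    rw [h, dist_self, mul_zero] at this
    have := abs_nonpos_iff.1 this
    linarith
  let f0 : Y → Fin d → ℝ := fun p => if h : ∃ x ∈ tkDelta K, J x = p then h.choose else 0
  have hf0 : ∀ x ∈ tkDelta K, f0 (J x) = x := by
    intro x hx
    have h : ∃ x' ∈ tkDelta K, J x' = J x := ⟨x, hx, rfl⟩
    simp only [f0, dif_pos h]
    exact hinj _ h.choose_spec.1 _ hx h.choose_spec.2
  have hlip : ∀ v, LipschitzOnWith θ (fun p => f0 p v) (J '' tkDelta K) := by
    intro v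
    apply LipschitzOnWith.of_dist_le_mul
    rintro _ ⟨x, hx, rfl⟩ _ ⟨y, hy, rfl⟩
    rw [hf0 x hx, hf0 y hy, Real.dist_eq, hθr]
    exact hJ2 x hx y hy v
  choose f hf1 hf2 using fun v => (hlip v).extend_real
  let F : Y → Fin d → ℝ := fun p v => f v p
  have hF : Continuous F := continuous_pi fun v => (hf1 v).continuous
  have hFJ : ∀ x ∈ tkDelta K, F (J x) = x := by
    intro x hx
    funext v
    have := hf2 v ⟨x, hx, rfl⟩
    exact this.symm.trans (congrFun (hf0 x hx) v)
  have hcomp : IsCompact (J '' tkDelta K) := (tkDelta_compact hdown).image hJ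
  have hθ0 : (0:ℝ) < θ := by rw [hθr]; positivity
  have hnear : ∀ p ∈ Metric.cthickening 1 (J '' tkDelta K), ∃ v, tkC K (F p) < F p v := by
    intro p hp
    rw [hcomp.cthickening_eq_biUnion_closedBall zero_le_one] at hp
    simp only [Set.mem_iUnion] at hp
    obtain ⟨a, ⟨x, hx, rfl⟩, hp⟩ := hp
    have h1 : ∀ v, |F p v - x v| ≤ θ := by
      intro v
      have h2 := (hf1 v).dist_le_mul p (J x)
      have h3 : f v (J x) = x v := congrFun (hFJ x hx) v
      rw [h3, Real.dist_eq] at h2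
      have h4 : dist p (J x) ≤ 1 := hp
      refine h2.trans ?_
      nlinarith
    have h2 := tkC_le hdown hx hθ0.le h1
    have h3 : ∃ v, ((k:ℝ) + 1)⁻¹ ≤ x v := by
      by_contra hcon
      push Not at hcon
      set s := Finset.univ.filter (fun v => x v ≠ 0) with hs
      have h5 : ∑ v ∈ s, x v = 1 := by rw [← hx.2.1]; exact Finset.sum_filter_ne_zero _
      have hne : s.Nonempty := by
        by_contra h0
        rw [Finset.not_nonempty_iff_eq_empty] at h0
        rw [h0] at h5; simp at h5
      have h6 : ∑ v ∈ s, x v < ∑ v ∈ s, ((k:ℝ) + 1)⁻¹ :=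
        Finset.sum_lt_sum_of_nonempty hne fun v _ => hcon v
      rw [Finset.sum_const, nsmul_eq_mul, h5] at h6
      have h7 : (s.card : ℝ) ≤ k + 1 := by exact_mod_cast hK s hx.2.2
      have h8 : (s.card : ℝ) * ((k:ℝ) + 1)⁻¹ ≤ 1 := by
        rw [← div_eq_mul_inv, div_le_one (by positivity)]; exact h7
      linarith
    obtain ⟨v, hv⟩ := h3
    refine ⟨v, ?_⟩
    have h4 := (abs_le.1 (h1 v)).1
    have h5 : (θ : ℝ) * 4 = ((k:ℝ) + 1)⁻¹ := by rw [hθr]; field_simp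
    linarith
  refine ⟨fun p => ⟨J (tkW K (F p.1)), _, (tkW_mem (hnear p.1 p.2)).2, rfl⟩, ?_, ?_⟩
  · apply Continuous.subtype_mk
    apply hJ.comp
    apply continuous_pi
    intro v
    have hFc : Continuous fun p : Metric.cthickening 1 (J '' tkDelta K) => F p.1 :=
      hF.comp continuous_subtype_val
    have hCc := (tkC_continuous K).comp hFc
    have hu : ∀ u, Continuous fun p : Metric.cthickening 1 (J '' tkDelta K) =>
        max (F p.1 u - tkC K (F p.1)) 0 := fun u =>
      (((continuous_apply u).comp hFc).sub hCc).max continuous_const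
    unfold tkW
    exact (hu v).div (continuous_finsetSum _ fun u _ => hu u)
      (fun p => (tkW_mem (hnear p.1 p.2)).1.ne')
  · rintro ⟨p, hp⟩ ⟨x, hx, rfl⟩
    show J (tkW K (F (J x))) = J x
    rw [hFJ x hx, tkW_self hdown hx]

lemma tk_geom {E : Type} [NormedAddCommGroup E] [NormedSpace ℝ E]
    (X : Geometry.SimplicialComplex ℝ E) (hfin : X.faces.Finite) :
    ∃ (d : ℕ) (K : Finset (Finset (Fin d))) (pt : Fin d → E), Function.Injective pt ∧
      (∀ v, pt v ∈ X.vertices) ∧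
      (∀ s : Finset (Fin d), s ∈ K ↔ s.image pt ∈ X.faces) ∧
      (∀ t ∈ X.faces, ∃ s ∈ K, s.image pt = t) := by
  have hvf : X.vertices.Finite := by
    have : X.vertices = (fun v : E => ({v} : Finset E)) ⁻¹' X.faces := by
      ext v; exact Iff.rfl
    rw [this]
    exact hfin.preimage (fun a _ b _ h => Finset.singleton_injective h)
  have : Fintype X.vertices := hvf.fintype
  let e := Fintype.equivFin X.vertices
  let pt : Fin (Fintype.card X.vertices) → E := fun i => (e.symm i).1
  have hinj : Function.Injective pt := fun a b h => e.symm.injective (Subtype.ext h)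
  refine ⟨_, Finset.univ.filter (fun s => s.image pt ∈ X.faces), pt, hinj, fun v => (e.symm v).2,
    fun s => by simp, ?_⟩
  intro t ht
  have h1 : (Finset.univ.filter (fun v => pt v ∈ t)).image pt = t := by
    ext y
    simp only [Finset.mem_image, Finset.mem_filter, Finset.mem_univ, true_and]
    constructor
    · rintro ⟨v, hv, rfl⟩; exact hv
    · intro hy
      have hyv : y ∈ X.vertices := X.down_closed ht (by simpa using hy) (Finset.singleton_nonempty y)
      refine ⟨e ⟨y, hyv⟩, ?_, ?_⟩ <;> simp [pt, hy]
  exact ⟨_, by simp only [Finset.mem_filter, Finset.mem_univ, true_and]; rw [h1]; exact ht, h1⟩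

lemma tk_homeo {E : Type} [NormedAddCommGroup E] [NormedSpace ℝ E]
    (X : Geometry.SimplicialComplex ℝ E) {d : ℕ} {K : Finset (Finset (Fin d))} {pt : Fin d → E}
    (hinj : Function.Injective pt) (hKf : ∀ s : Finset (Fin d), s ∈ K ↔ s.image pt ∈ X.faces)
    (hsurj : ∀ t ∈ X.faces, ∃ s ∈ K, s.image pt = t)
    (hdown : ∀ s ∈ K, ∀ t ⊆ s, t.Nonempty → t ∈ K) :
    Nonempty (tkDelta K ≃ₜ X.space) := by
  let Φ : (Fin d → ℝ) → E := fun x => ∑ v, x v • pt v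
  have hΦ : Continuous Φ := by
    apply continuous_finsetSum
    intro v _
    exact (continuous_apply v).smul continuous_const
  have hmem : ∀ x ∈ tkDelta K,
      Φ x ∈ convexHull ℝ (((Finset.univ.filter (fun v => x v ≠ 0)).image pt : Finset E) : Set E) := by
    intro x hx
    set s := Finset.univ.filter (fun v => x v ≠ 0) with hs
    have h1 : Φ x = ∑ v ∈ s, x v • pt v := by
      symm
      apply Finset.sum_subset (Finset.subset_univ _)
      intro v _ hv
      have : x v = 0 := by simpa [hs] using hv
      rw [this, zero_smul]
    rw [h1]
    apply (convex_convexHull ℝ _).sum_mem (fun v _ => hx.1 v)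
    · rw [← hx.2.1]; exact Finset.sum_filter_ne_zero _
    · intro v hv
      apply subset_convexHull
      exact Finset.mem_coe.2 (Finset.mem_image_of_mem _ hv)
  have honto : ∀ s ∈ K, ∀ p ∈ convexHull ℝ ((s.image pt : Finset E) : Set E),
      ∃ x ∈ tkDelta K, Φ x = p ∧ ∀ v, v ∉ s → x v = 0 := by
    intro s hs p hp
    rw [Finset.mem_convexHull'] at hp
    obtain ⟨w, hw0, hw1, hw2⟩ := hp
    rw [Finset.sum_image (fun a _ b _ h => hinj h)] at hw1 hw2
    let x : Fin d → ℝ := fun v => if v ∈ s then w (pt v) else 0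
    have hsum : ∑ v, x v = 1 := by
      rw [← hw1]; simp [x]
    refine ⟨x, ⟨?_, hsum, ?_⟩, ?_, ?_⟩
    · intro v
      by_cases hv : v ∈ s
      · simp only [x, if_pos hv]; exact hw0 _ (Finset.mem_image_of_mem _ hv)
      · simp [x, hv]
    · apply hdown s hs
      · intro v hv
        by_contra h0
        simp [x, h0] at hv
      · by_contra h0
        rw [Finset.not_nonempty_iff_eq_empty, Finset.filter_eq_empty_iff] at h0
        rw [Finset.sum_eq_zero (fun v _ => by simpa using h0 (Finset.mem_univ v))] at hsum
        exact zero_ne_one hsum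
    · rw [← hw2]
      simp [Φ, x, ite_smul]
    · intro v hv; simp [x, hv]
  have huniq : ∀ s ∈ K, ∀ x y : Fin d → ℝ, ∑ v, x v = 1 → ∑ v, y v = 1 →
      (∀ v, v ∉ s → x v = 0) → (∀ v, v ∉ s → y v = 0) → Φ x = Φ y → x = y := by
    intro s hs x y hx hy hxs hys hxy
    have hind := X.indep ((hKf s).1 hs)
    let em : {v // v ∈ s} ↪ {y // y ∈ s.image pt} :=
      ⟨fun v => ⟨pt v.1, Finset.mem_image_of_mem _ v.2⟩,
        fun a b h => Subtype.ext (hinj (congrArg Subtype.val h))⟩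
    have hind2 : AffineIndependent ℝ (fun v : {v // v ∈ s} => pt v.1) :=
      hind.comp_embedding em
    rw [affineIndependent_iff] at hind2
    have hred : ∀ (A : Type) [AddCommMonoid A] (f : Fin d → A), (∀ v, v ∉ s → f v = 0) →
        ∑ v : {v // v ∈ s}, f v.1 = ∑ v, f v := by
      intro A _ f hf
      rw [Finset.sum_coe_sort s f]
      exact Finset.sum_subset (Finset.subset_univ _) (fun v _ hv => hf v hv)
    have h1 := hind2 Finset.univ (fun v => x v.1 - y v.1) (by
      rw [hred ℝ (fun v => x v - y v) (fun v hv => by simp [hxs v hv, hys v hv]),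
        Finset.sum_sub_distrib, hx, hy, sub_self]) (by
      rw [hred E (fun v => (x v - y v) • pt v) (fun v hv => by simp [hxs v hv, hys v hv])]
      simp only [sub_smul]
      rw [Finset.sum_sub_distrib, sub_eq_zero]
      exact hxy)
    funext v
    by_cases hv : v ∈ s
    · have := h1 ⟨v, hv⟩ (Finset.mem_univ _)
      simp only at this
      linarith
    · rw [hxs v hv, hys v hv]
  have hsp : ∀ x ∈ tkDelta K, Φ x ∈ X.space := by
    intro x hx
    rw [Geometry.SimplicialComplex.mem_space_iff]
    exact ⟨_, (hKf _).1 hx.2.2, hmem x hx⟩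
  let Φ' : tkDelta K → X.space := fun x => ⟨Φ x.1, hsp x.1 x.2⟩
  have hc : Continuous Φ' := (hΦ.comp continuous_subtype_val).subtype_mk _
  have hbij : Function.Bijective Φ' := by
    constructor
    · rintro ⟨x, hx⟩ ⟨y, hy⟩ h
      have h0 : Φ x = Φ y := congrArg Subtype.val h
      apply Subtype.ext
      show x = y
      set s := Finset.univ.filter (fun v => x v ≠ 0) with hs
      set t := Finset.univ.filter (fun v => y v ≠ 0) with ht
      have hxs : ∀ v, v ∉ s → x v = 0 := fun v hv => by simpa [hs] using hv
      have hyt : ∀ v, v ∉ t → y v = 0 := fun v hv => by simpa [ht] using hv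
      have h1 := X.inter_subset_convexHull ((hKf s).1 hx.2.2) ((hKf t).1 hy.2.2)
        ⟨hmem x hx, h0 ▸ hmem y hy⟩
      have h2 : ((s.image pt : Finset E) : Set E) ∩ ((t.image pt : Finset E) : Set E) =
          (((s ∩ t).image pt : Finset E) : Set E) := by
        rw [Finset.image_inter _ _ hinj, Finset.coe_inter]
      rw [h2] at h1
      have hne : (s ∩ t).Nonempty := by
        by_contra hcon
        rw [Finset.not_nonempty_iff_eq_empty] at hcon
        rw [hcon] at h1
        simp at h1
      obtain ⟨z, hz, hzp, hzs⟩ := honto (s ∩ t)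
        (hdown s hx.2.2 _ Finset.inter_subset_left hne) _ h1
      have e1 := huniq s hx.2.2 x z hx.2.1 hz.2.1 hxs
        (fun v hv => hzs v (fun h => hv (Finset.mem_inter.1 h).1)) hzp.symm
      have e2 := huniq t hy.2.2 y z hy.2.1 hz.2.1 hyt
        (fun v hv => hzs v (fun h => hv (Finset.mem_inter.1 h).2)) (h0.symm.trans hzp.symm)
      rw [e1, e2]
    · rintro ⟨p, hp⟩
      rw [Geometry.SimplicialComplex.mem_space_iff] at hp
      obtain ⟨t, ht, hpt⟩ := hp
      obtain ⟨s, hs, rfl⟩ := hsurj t ht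
      obtain ⟨x, hx, hxp, _⟩ := honto s hs p hpt
      exact ⟨⟨x, hx⟩, Subtype.ext hxp⟩
  have : CompactSpace (tkDelta K) := isCompact_iff_compactSpace.1 (tkDelta_compact hdown)
  have hc' : Continuous (Equiv.ofBijective Φ' hbij) := hc
  exact ⟨hc'.homeoOfEquivCompactToT2⟩

/-- Let `k ≥ 0`, `n ≥ 2k+1`, `L ≥ 1` and `ε > 0`.  There is
`C(n, L, ε) > 0` such that every finite `k`-dimensional simplicial complex with `N ≥ 2`
faces, in which every vertex lies in at most `L` faces, admits a topological embedding
of its polyhedron into the closed ball of radius `C(n, L, ε) * N^(1/(n-k) + ε)` in `ℝⁿ`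
whose closed `1`-neighborhood retracts onto the image. -/
theorem statement14 (k n L : ℕ) (hn : 2 * k + 1 ≤ n) (hL : 1 ≤ L) (ε : ℝ) (hε : 0 < ε) :
    ∃ C : ℝ, 0 < C ∧
      ∀ (E : Type) [NormedAddCommGroup E] [NormedSpace ℝ E]
        (X : Geometry.SimplicialComplex ℝ E) (N : ℕ),
        X.faces.Finite →
        (∀ s ∈ X.faces, s.card ≤ k + 1) →
        X.faces.ncard = N → 2 ≤ N →
        (∀ v ∈ X.vertices, {s | s ∈ X.faces ∧ v ∈ s}.ncard ≤ L) →
        ∃ I : X.space → EuclideanSpace ℝ (Fin n),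
          Continuous I ∧ Function.Injective I ∧
          (∀ x, I x ∈ Metric.closedBall (0 : EuclideanSpace ℝ (Fin n))
            (C * (N : ℝ) ^ (((n : ℝ) - (k : ℝ))⁻¹ + ε))) ∧
          RetractsOnto (Metric.cthickening 1 (Set.range I)) (Set.range I) := by
  obtain ⟨Kc, C, hKc, hC, hA⟩ := tk_A k n L hn ε hε
  have hn0 : (1:ℝ) ≤ n := by exact_mod_cast (by omega : 1 ≤ n)
  set c : ℝ := 4 * ((k:ℝ) + 1) * Kc with hc
  have hc0 : 0 < c := by positivity
  refine ⟨c * (n * C), by positivity, ?_⟩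
  intro E _ _ X N hfin hdim hN hN2 hdeg
  obtain ⟨d, K, pt, hinj, hpt, hKf, hsurj⟩ := tk_geom X hfin
  have himg : Function.Injective (fun s : Finset (Fin d) => s.image pt) :=
    Finset.image_injective hinj
  have hK : ∀ s ∈ K, s.card ≤ k + 1 := by
    intro s hs
    rw [← Finset.card_image_of_injective s hinj]
    exact hdim _ ((hKf s).1 hs)
  have hdown : ∀ s ∈ K, ∀ t ⊆ s, t.Nonempty → t ∈ K := by
    intro s hs t ht hne
    exact (hKf t).2 (X.down_closed ((hKf s).1 hs) (Finset.image_subset_image ht) (hne.image _))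
  have hLK : ∀ v, (K.filter (fun s => v ∈ s)).card ≤ L := by
    intro v
    refine le_trans ?_ (hdeg (pt v) (hpt v))
    rw [← Set.ncard_coe_finset]
    have hfs : {s | s ∈ X.faces ∧ pt v ∈ s}.Finite := hfin.subset (fun s hs => hs.1)
    refine Set.ncard_le_ncard_of_injOn (fun s => s.image pt) ?_ ?_ hfs
    · intro s hs
      have hs := Finset.mem_filter.1 (Finset.mem_coe.1 hs)
      exact ⟨(hKf s).1 hs.1, Finset.mem_image_of_mem _ hs.2⟩
    · exact himg.injOn
  have hKN : K.card = N := by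
    rw [← hN, ← Set.ncard_coe_finset, ← Set.ncard_image_of_injective _ himg]
    congr 1
    ext t
    constructor
    · rintro ⟨s, hs, rfl⟩
      exact (hKf s).1 (Finset.mem_coe.1 hs)
    · intro ht
      obtain ⟨s, hs, hst⟩ := hsurj t ht
      exact ⟨s, Finset.mem_coe.2 hs, hst⟩
  obtain ⟨J, hJ1, hJ2, hJ3⟩ := hA d K hK hdown hLK (by omega)
  obtain ⟨Ψ⟩ := tk_homeo X hinj hKf hsurj hdown
  let J' : (Fin d → ℝ) → EuclideanSpace ℝ (Fin n) := fun x => c • WithLp.toLp 2 (J x)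
  have hJ'c : Continuous J' := ((PiLp.continuous_toLp 2 _).comp hJ1).const_smul c
  have hJ'3 : ∀ x ∈ tkDelta K, ∀ y ∈ tkDelta K, ∀ v,
      |x v - y v| ≤ (4 * ((k : ℝ) + 1))⁻¹ * dist (J' x) (J' y) := by
    intro x hx y hy v
    have h1 : ‖J x - J y‖ ≤ ‖WithLp.toLp 2 (J x - J y)‖ := by
      rw [pi_norm_le_iff_of_nonneg (norm_nonneg _)]
      intro j
      exact PiLp.norm_apply_le (WithLp.toLp 2 (J x - J y)) j
    have h2 : dist (J' x) (J' y) = c * ‖WithLp.toLp 2 (J x - J y)‖ := by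
      rw [dist_eq_norm]
      simp only [J']
      rw [← smul_sub, norm_smul, Real.norm_eq_abs, abs_of_pos hc0, ← WithLp.toLp_sub]
    rw [h2, hc]
    have h3 : (4 * ((k : ℝ) + 1))⁻¹ * (4 * ((k:ℝ) + 1) * Kc * ‖WithLp.toLp 2 (J x - J y)‖) =
        Kc * ‖WithLp.toLp 2 (J x - J y)‖ := by
      field_simp
    rw [h3]
    refine (hJ3 x hx y hy v).trans ?_
    gcongr
  have hrange : Set.range (fun p : X.space => J' (Ψ.symm p).1) = J' '' tkDelta K := by
    ext q
    constructor
    · rintro ⟨p, rfl⟩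
      exact ⟨_, (Ψ.symm p).2, rfl⟩
    · rintro ⟨x, hx, rfl⟩
      exact ⟨Ψ ⟨x, hx⟩, by simp⟩
  refine ⟨fun p => J' (Ψ.symm p).1, ?_, ?_, ?_, ?_⟩
  · exact hJ'c.comp (continuous_subtype_val.comp Ψ.symm.continuous)
  · intro p p' hpp
    apply Ψ.symm.injective
    apply Subtype.ext
    funext v
    have h1 := hJ'3 _ (Ψ.symm p).2 _ (Ψ.symm p').2 v
    have h2 : J' (Ψ.symm p).1 = J' (Ψ.symm p').1 := hpp
    rw [h2, dist_self, mul_zero] at h1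
    have := abs_nonpos_iff.1 h1
    linarith
  · intro p
    rw [mem_closedBall_zero_iff]
    simp only [J']
    rw [norm_smul, Real.norm_eq_abs, abs_of_pos hc0, mul_assoc c (n * C)]
    have h1 := hJ2 _ (Ψ.symm p).2
    rw [hKN] at h1
    set y := J (Ψ.symm p).1 with hy
    apply mul_le_mul_of_nonneg_left _ hc0.le
    have h2 : ‖WithLp.toLp 2 y‖ ≤ n * ‖y‖ := by
      rw [EuclideanSpace.norm_eq, Real.sqrt_le_left (by positivity)]
      have h3 : ∀ j ∈ (Finset.univ : Finset (Fin n)), ‖(WithLp.toLp 2 y : EuclideanSpace ℝ (Fin n)) j‖ ^ 2 ≤ ‖y‖ ^ 2 := by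
        intro j _
        have := norm_le_pi_norm y j
        gcongr
      refine (Finset.sum_le_card_nsmul _ _ _ h3).trans ?_
      rw [Finset.card_univ, Fintype.card_fin, nsmul_eq_mul, mul_pow]
      have : (n:ℝ) ≤ n ^ 2 := by nlinarith
      gcongr
    refine h2.trans ?_
    rw [mul_assoc]
    gcongr
  · rw [hrange]
    exact tk_retract hK hdown hJ'c hJ'3
end

section
/- Let k ≥ 0 and let S₁, …, S_J (J ≥ 1) be finite sets such that no single element belongs to all of S₁, …, S_J, and such that |S₁| ≤ k+1. Then there exists a set of indices I ⊆ {1, …, J} with 1 ∈ I and |I| ≤ k+2 such that no single element belongs to S_i for every i ∈ I. -/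
/-- Let `k ≥ 0` and let `S 0, …, S (J-1)` (with `J ≥ 1`) be finite sets
with empty overall intersection, such that `|S 0| ≤ k + 1`.  Then there is a set of at
most `k + 2` indices, containing the first index, whose corresponding sets already have
empty intersection. -/
theorem statement15 {α : Type*} [DecidableEq α] (k J : ℕ) (hJ : 0 < J)
    (S : Fin J → Finset α) (hcard : (S ⟨0, hJ⟩).card ≤ k + 1)
    (hempty : ¬∃ v : α, ∀ j : Fin J, v ∈ S j) :
    ∃ I : Finset (Fin J), (⟨0, hJ⟩ : Fin J) ∈ I ∧ I.card ≤ k + 2 ∧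
      ¬∃ v : α, ∀ j ∈ I, v ∈ S j := by
  push Not at hempty
  choose f hf using hempty
  refine ⟨insert ⟨0, hJ⟩ ((S ⟨0, hJ⟩).image f), Finset.mem_insert_self _ _, ?_, ?_⟩
  · have h1 := Finset.card_insert_le (⟨0, hJ⟩ : Fin J) ((S ⟨0, hJ⟩).image f)
    have h2 := Finset.card_image_le (s := S ⟨0, hJ⟩) (f := f)
    omega
  · rintro ⟨v, hv⟩
    exact hf v (hv _ (Finset.mem_insert_of_mem
      (Finset.mem_image_of_mem f (hv _ (Finset.mem_insert_self _ _)))))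
end

section
/- For every integer d ≥ 1 there exists a constant c(d) > 0 such that for every δ with 0 < δ ≤ 1 the following holds: the Lebesgue measure of the set of d×d real matrices M lying in the unit ball { M : ‖M‖ ≤ 1 } (where ‖·‖ is the Euclidean/Frobenius norm, identifying d×d matrices with ℝ^{d²}) and satisfying |det M| < c(d)·δ is at most δ times the Lebesgue measure of the unit ball. Equivalently, a matrix chosen uniformly at random from the unit ball in ℝ^{d²} satisfies |det M| ≥ c(d)·δ with probability at least 1−δ. -/
open Metric MeasureTheory

lemma lint_split {α : Type} [MeasurableSpace α] (μ : Measure α) [SigmaFinite μ] (n : ℕ)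
    (i : Fin (n+1)) (f : (Fin (n+1) → α) → ENNReal) (hf : Measurable f) :
    ∫⁻ v, f v ∂(Measure.pi fun _ => μ) =
      ∫⁻ y, ∫⁻ x, f (i.insertNth x y) ∂μ ∂(Measure.pi fun _ : Fin n => μ) := by
  have h := (measurePreserving_piFinSuccAbove (fun _ : Fin (n+1) => μ) i).symm
  rw [← h.lintegral_comp hf]
  rw [lintegral_prod_symm]
  · rfl
  · exact (hf.comp (MeasurableEquiv.measurable _)).aemeasurable

lemma mp_uncurry {ι κ : Type} [Fintype ι] [Fintype κ] (ν : Measure ℝ) [SigmaFinite ν] :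
    MeasurePreserving (fun (V : ι → κ → ℝ) (p : ι × κ) => V p.1 p.2)
      (Measure.pi fun _ => Measure.pi fun _ => ν) (Measure.pi fun _ => ν) := by
  have hm : Measurable (fun (V : ι → κ → ℝ) (p : ι × κ) => V p.1 p.2) := by fun_prop
  refine ⟨hm, (Measure.pi_eq fun s hs => ?_).symm⟩
  rw [Measure.map_apply hm (MeasurableSet.univ_pi hs)]
  have : (fun (V : ι → κ → ℝ) (p : ι × κ) => V p.1 p.2) ⁻¹' (Set.univ.pi s) =
      Set.univ.pi fun i => Set.univ.pi fun j => s (i, j) := by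
    ext V; simp
  rw [this, Measure.pi_pi]
  simp_rw [Measure.pi_pi]
  rw [Fintype.prod_prod_type]

lemma mp_uncurry_swap {ι κ : Type} [Fintype ι] [Fintype κ] (ν : Measure ℝ) [SigmaFinite ν] :
    MeasurePreserving (fun (V : κ → ι → ℝ) (p : ι × κ) => V p.2 p.1)
      (Measure.pi fun _ => Measure.pi fun _ => ν) (Measure.pi fun _ => ν) := by
  have hm : Measurable (fun (V : κ → ι → ℝ) (p : ι × κ) => V p.2 p.1) := by fun_prop
  refine ⟨hm, (Measure.pi_eq fun s hs => ?_).symm⟩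
  rw [Measure.map_apply hm (MeasurableSet.univ_pi hs)]
  have : (fun (V : κ → ι → ℝ) (p : ι × κ) => V p.2 p.1) ⁻¹' (Set.univ.pi s) =
      Set.univ.pi fun j => Set.univ.pi fun i => s (i, j) := by
    ext V; simp; tauto
  rw [this, Measure.pi_pi]
  simp_rw [Measure.pi_pi]
  rw [Fintype.prod_prod_type_right]

lemma lint_transpose {ι κ : Type} [Fintype ι] [Fintype κ] (ν : Measure ℝ) [SigmaFinite ν]
    (f : (ι → κ → ℝ) → ENNReal) (hf : Measurable f) :
    ∫⁻ V, f V ∂(Measure.pi fun _ => Measure.pi fun _ => ν) =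
    ∫⁻ V : κ → ι → ℝ, f (fun i j => V j i) ∂(Measure.pi fun _ => Measure.pi fun _ => ν) := by
  have hg : Measurable (fun X : ι × κ → ℝ => f (fun i j => X (i, j))) :=
    hf.comp (by fun_prop)
  have h1 := (mp_uncurry (ι := ι) (κ := κ) ν).lintegral_comp hg
  have h2 := (mp_uncurry_swap (ι := ι) (κ := κ) ν).lintegral_comp hg
  exact h1.trans h2.symm

noncomputable def nuB : Measure ℝ := volume.restrict (Set.Icc (-1) 1)

instance : IsFiniteMeasure nuB := by unfold nuB; infer_instance

noncomputable def hB (x : ENNReal) : ENNReal := x ^ (-(1/2) : ℝ)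

lemma hB_meas : Measurable hB := by unfold hB; fun_prop

lemma hB_sq (x : ENNReal) : hB x * hB x = x⁻¹ := by
  unfold hB
  rw [← sq, ← ENNReal.rpow_natCast, ← ENNReal.rpow_mul, ← ENNReal.rpow_neg_one]
  norm_num

lemma hB_anti {x y : ENNReal} (h : x ≤ y) : hB y ≤ hB x := by
  unfold hB
  rw [ENNReal.rpow_neg, ENNReal.rpow_neg]
  gcongr

lemma hB_mul (x y : ℝ) : hB ‖x * y‖ₑ = hB ‖x‖ₑ * hB ‖y‖ₑ := by
  unfold hB
  rw [enorm_mul, ENNReal.mul_rpow_of_ne_top] <;> simp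

lemma hB_int_loc : ∫⁻ x in Set.Icc (-1 : ℝ) 1, hB ‖x‖ₑ < ⊤ := by
  have key : ∫⁻ x in Set.Ioo (0 : ℝ) 1, hB ‖x‖ₑ < ⊤ := by
    have := (intervalIntegral.integrableOn_Ioo_rpow_iff (s := -(1/2)) (t := 1) one_pos).2 (by norm_num)
    refine lt_of_le_of_lt (le_of_eq ?_) this.2
    refine setLIntegral_congr_fun measurableSet_Ioo fun x hx => ?_
    unfold hB
    simp only
    rw [Real.enorm_of_nonneg hx.1.le, Real.enorm_of_nonneg (by have := hx.1; positivity),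
      ENNReal.ofReal_rpow_of_pos hx.1]
  have key2 : ∫⁻ x in Set.Ioo (-1 : ℝ) 0, hB ‖x‖ₑ < ⊤ := by
    have := (Measure.measurePreserving_neg (volume : Measure ℝ)).setLIntegral_comp_preimage
      (measurableSet_Ioo (a := (0:ℝ)) (b := 1)) (f := fun x => hB ‖x‖ₑ)
      (hB_meas.comp measurable_enorm)
    have e : (Neg.neg ⁻¹' Set.Ioo (0:ℝ) 1) = Set.Ioo (-1) 0 := by ext; simp [and_comm, neg_lt]
    rw [e] at this
    simp only [enorm_neg] at this
    rwa [this]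
  have : (Set.Icc (-1:ℝ) 1) ⊆ (Set.Ioo (-1) 0 ∪ Set.Ioo 0 1) ∪ {-1, 0, 1} := by
    intro x hx
    simp only [Set.mem_union, Set.mem_Ioo, Set.mem_insert_iff, Set.mem_singleton_iff, Set.mem_Icc] at *
    grind
  refine (lintegral_mono_set this).trans_lt ?_
  refine (lintegral_union_le _ _ _).trans_lt ?_
  have z : (volume : Measure ℝ) {-1, 0, 1} = 0 := (Set.Finite.measure_zero (by simp) _)
  rw [Measure.restrict_zero_set z]
  simp only [lintegral_zero_measure, add_zero]
  exact (lintegral_union_le _ _ _).trans_lt (ENNReal.add_lt_top.2 ⟨key2, key⟩)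

noncomputable def KB : ENNReal := 2 + ∫⁻ x in Set.Icc (-1 : ℝ) 1, hB ‖x‖ₑ

lemma KB_lt : KB < ⊤ := ENNReal.add_lt_top.2 ⟨by simp, hB_int_loc⟩

lemma hB_shift (r : ℝ) : ∫⁻ x, hB ‖x + r‖ₑ ∂nuB ≤ KB := by
  have h1 : ∀ x : ℝ, hB ‖x‖ₑ ≤ 1 + (Set.Icc (-1:ℝ) 1).indicator (fun x => hB ‖x‖ₑ) x := by
    intro x
    by_cases hx : x ∈ Set.Icc (-1:ℝ) 1
    · rw [Set.indicator_of_mem hx]; exact le_add_self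
    · rw [Set.indicator_of_notMem hx, add_zero]
      have : hB 1 = 1 := by unfold hB; simp
      rw [← this]
      apply hB_anti
      rw [← ofReal_norm, ENNReal.one_le_ofReal]
      rw [Set.mem_Icc, ← abs_le, not_le] at hx
      exact hx.le
  calc _ ≤ ∫⁻ x, (1 + (Set.Icc (-1:ℝ) 1).indicator (fun x => hB ‖x‖ₑ) (x + r)) ∂nuB :=
        lintegral_mono fun x => h1 _
    _ = nuB Set.univ + ∫⁻ x, (Set.Icc (-1:ℝ) 1).indicator (fun x => hB ‖x‖ₑ) (x + r) ∂nuB := by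
        rw [lintegral_add_left measurable_const]; simp
    _ ≤ 2 + ∫⁻ x, (Set.Icc (-1:ℝ) 1).indicator (fun x => hB ‖x‖ₑ) (x + r) := by
        gcongr
        · unfold nuB; simp; norm_num
        · exact Measure.restrict_le_self
    _ = KB := by
        rw [lintegral_add_right_eq_self (fun x => (Set.Icc (-1:ℝ) 1).indicator (fun x => hB ‖x‖ₑ) x),
          lintegral_indicator measurableSet_Icc]; rfl

lemma hB_affine (w s : ℝ) (hw : w ≠ 0) : ∫⁻ x, hB ‖w * x + s‖ₑ ∂nuB ≤ KB * hB ‖w‖ₑ := by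
  have : ∀ x, hB ‖w * x + s‖ₑ = hB ‖w‖ₑ * hB ‖x + s / w‖ₑ := by
    intro x; rw [← hB_mul]; congr 2; field_simp
  simp_rw [this]
  rw [lintegral_const_mul _ (by exact hB_meas.comp (by fun_prop)), mul_comm]
  gcongr
  exact hB_shift _

lemma slab_affine (w s t : ℝ) (hw : w ≠ 0) :
    ∫⁻ x, {y : ℝ | |y| < t}.indicator 1 (w * x + s) ∂nuB ≤ 2 * ENNReal.ofReal t * ‖w‖ₑ⁻¹ := by
  have h : ∀ x, {y : ℝ | |y| < t}.indicator (1 : ℝ → ENNReal) (w * x + s)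
      = (ball (-(s/w)) (t / |w|)).indicator 1 x := by
    intro x
    simp only [Set.indicator_apply, Set.mem_ofPred_eq, Pi.one_apply]
    congr 1
    rw [mem_ball, Real.dist_eq, lt_div_iff₀ (abs_pos.2 hw), ← abs_mul]
    congr! 2
    field_simp
    ring_nf
  simp_rw [h]
  rw [lintegral_indicator_one measurableSet_ball]
  refine (Measure.restrict_le_self _).trans ?_
  rw [Real.volume_ball, ENNReal.ofReal_mul (by norm_num), ENNReal.ofReal_div_of_pos (abs_pos.2 hw),
    ← Real.norm_eq_abs, ofReal_norm, div_eq_mul_inv]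
  simp [mul_assoc]

lemma lin_int {n : ℕ} (f : ℝ → ENNReal) (hf : Measurable f) (w : Fin (n+1) → ℝ) (i : Fin (n+1))
    (K : ENNReal) (hK : ∀ s, ∫⁻ x, f (w i * x + s) ∂nuB ≤ K) :
    ∫⁻ a : Fin (n+1) → ℝ, f (∑ j, a j * w j) ∂(Measure.pi fun _ => nuB) ≤
      K * (Measure.pi fun _ : Fin n => nuB) Set.univ := by
  have hm : Measurable fun a : Fin (n+1) → ℝ => f (∑ j, a j * w j) := hf.comp (by fun_prop)
  rw [lint_split nuB n i _ hm]
  rw [← lintegral_const]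
  refine lintegral_mono fun y => ?_
  refine le_trans (le_of_eq ?_) (hK (∑ j, y j * w (i.succAbove j)))
  refine lintegral_congr fun x => ?_
  rw [Fin.sum_univ_succAbove _ i]
  simp [mul_comm]

lemma exists_enorm_eq {n : ℕ} (w : Fin (n+1) → ℝ) : ∃ i, ‖w‖ₑ = ‖w i‖ₑ := by
  obtain ⟨i, hi⟩ := Finite.exists_max (fun i => ‖w i‖)
  refine ⟨i, ?_⟩
  rw [← ofReal_norm, ← ofReal_norm]
  congr 1
  exact le_antisymm ((pi_norm_le_iff_of_nonneg (norm_nonneg _)).2 hi) (norm_le_pi_norm w i)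

noncomputable def CB (n : ℕ) : ENNReal := KB * (Measure.pi fun _ : Fin n => nuB) Set.univ + 1

lemma CB_lt (n : ℕ) : CB n < ⊤ :=
  ENNReal.add_lt_top.2 ⟨ENNReal.mul_lt_top KB_lt (measure_lt_top _ _), by simp⟩

lemma J_le {n : ℕ} (w : Fin (n+1) → ℝ) :
    ∫⁻ a : Fin (n+1) → ℝ, hB ‖∑ j, a j * w j‖ₑ ∂(Measure.pi fun _ => nuB) ≤ CB n * hB ‖w‖ₑ := by
  by_cases hw : w = 0
  · have : hB ‖w‖ₑ = ⊤ := by subst hw; unfold hB; simp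
    rw [this, ENNReal.mul_top (by unfold CB; simp)]
    exact le_top
  · obtain ⟨i, hi⟩ := exists_enorm_eq w
    have hi0 : w i ≠ 0 := by
      intro h; rw [h] at hi; simp at hi; exact hw hi
    refine (lin_int (fun x => hB ‖x‖ₑ) (hB_meas.comp measurable_enorm) w i _
      (fun s => hB_affine (w i) s hi0)).trans ?_
    rw [hi, mul_right_comm]
    gcongr
    exact le_self_add

lemma slab_le {n : ℕ} (w : Fin (n+1) → ℝ) (t : ℝ) (ht : 0 < t) :
    ∫⁻ a : Fin (n+1) → ℝ, {y : ℝ | |y| < t}.indicator 1 (∑ j, a j * w j) ∂(Measure.pi fun _ => nuB)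
      ≤ 2 * ENNReal.ofReal t * (CB n * ‖w‖ₑ⁻¹) := by
  by_cases hw : w = 0
  · have : ‖w‖ₑ⁻¹ = ⊤ := by subst hw; simp
    rw [this, ENNReal.mul_top (by unfold CB; simp), ENNReal.mul_top (by simpa using ht)]
    exact le_top
  · obtain ⟨i, hi⟩ := exists_enorm_eq w
    have hi0 : w i ≠ 0 := by
      intro h; rw [h] at hi; simp at hi; exact hw hi
    refine (lin_int ({y : ℝ | |y| < t}.indicator 1) (measurable_one.indicator
      (measurableSet_lt (by fun_prop) (by fun_prop))) w i _
      (fun s => slab_affine (w i) s t hi0)).trans ?_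
    rw [hi, mul_assoc, mul_comm (‖w i‖ₑ⁻¹)]
    gcongr
    unfold CB
    refine le_trans ?_ le_self_add
    refine le_mul_of_one_le_left' ?_
    unfold KB
    exact le_trans (by norm_num) le_self_add

noncomputable def wB {k : ℕ} (U : Fin k → Fin (k+1) → ℝ) (j : Fin (k+1)) : ℝ :=
  (-1) ^ (j : ℕ) * (Matrix.of fun i l => U i (j.succAbove l)).det

lemma wB_cont {k : ℕ} : Continuous (wB (k := k)) := by
  refine continuous_pi fun j => ?_
  unfold wB
  refine continuous_const.mul (Continuous.matrix_det ?_)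
  refine continuous_matrix fun i l => ?_
  simp only [Matrix.of_apply]
  fun_prop

lemma det_cons {k : ℕ} (a : Fin (k+1) → ℝ) (U : Fin k → Fin (k+1) → ℝ) :
    (Matrix.of (Fin.cons a U : Fin (k+1) → Fin (k+1) → ℝ)).det = ∑ j, a j * wB U j := by
  rw [Matrix.det_succ_row_zero]
  refine Finset.sum_congr rfl fun j _ => ?_
  unfold wB
  simp only [Matrix.of_apply, Fin.cons_zero]
  have : (Matrix.of (Fin.cons a U : Fin (k+1) → Fin (k+1) → ℝ)).submatrix Fin.succ j.succAbove
    = (Matrix.of fun i l => U i (j.succAbove l)) := by ext; simp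
  rw [this]; ring

lemma wB_bound {k : ℕ} (a b : Fin (k+1) → ℝ) (U : Fin k → Fin (k+1) → ℝ)
    (V : Fin (k+1) → Fin (k+2) → ℝ)
    (hV : V = fun i j => (Fin.cons b (Fin.cons a U : Fin (k+1) → Fin (k+1) → ℝ) :
      Fin (k+2) → Fin (k+1) → ℝ) j i) :
    ‖wB V‖ₑ⁻¹ ≤ hB ‖∑ j, a j * wB U j‖ₑ * hB ‖∑ j, b j * wB U j‖ₑ := by
  have hn : ∀ j, ‖wB V j‖ₑ ≤ ‖wB V‖ₑ := fun j => by
    rw [← ofReal_norm, ← ofReal_norm]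
    exact ENNReal.ofReal_le_ofReal (norm_le_pi_norm _ j)
  have h0 : ‖wB V 0‖ₑ = ‖∑ j, a j * wB U j‖ₑ := by
    rw [← det_cons, ← Matrix.det_transpose]
    unfold wB
    simp only [enorm_mul, enorm_pow, enorm_neg, enorm_one, one_pow, one_mul]
    congr 2
    subst hV
    ext i l
    simp
  have h1 : ‖wB V 1‖ₑ = ‖∑ j, b j * wB U j‖ₑ := by
    rw [← det_cons, ← Matrix.det_transpose]
    unfold wB
    simp only [enorm_mul, enorm_pow, enorm_neg, enorm_one, one_pow, one_mul]
    congr 2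
    subst hV
    ext i l
    refine Fin.cases ?_ (fun l => ?_) l
    · simp
    · simp only [Matrix.of_apply, Matrix.transpose_apply, Fin.cons_succ]
      rw [show (1 : Fin (k+2)) = Fin.succ 0 from rfl, Fin.succ_succAbove_succ]
      simp
  rw [← hB_sq]
  exact mul_le_mul' (hB_anti (h0 ▸ hn 0)) (hB_anti (h1 ▸ hn 1))

lemma Q (k : ℕ) : ∫⁻ U : Fin k → Fin (k+1) → ℝ, ‖wB U‖ₑ⁻¹
    ∂(Measure.pi fun _ => Measure.pi fun _ => nuB) < ⊤ := by
  induction k with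
  | zero =>
    have : ∀ U : Fin 0 → Fin 1 → ℝ, ‖wB U‖ₑ⁻¹ = 1 := by
      intro U
      obtain ⟨i, hi⟩ := exists_enorm_eq (wB U)
      rw [hi]
      unfold wB
      simp
    simp_rw [this]
    simp
  | succ k ih =>
    have hm : Measurable (fun V : Fin (k+1) → Fin (k+2) → ℝ => ‖wB V‖ₑ⁻¹) :=
      (measurable_enorm.comp wB_cont.measurable).inv
    have hm2 : Measurable (fun V : Fin (k+2) → Fin (k+1) → ℝ => ‖wB (fun i j => V j i)‖ₑ⁻¹) :=
      hm.comp (by fun_prop)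
    rw [lint_transpose _ _ hm, lint_split _ _ 0 _ hm2, lint_split _ _ 0]
    swap
    · refine Measurable.lintegral_prod_right' (f := fun p : (Fin (k+1) → Fin (k+1) → ℝ) × (Fin (k+1) → ℝ) =>
        ‖wB (fun i j => (Fin.insertNth 0 p.2 p.1 : Fin (k+2) → Fin (k+1) → ℝ) j i)‖ₑ⁻¹) ?_
      refine hm2.comp (g := fun V : Fin (k+2) → Fin (k+1) → ℝ => ‖wB (fun i j => V j i)‖ₑ⁻¹) (f := fun p : (Fin (k+1) → Fin (k+1) → ℝ) × (Fin (k+1) → ℝ) => (Fin.insertNth 0 p.2 p.1 : Fin (k+2) → Fin (k+1) → ℝ)) ?_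
      refine Continuous.measurable ?_
      fun_prop
    simp only [Fin.insertNth_zero']
    calc _ ≤ ∫⁻ U : Fin k → Fin (k+1) → ℝ, ∫⁻ a : Fin (k+1) → ℝ, ∫⁻ b : Fin (k+1) → ℝ,
          hB ‖∑ j, a j * wB U j‖ₑ * hB ‖∑ j, b j * wB U j‖ₑ ∂(Measure.pi fun _ => nuB)
          ∂(Measure.pi fun _ => nuB) ∂(Measure.pi fun _ => Measure.pi fun _ => nuB) := by
          refine lintegral_mono fun U => lintegral_mono fun a => lintegral_mono fun b => ?_
          exact wB_bound a b U _ rfl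
      _ ≤ ∫⁻ U : Fin k → Fin (k+1) → ℝ, (CB k * CB k) * ‖wB U‖ₑ⁻¹
          ∂(Measure.pi fun _ => Measure.pi fun _ => nuB) := by
          refine lintegral_mono fun U => ?_
          have hmm : Measurable fun b : Fin (k+1) → ℝ => hB ‖∑ j, b j * wB U j‖ₑ :=
            hB_meas.comp (by fun_prop)
          simp_rw [lintegral_const_mul _ hmm]
          rw [lintegral_mul_const _ hmm, ← hB_sq, mul_mul_mul_comm]
          exact mul_le_mul' (J_le _) (J_le _)
      _ < ⊤ := by
          rw [lintegral_const_mul' _ _ (ENNReal.mul_lt_top (CB_lt _) (CB_lt _)).ne]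
          exact ENNReal.mul_lt_top (ENNReal.mul_lt_top (CB_lt _) (CB_lt _)) ih

lemma det_small (k : ℕ) : ∃ C : ENNReal, C < ⊤ ∧ ∀ t : ℝ, 0 < t →
    (Measure.pi fun _ : Fin (k+1) => Measure.pi fun _ : Fin (k+1) => nuB)
      {V | |(Matrix.of V).det| < t} ≤ ENNReal.ofReal t * C := by
  refine ⟨2 * CB k * ∫⁻ U : Fin k → Fin (k+1) → ℝ, ‖wB U‖ₑ⁻¹
    ∂(Measure.pi fun _ => Measure.pi fun _ => nuB),
    ENNReal.mul_lt_top (ENNReal.mul_lt_top (by simp) (CB_lt _)) (Q k), fun t ht => ?_⟩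
  have hdet : Measurable fun V : Fin (k+1) → Fin (k+1) → ℝ => (Matrix.of V).det := by
    refine Continuous.measurable (Continuous.matrix_det ?_)
    exact continuous_id
  have hs : MeasurableSet {V : Fin (k+1) → Fin (k+1) → ℝ | |(Matrix.of V).det| < t} :=
    measurableSet_lt (by exact continuous_abs.measurable.comp hdet) measurable_const
  rw [← lintegral_indicator_one hs, lint_split _ _ 0 _ (measurable_one.indicator hs),
    ← lintegral_const_mul' _ _ (ENNReal.mul_lt_top (by simp) (CB_lt _)).ne,
    ← lintegral_const_mul' _ _ (by simp)]
  refine lintegral_mono fun U => ?_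
  refine le_trans (le_of_eq ?_) ((slab_le (wB U) t ht).trans (le_of_eq (by ring)))
  refine lintegral_congr fun a => ?_
  simp only [Set.indicator_apply, Set.mem_ofPred_eq, Fin.insertNth_zero', det_cons]
  rfl

/-- For every `d ≥ 1` there is `c(d) > 0` such that for every
`0 < δ ≤ 1`: the Lebesgue measure of the set of `d × d` real matrices `M` in the unit
ball of `ℝ^(d²)` (Frobenius norm) with `|det M| < c(d) * δ` is at most `δ` times the
Lebesgue measure of the unit ball.  Equivalently, a matrix chosen uniformly at random
from the unit ball satisfies `|det M| ≥ c(d) * δ` with probability at least `1 - δ`. -/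
theorem statement16 (d : ℕ) (hd : 1 ≤ d) :
    ∃ c : ℝ, 0 < c ∧
      ∀ δ : ℝ, 0 < δ → δ ≤ 1 →
        volume {M : EuclideanSpace ℝ (Fin d × Fin d) |
            M ∈ Metric.closedBall (0 : EuclideanSpace ℝ (Fin d × Fin d)) 1 ∧
            |Matrix.det (Matrix.of fun i j : Fin d => M (i, j))| < c * δ} ≤
          ENNReal.ofReal δ *
            volume (Metric.closedBall (0 : EuclideanSpace ℝ (Fin d × Fin d)) 1) := by
  obtain ⟨k, rfl⟩ : ∃ k, d = k + 1 := ⟨d - 1, by omega⟩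
  obtain ⟨C, hC, h⟩ := det_small k
  set B := volume (Metric.closedBall (0 : EuclideanSpace ℝ (Fin (k+1) × Fin (k+1))) 1) with hB
  have hB0 : 0 < B := measure_closedBall_pos _ _ one_pos
  have hBt : B < ⊤ := measure_closedBall_lt_top
  have hb : 0 < B.toReal := ENNReal.toReal_pos hB0.ne' hBt.ne
  have hc : 0 < B.toReal / (C.toReal + 1) := by positivity
  refine ⟨B.toReal / (C.toReal + 1), hc, fun δ hδ _ => ?_⟩
  set t := B.toReal / (C.toReal + 1) * δ with ht
  have htp : 0 < t := by positivity
  have h2 : ENNReal.ofReal t * C ≤ ENNReal.ofReal δ * B := by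
    rw [← ENNReal.ofReal_toReal hC.ne, ← ENNReal.ofReal_toReal hBt.ne,
      ← ENNReal.ofReal_mul htp.le, ← ENNReal.ofReal_mul hδ.le]
    apply ENNReal.ofReal_le_ofReal
    rw [ht, div_mul_eq_mul_div, div_mul_eq_mul_div, div_le_iff₀ (by positivity)]
    nlinarith [mul_pos hb hδ]
  refine le_trans ?_ ((h t htp).trans h2)
  have hdet : Measurable fun V : Fin (k+1) × Fin (k+1) → ℝ =>
      (Matrix.of fun i j => V (i, j)).det := by
    refine Continuous.measurable (Continuous.matrix_det ?_)
    refine continuous_matrix fun i l => ?_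
    simp only [Matrix.of_apply]
    fun_prop
  have hs : MeasurableSet {V : Fin (k+1) × Fin (k+1) → ℝ |
      |(Matrix.of fun i j => V (i, j)).det| < t} :=
    measurableSet_lt (by exact continuous_abs.measurable.comp hdet) measurable_const
  have e1 := (mp_uncurry (ι := Fin (k+1)) (κ := Fin (k+1)) nuB).measure_preimage hs.nullMeasurableSet
  refine le_trans ?_ (le_of_eq e1.symm)
  have e2 : (Measure.pi fun _ : Fin (k+1) × Fin (k+1) => nuB) =
      volume.restrict (Set.univ.pi fun _ => Set.Icc (-1) 1) := by
    rw [volume_pi, Measure.restrict_pi_pi]; rfl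
  rw [e2, Measure.restrict_apply hs]
  have hS : MeasurableSet ({V : Fin (k+1) × Fin (k+1) → ℝ |
      |(Matrix.of fun i j => V (i, j)).det| < t} ∩ (Set.univ.pi fun _ => Set.Icc (-1) 1)) :=
    hs.inter (MeasurableSet.univ_pi fun _ => measurableSet_Icc)
  rw [← (EuclideanSpace.volume_preserving_symm_measurableEquiv_toLp
    (Fin (k+1) × Fin (k+1))).measure_preimage hS.nullMeasurableSet]
  refine measure_mono fun M hM => ?_
  refine ⟨hM.2, fun p _ => ?_⟩
  have := (PiLp.norm_apply_le M p).trans (mem_closedBall_zero_iff.1 hM.1)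
  exact abs_le.1 this
end

section
/- Let n ≥ 1, ρ > 0, and let m ≤ n. There is a constant C(n,ρ) > 0 with the following property: let q₀, …, q_m be points of ℝⁿ with pairwise distances at most ρ, and let v₀, …, v_m be independent random points, with v_i distributed uniformly in the closed unit ball centered at q_i. Fix 0 ≤ j < m and let Δ₁ = convexHull{v₀, …, v_j} and Δ₂ = convexHull{v_{j+1}, …, v_m}. Then for all ε₁, ε₂ > 0, the probability that the open ε₁-neighborhood of Δ₁ and the open ε₂-neighborhood of Δ₂ have a common point is at most C(n,ρ)·(ε₁ + ε₂). -/
open Metric Set Function MeasureTheory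

lemma s17_hull {ι E : Type*} [Fintype ι] [NormedAddCommGroup E] [NormedSpace ℝ E]
    (v : ι → E) (S : Set ι) (y : E) (hy : y ∈ convexHull ℝ (v '' S)) :
    ∃ w : ι → ℝ, (∀ k, 0 ≤ w k) ∧ ∑ k, w k = 1 ∧ (∀ k, k ∉ S → w k = 0) ∧
      ∑ k, w k • v k = y := by
  classical
  have := convexHull_min (s := v '' S) (t := {y | ∃ w : ι → ℝ, (∀ k, 0 ≤ w k) ∧ ∑ k, w k = 1 ∧
    (∀ k, k ∉ S → w k = 0) ∧ ∑ k, w k • v k = y}) (𝕜 := ℝ) ?_ ?_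
  · exact this hy
  · rintro _ ⟨i, hi, rfl⟩
    refine ⟨Pi.single i 1, fun k => ?_, ?_, fun k hk => ?_, ?_⟩
    · by_cases h : k = i
      · subst h; simp
      · simp [h]
    · simp
    · have : k ≠ i := by rintro rfl; exact hk hi
      simp [this]
    · rw [Finset.sum_eq_single i]
      · simp
      · intro b _ hb; simp [hb]
      · simp
  · rintro x ⟨w, hw, hw1, hwS, rfl⟩ y ⟨w', hw', hw1', hwS', rfl⟩ a b ha hb hab
    refine ⟨fun k => a * w k + b * w' k, fun k => ?_, ?_, fun k hk => ?_, ?_⟩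
    · have := hw k; have := hw' k; positivity
    · rw [Finset.sum_add_distrib, ← Finset.mul_sum, ← Finset.mul_sum, hw1, hw1']; linarith
    · simp [hwS k hk, hwS' k hk]
    · simp only [add_smul, Finset.sum_add_distrib, mul_smul, Finset.smul_sum]

/-- degenerate set -/
def s17B (n m : ℕ) (i : Fin (m + 1)) (δ : ℝ) : Set (Fin (m + 1) → EuclideanSpace ℝ (Fin n)) :=
  {v | ∃ c : Fin (m + 1) → ℝ, c i = 1 ∧ ∑ k, c k = 0 ∧ ‖∑ k, c k • v k‖ < δ}

lemma s17B_open (n m : ℕ) (i : Fin (m + 1)) (δ : ℝ) : IsOpen (s17B n m i δ) := by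
  have : s17B n m i δ = ⋃ c : Fin (m + 1) → ℝ, ⋃ _ : c i = 1, ⋃ _ : ∑ k, c k = 0,
      {v : Fin (m + 1) → EuclideanSpace ℝ (Fin n) | ‖∑ k, c k • v k‖ < δ} := by
    ext v; simp only [s17B, mem_iUnion, exists_prop, mem_ofPred_eq]
  rw [this]
  refine isOpen_iUnion fun c => isOpen_iUnion fun _ => isOpen_iUnion fun _ => ?_
  exact isOpen_lt (by fun_prop) continuous_const

lemma s17_sub (n m : ℕ) (hm : m ≤ n) (j : ℕ) (ε₁ ε₂ : ℝ) :
    {v : Fin (m + 1) → EuclideanSpace ℝ (Fin n) |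
      (Metric.thickening ε₁
        (convexHull ℝ (v '' {i : Fin (m + 1) | (i : ℕ) ≤ j})) ∩
      Metric.thickening ε₂
        (convexHull ℝ (v '' {i : Fin (m + 1) | j < (i : ℕ)}))).Nonempty} ⊆
    ⋃ i, s17B n m i ((n + 1) * (ε₁ + ε₂)) := by
  rintro v ⟨x, h1, h2⟩
  obtain ⟨y, hy, hxy⟩ := Metric.mem_thickening_iff.1 h1
  obtain ⟨z, hz, hxz⟩ := Metric.mem_thickening_iff.1 h2
  obtain ⟨w, hw, hw1, hwS, rfl⟩ := s17_hull v _ y hy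
  obtain ⟨w', hw', hw1', hwS', rfl⟩ := s17_hull v _ z hz
  have hd : ‖∑ k, (w k - w' k) • v k‖ < ε₁ + ε₂ := by
    simp only [sub_smul, Finset.sum_sub_distrib]
    rw [← dist_eq_norm]
    calc _ ≤ _ := dist_triangle_left _ _ x
      _ < _ := by linarith
  obtain ⟨i, -, hi⟩ : ∃ i ∈ (Finset.univ : Finset (Fin (m+1))), (1 / (m + 1) : ℝ) ≤ w i := by
    apply Finset.exists_le_of_sum_le (by simp)
    rw [hw1]; simp; field_simp; rfl
  have hm0 : (0:ℝ) < m + 1 := by positivity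
  have hpos : 0 < w i := lt_of_lt_of_le (by positivity) hi
  have hiS : (i : ℕ) ≤ j := by
    by_contra h
    exact hpos.ne' (hwS i h)
  have hi' : w' i = 0 := hwS' i (by simpa using hiS)
  refine mem_iUnion.2 ⟨i, fun k => (w i)⁻¹ * (w k - w' k), ?_, ?_, ?_⟩
  · simp [hi', hpos.ne']
  · rw [← Finset.mul_sum, Finset.sum_sub_distrib, hw1, hw1']; simp
  · simp only [mul_smul, ← Finset.smul_sum]
    rw [norm_smul, norm_inv, Real.norm_of_nonneg hpos.le]
    have h3 : (w i)⁻¹ ≤ n + 1 := by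
      rw [inv_le_comm₀ hpos (by positivity)]
      refine le_trans ?_ hi
      rw [one_div]
      have : (m:ℝ) ≤ n := by exact_mod_cast hm
      gcongr
    calc _ ≤ ((n:ℝ)+1) * ‖∑ k, (w k - w' k) • v k‖ := by gcongr
      _ < _ := by gcongr

lemma s17_slab (n : ℕ) (u : EuclideanSpace ℝ (Fin n)) (hu : ‖u‖ = 1) (t δ : ℝ)
    (q : EuclideanSpace ℝ (Fin n)) :
    volume ({x | |inner ℝ u x - t| ≤ δ} ∩ closedBall q 1) ≤ ENNReal.ofReal (2 ^ n * δ) := by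
  classical
  have hn : 0 < n := by
    rcases Nat.eq_zero_or_pos n with rfl | h
    · rw [Subsingleton.elim u 0] at hu; simp at hu
    · exact h
  let i0 : Fin n := ⟨0, hn⟩
  obtain ⟨b, hb⟩ := Orthonormal.exists_orthonormalBasis_extension_of_card_eq
    (𝕜 := ℝ) (E := EuclideanSpace ℝ (Fin n)) (ι := Fin n) (by simp) (v := fun _ => u) (s := {i0})
    (by
      constructor
      · rintro ⟨i, hi⟩; simpa using hu
      · rintro ⟨i, hi⟩ ⟨k, hk⟩ h
        exact absurd (Subtype.ext (hi.trans hk.symm)) h)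
  have hb0 : b i0 = u := hb i0 rfl
  let lo : Fin n → ℝ := fun k => if k = i0 then t - δ else inner ℝ (b k) q - 1
  let hi : Fin n → ℝ := fun k => if k = i0 then t + δ else inner ℝ (b k) q + 1
  have mp := (PiLp.volume_preserving_ofLp (Fin n)).comp b.measurePreserving_repr
  have hsub : ({x | |inner ℝ u x - t| ≤ δ} ∩ closedBall q 1) ⊆
      (WithLp.ofLp ∘ b.repr) ⁻¹' (Icc lo hi) := by
    rintro x ⟨hx, hxq⟩
    rw [mem_ofPred_eq] at hx
    have key : ∀ k, lo k ≤ inner ℝ (b k) x ∧ inner ℝ (b k) x ≤ hi k := by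
      intro k
      by_cases hk : k = i0
      · subst hk
        simp only [lo, hi, if_true, hb0]
        have := abs_le.1 hx
        constructor <;> linarith
      · simp only [lo, hi, if_neg hk]
        have h1 : |inner ℝ (b k) (x - q)| ≤ 1 := by
          refine (abs_real_inner_le_norm _ _).trans ?_
          rw [b.norm_eq_one, one_mul]
          simpa [dist_eq_norm] using hxq
        rw [inner_sub_right] at h1
        have := abs_le.1 h1
        constructor <;> linarith
    refine ⟨fun k => ?_, fun k => ?_⟩
    · simpa [b.repr_apply_apply] using (key k).1
    · simpa [b.repr_apply_apply] using (key k).2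
  refine (measure_mono hsub).trans ?_
  rw [mp.measure_preimage measurableSet_Icc.nullMeasurableSet, Real.volume_Icc_pi,
    ← Finset.mul_prod_erase Finset.univ _ (Finset.mem_univ i0)]
  rw [Finset.prod_congr rfl (g := fun _ => ENNReal.ofReal 2)]
  · rw [Finset.prod_const, Finset.card_erase_of_mem (Finset.mem_univ _), Finset.card_univ,
      Fintype.card_fin, ← ENNReal.ofReal_pow (by norm_num), mul_comm, ← ENNReal.ofReal_mul (by positivity)]
    apply le_of_eq
    congr 1
    obtain ⟨k, rfl⟩ : ∃ k, n = k + 1 := ⟨n - 1, by omega⟩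
    simp [lo, hi, pow_succ]; ring
  · intro k hk
    have : k ≠ i0 := Finset.ne_of_mem_erase hk
    simp only [lo, hi, if_neg this]
    congr 1; ring

lemma s17_hyper (n m : ℕ) (hm : m ≤ n) (hm0 : 0 < m) (w : Fin m → EuclideanSpace ℝ (Fin n)) :
    ∃ u : EuclideanSpace ℝ (Fin n), ‖u‖ = 1 ∧ ∃ t : ℝ, ∀ k, inner ℝ u (w k) = t := by
  obtain ⟨l, rfl⟩ : ∃ k, m = k + 1 := ⟨m - 1, by omega⟩
  have h1 := finrank_vectorSpan_range_le ℝ w (n := l) (by simp)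
  have hne : (vectorSpan ℝ (range w))ᗮ ≠ ⊥ := by
    intro h
    rw [Submodule.orthogonal_eq_bot_iff] at h
    rw [h, finrank_top] at h1
    simp at h1; omega
  obtain ⟨u, hu, hu0⟩ := Submodule.exists_mem_ne_zero_of_ne_bot hne
  have hun : ‖u‖ ≠ 0 := by simpa using hu0
  refine ⟨‖u‖⁻¹ • u, by rw [norm_smul]; simp [hun], inner ℝ (‖u‖⁻¹ • u) (w 0), fun k => ?_⟩
  have h2 := (Submodule.mem_orthogonal' _ _).1 hu (w k - w 0)
    (vsub_mem_vectorSpan ℝ (mem_range_self k) (mem_range_self 0))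
  rw [inner_sub_right] at h2
  simp only [inner_smul_left]
  rw [sub_eq_zero.1 h2]

lemma s17_B_meas (n m : ℕ) (hm : m ≤ n) (hm0 : 0 < m) (i : Fin (m + 1)) (δ : ℝ)
    (q : Fin (m + 1) → EuclideanSpace ℝ (Fin n)) :
    (Measure.pi fun i : Fin (m + 1) => volume.restrict (Metric.closedBall (q i) 1))
      (s17B n m i δ) ≤ ENNReal.ofReal (2 ^ n * δ) *
        (volume (closedBall (0 : EuclideanSpace ℝ (Fin n)) 1)) ^ m := by
  have mp := (measurePreserving_piFinSuccAbove
    (fun i : Fin (m + 1) => (volume.restrict (Metric.closedBall (q i) 1) :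
      Measure (EuclideanSpace ℝ (Fin n)))) i).symm
  rw [← mp.measure_preimage (s17B_open n m i δ).measurableSet.nullMeasurableSet,
    Measure.prod_apply_symm (mp.measurable (s17B_open n m i δ).measurableSet)]
  calc _ ≤ ∫⁻ _, ENNReal.ofReal (2 ^ n * δ) ∂(Measure.pi fun k : Fin m =>
        volume.restrict (Metric.closedBall (q (i.succAbove k)) 1)) := by
        refine lintegral_mono fun w => ?_
        obtain ⟨u, hu, t, ht⟩ := s17_hyper n m hm hm0 w
        refine le_trans ?_ (s17_slab n u hu t δ (q i))
        rw [Measure.restrict_apply' measurableSet_closedBall]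
        refine measure_mono (inter_subset_inter_left _ ?_)
        rintro x ⟨c, hc, hc0, hlt⟩
        rw [Fin.sum_univ_succAbove _ i] at hc0 hlt
        simp only [MeasurableEquiv.piFinSuccAbove_symm_apply, Fin.insertNthEquiv_apply,
          Fin.insertNth_apply_same, Fin.insertNth_apply_succAbove, hc, one_smul] at hlt hc0
        have h1 := abs_real_inner_le_norm u (x + ∑ k, c (i.succAbove k) • w k)
        rw [hu, one_mul, inner_add_right, inner_sum] at h1
        simp only [inner_smul_right, ht] at h1
        rw [← Finset.sum_mul] at h1
        have h2 : ∑ k, c (i.succAbove k) = -1 := by linarith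
        rw [h2] at h1
        simp only [mem_ofPred_eq]
        rw [sub_eq_add_neg, ← neg_one_mul]
        exact h1.trans hlt.le
    _ = _ := by
        rw [lintegral_const, Measure.pi_univ]
        simp [Measure.addHaar_closedBall_center]


/-- Let `n ≥ 1`, `ρ > 0`, `m ≤ n`.  There is `C(n, ρ) > 0` such that:
if `q 0, …, q m` are points of `ℝⁿ` with pairwise distances at most `ρ`, and
`v 0, …, v m` are independent random points, `v i` uniform in the closed unit ball
around `q i`, then for `0 ≤ j < m` and all `ε₁, ε₂ > 0` the probability that the open
`ε₁`-neighborhood of `convexHull {v 0, …, v j}` meets the open `ε₂`-neighborhood of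
`convexHull {v (j+1), …, v m}` is at most `C(n, ρ) * (ε₁ + ε₂)`.  (The probability is
expressed against the product `μ` of the restrictions of Lebesgue measure to the unit
balls: `μ(bad) ≤ ENNReal.ofReal (C * (ε₁ + ε₂)) * μ(univ)`.) -/
theorem statement17 (n : ℕ) (hn : 1 ≤ n) (ρ : ℝ) (hρ : 0 < ρ) :
    ∃ C : ℝ, 0 < C ∧
      ∀ (m : ℕ), m ≤ n →
        ∀ q : Fin (m + 1) → EuclideanSpace ℝ (Fin n),
          (∀ i j : Fin (m + 1), dist (q i) (q j) ≤ ρ) →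
          ∀ j : ℕ, j < m →
            ∀ ε₁ ε₂ : ℝ, 0 < ε₁ → 0 < ε₂ →
              (Measure.pi fun i : Fin (m + 1) => volume.restrict (Metric.closedBall (q i) 1))
                {v : Fin (m + 1) → EuclideanSpace ℝ (Fin n) |
                  (Metric.thickening ε₁
                      (convexHull ℝ (v '' {i : Fin (m + 1) | (i : ℕ) ≤ j})) ∩
                    Metric.thickening ε₂
                      (convexHull ℝ (v '' {i : Fin (m + 1) | j < (i : ℕ)}))).Nonempty} ≤
              ENNReal.ofReal (C * (ε₁ + ε₂)) *
                (Measure.pi fun i : Fin (m + 1) =>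
                  volume.restrict (Metric.closedBall (q i) 1)) Set.univ := by
  classical
  set V := volume (closedBall (0 : EuclideanSpace ℝ (Fin n)) 1) with hV
  have hV0 : V ≠ 0 := (measure_closedBall_pos _ _ one_pos).ne'
  have hVt : V ≠ ⊤ := measure_closedBall_lt_top.ne
  have hVr : 0 < V.toReal := ENNReal.toReal_pos hV0 hVt
  refine ⟨(n + 1) * (2 ^ n * (n + 1)) / V.toReal, by positivity, ?_⟩
  intro m hm q _ j hj ε₁ ε₂ h1 h2
  refine (measure_mono (s17_sub n m hm j ε₁ ε₂)).trans ?_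
  refine (measure_iUnion_fintype_le _ _).trans ?_
  refine (Finset.sum_le_sum fun i _ => s17_B_meas n m hm (by omega) i _ q).trans ?_
  rw [Finset.sum_const, Measure.pi_univ]
  have hp : ∀ i, (volume.restrict (closedBall (q i) 1)) univ = V := by
    intro i
    rw [Measure.restrict_apply_univ, Measure.addHaar_closedBall_center]
  simp only [hp, Finset.prod_const, Finset.card_univ, Fintype.card_fin]
  suffices key : ((m + 1 : ℕ) : ENNReal) * ENNReal.ofReal (2 ^ n * ((n + 1) * (ε₁ + ε₂))) ≤
      ENNReal.ofReal ((n + 1) * (2 ^ n * (n + 1)) / V.toReal * (ε₁ + ε₂)) * V by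
    calc _ = (((m + 1 : ℕ) : ENNReal) * ENNReal.ofReal (2 ^ n * ((n + 1) * (ε₁ + ε₂)))) * V ^ m := by
          rw [nsmul_eq_mul, mul_assoc]
      _ ≤ (ENNReal.ofReal ((n + 1) * (2 ^ n * (n + 1)) / V.toReal * (ε₁ + ε₂)) * V) * V ^ m := by
          gcongr
      _ = _ := by rw [pow_succ' V m, mul_assoc]
  nth_rewrite 2 [← ENNReal.ofReal_toReal hVt]
  rw [← ENNReal.ofReal_natCast, ← ENNReal.ofReal_mul (by positivity),
    ← ENNReal.ofReal_mul (by positivity)]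
  apply ENNReal.ofReal_le_ofReal
  have : (m:ℝ) ≤ n := by exact_mod_cast hm
  have e : (n + 1) * (2 ^ n * (n + 1)) / V.toReal * (ε₁ + ε₂) * V.toReal
    = ((n:ℝ) + 1) * (2 ^ n * ((n + 1) * (ε₁ + ε₂))) := by field_simp
  rw [e]
  push_cast
  gcongr
end
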